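/- arXiv:2010.00395 — 3 statements merged into one kernel-verified Lean document; each statement's English description precedes it below -/
import Mathlib

section
/- Let n ≥ 2, let K be a convex body in ℝⁿ containing the origin in its interior, let f : S^{n-1} → ℝ be continuous, and let δ > 0 be small enough that h_t := h_K + t f > 0 on S^{n-1} for all t ∈ (−δ, δ). Then: (i) for spherical-Lebesgue almost every u ∈ S^{n-1}, the boundary point ρ_K(u)u has a unique outer unit normal v_u (i.e., a unique v_u ∈ S^{n-1} with ρ_K(u) u·v_u = h_K(v_u)), and lim_{t→0} (ρ_{[h_t]}(u) − ρ_K(u))/t = f(v_u) ρ_K(u) / h_K(v_u); (ii) there exists M > 0 such that |ρ_{[h_t]}(u) − ρ_K(u)| ≤ M|t| for all u ∈ S^{n-1} and all t ∈ (−δ, δ). -/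
open MeasureTheory Metric Set Filter
open scoped RealInnerProductSpace Topology Pointwise NNReal ENNReal

noncomputable section

/-- `ℝⁿ` as Euclidean space. -/
abbrev Eu (n : ℕ) := EuclideanSpace ℝ (Fin n)

/-- The Gaussian measure `γₙ(A) = (2π)^{-n/2} ∫_A e^{-|x|²/2} dx`. -/
def gaussVol (n : ℕ) (A : Set (Eu n)) : ℝ :=
  (Real.sqrt (2 * Real.pi))⁻¹ ^ n * ∫ x in A, Real.exp (-‖x‖ ^ 2 / 2)

/-- A convex body: a compact convex set with nonempty interior. -/
def IsConvexBody {n : ℕ} (K : Set (Eu n)) : Prop :=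
  Convex ℝ K ∧ IsCompact K ∧ (interior K).Nonempty

/-- The support function `h_K(v) = max_{y ∈ K} ⟪y, v⟫`. -/
def suppFun {n : ℕ} (K : Set (Eu n)) (v : Eu n) : ℝ :=
  sSup ((fun y => ⟪y, v⟫) '' K)

/-- The Gaussian surface area measure of `K`, as a set function:
`S_{γₙ,K}(η) = (2π)^{-n/2} ∫_{ν_K⁻¹(η)} e^{-|x|²/2} dH^{n-1}(x)`, where
`ν_K⁻¹(η)` is the set of boundary points of `K` having an outer unit normal in `η`. -/
def gaussSurf (n : ℕ) (K : Set (Eu n)) (η : Set (Eu n)) : ℝ :=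
  (Real.sqrt (2 * Real.pi))⁻¹ ^ n *
    ∫ x in {x | x ∈ frontier K ∧ ∃ v ∈ η, ⟪x, v⟫ = suppFun K v},
      Real.exp (-‖x‖ ^ 2 / 2) ∂μH[(n : ℝ) - 1]

open Classical in
/-- (A choice of) Gauss map of `K`: to a boundary point `x` it assigns an outer unit
normal of `K` at `x` (for a convex body `K`, this is unique for `H^{n-1}`-a.e. `x ∈ ∂K`). -/
def gaussMap {n : ℕ} (K : Set (Eu n)) (x : Eu n) : Eu n :=
  if h : ∃ v : Eu n, ‖v‖ = 1 ∧ ⟪x, v⟫ = suppFun K v then h.choose else 0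

/-- The Wulff shape `[g] = {x : x·v ≤ g v for all unit v}`. -/
def wulff {n : ℕ} (g : Eu n → ℝ) : Set (Eu n) :=
  {x | ∀ v : Eu n, ‖v‖ = 1 → ⟪x, v⟫ ≤ g v}

/-- The radial function `ρ_K(u) = max {r : r • u ∈ K}`. -/
def radialFun {n : ℕ} (K : Set (Eu n)) (u : Eu n) : ℝ :=
  sSup {r : ℝ | r • u ∈ K}

/-- The standard Gaussian distribution function `Φ`. -/
def Phi (x : ℝ) : ℝ :=
  (Real.sqrt (2 * Real.pi))⁻¹ * ∫ t in Iic x, Real.exp (-t ^ 2 / 2)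

/-- The inverse `Φ⁻¹` of the standard Gaussian distribution function. -/
def PhiInv : ℝ → ℝ := Function.invFun Phi

section Aux

variable {n : ℕ} {K : Set (Eu n)}

lemma aux_bdd (hK : IsCompact K) (v : Eu n) : BddAbove ((fun y => ⟪y, v⟫) '' K) :=
  (hK.image (by fun_prop)).bddAbove

lemma aux_le_supp (hK : IsCompact K) {y : Eu n} (hy : y ∈ K) (v : Eu n) :
    ⟪y, v⟫ ≤ suppFun K v :=
  le_csSup (aux_bdd hK v) (mem_image_of_mem _ hy)

lemma aux_supp_le (hne : K.Nonempty) {v : Eu n} {c : ℝ} (h : ∀ y ∈ K, ⟪y, v⟫ ≤ c) :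
    suppFun K v ≤ c :=
  csSup_le (hne.image _) (by rintro _ ⟨y, hy, rfl⟩; exact h y hy)

lemma aux_supp_cont (hK : IsCompact K) (hne : K.Nonempty) : Continuous (suppFun K) := by
  obtain ⟨R, hR⟩ := hK.isBounded.exists_norm_le
  have hR0 : 0 ≤ R := (norm_nonneg _).trans (hR _ hne.some_mem)
  refine (LipschitzWith.of_le_add_mul (⟨R, hR0⟩ : ℝ≥0) fun v w => ?_).continuous
  refine aux_supp_le hne fun y hy => ?_
  have h1 := aux_le_supp hK hy w
  have h2 : ⟪y, v⟫ = ⟪y, w⟫ + ⟪y, v - w⟫ := by rw [inner_sub_right]; ring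
  have h3 := real_inner_le_norm y (v - w)
  have h4 : ‖y‖ * ‖v - w‖ ≤ R * ‖v - w‖ := by gcongr; exact hR y hy
  rw [dist_eq_norm]
  change _ ≤ _ + R * _
  linarith

lemma aux_HB (hc : Convex ℝ K) (hK : IsCompact K) (hne : K.Nonempty) {x : Eu n}
    (h : ∀ v : Eu n, ‖v‖ = 1 → ⟪x, v⟫ ≤ suppFun K v) : x ∈ K := by
  by_contra hx
  obtain ⟨φ, c, h1, h2⟩ := geometric_hahn_banach_closed_point hc hK.isClosed hx
  set w := (InnerProductSpace.toDual ℝ (Eu n)).symm φ with hw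
  have hφ : ∀ y, φ y = ⟪y, w⟫ := fun y => by
    rw [real_inner_comm, hw, InnerProductSpace.toDual_symm_apply]
  have hw0 : w ≠ 0 := by
    intro h0
    have := h1 _ hne.some_mem
    rw [hφ, h0, inner_zero_right] at this
    rw [hφ, h0, inner_zero_right] at h2
    linarith
  have hwp : 0 < ‖w‖ := norm_pos_iff.2 hw0
  have h3 := h (‖w‖⁻¹ • w) (by rw [norm_smul, norm_inv, norm_norm, inv_mul_cancel₀ hwp.ne'])
  have h4 : suppFun K (‖w‖⁻¹ • w) ≤ ‖w‖⁻¹ * c := by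
    refine aux_supp_le hne fun y hy => ?_
    rw [inner_smul_right]
    have := h1 y hy
    rw [hφ] at this
    gcongr
  rw [inner_smul_right] at h3
  rw [hφ] at h2
  have := h3.trans h4
  have h5 := le_of_mul_le_mul_left this (inv_pos.2 hwp)
  linarith

lemma aux_wulff_bdd (g : Eu n → ℝ) {u : Eu n} (hu : ‖u‖ = 1) :
    ∀ r ∈ {r : ℝ | r • u ∈ wulff g}, r ≤ g u := by
  intro r hr
  have := hr u hu
  rwa [real_inner_smul_left, real_inner_self_eq_norm_sq, hu, one_pow, mul_one] at this

lemma aux_le_radial (g : Eu n → ℝ) {u : Eu n} (hu : ‖u‖ = 1) {r : ℝ}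
    (h : ∀ v : Eu n, ‖v‖ = 1 → r * ⟪u, v⟫ ≤ g v) : r ≤ radialFun (wulff g) u := by
  refine le_csSup ⟨_, aux_wulff_bdd g hu⟩ ?_
  intro v hv
  rw [real_inner_smul_left]
  exact h v hv

/-- the radial endpoint belongs to the Wulff shape -/
lemma aux_radial_mem (g : Eu n → ℝ) (hg : ∀ v : Eu n, ‖v‖ = 1 → 0 < g v) {u : Eu n}
    (hu : ‖u‖ = 1) (v : Eu n) (hv : ‖v‖ = 1) :
    radialFun (wulff g) u * ⟪u, v⟫ ≤ g v := by
  have hne : (0 : ℝ) ∈ {r : ℝ | r • u ∈ wulff g} := by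
    intro w hw
    simpa using (hg w hw).le
  rcases le_or_gt ⟪u, v⟫ 0 with h | h
  · have : 0 ≤ radialFun (wulff g) u := le_csSup ⟨_, aux_wulff_bdd g hu⟩ hne
    exact (mul_nonpos_of_nonneg_of_nonpos this h).trans (hg v hv).le
  · rw [← le_div_iff₀ h]
    refine csSup_le ⟨0, hne⟩ fun r hr => ?_
    rw [le_div_iff₀ h, ← real_inner_smul_left]
    exact hr v hv

lemma aux_wulff_supp (hc : Convex ℝ K) (hK : IsCompact K) (hne : K.Nonempty) :
    wulff (suppFun K) = K := by
  ext x
  exact ⟨fun h => aux_HB hc hK hne h, fun h v _ => aux_le_supp hK h v⟩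

lemma aux_supp_lower (hK : IsCompact K) (hK0 : (0 : Eu n) ∈ interior K) :
    ∃ r > 0, ∀ v : Eu n, ‖v‖ = 1 → r ≤ suppFun K v := by
  obtain ⟨r, hr, hb⟩ := Metric.nhds_basis_closedBall.mem_iff.1 (mem_interior_iff_mem_nhds.1 hK0)
  refine ⟨r, hr, fun v hv => ?_⟩
  have : r • v ∈ K := hb (by simp [norm_smul, hv, abs_of_pos hr])
  have h := aux_le_supp hK this v
  rwa [real_inner_smul_left, real_inner_self_eq_norm_sq, hv, one_pow, mul_one] at h

/-- part (ii) -/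
lemma aux_lip (hc : Convex ℝ K) (hK : IsCompact K) (hK0 : (0 : Eu n) ∈ interior K)
    (f : Eu n → ℝ) (hf : ContinuousOn f (sphere (0 : Eu n) 1))
    (δ : ℝ) 
    (hpos : ∀ t ∈ Ioo (-δ) δ, ∀ v : Eu n, ‖v‖ = 1 → 0 < suppFun K v + t * f v) :
    ∃ M > 0, ∀ u : Eu n, ‖u‖ = 1 → ∀ t ∈ Ioo (-δ) δ,
        |radialFun (wulff fun w => suppFun K w + t * f w) u - radialFun K u| ≤ M * |t| := by
  have hne : K.Nonempty := ⟨0, interior_subset hK0⟩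
  obtain ⟨r, hr, hrs⟩ := aux_supp_lower hK hK0
  obtain ⟨C, hC⟩ := (isCompact_sphere (0 : Eu n) 1).exists_bound_of_continuousOn hf
  obtain ⟨R, hR⟩ := (isCompact_sphere (0 : Eu n) 1).exists_bound_of_continuousOn
    (aux_supp_cont hK hne).continuousOn
  have hspos : ∀ v : Eu n, ‖v‖ = 1 → 0 < suppFun K v := fun v hv => hr.trans_le (hrs v hv)
  refine ⟨(|C| / r) * |R| + 1, by positivity, fun u hu t ht => ?_⟩
  set ρ := radialFun K u with hρ
  rw [← aux_wulff_supp hc hK hne] at hρ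
  have hρmem := aux_radial_mem (suppFun K) hspos hu
  rw [← hρ] at hρmem
  have hρle : ∀ {s : ℝ}, (∀ v : Eu n, ‖v‖ = 1 → s * ⟪u, v⟫ ≤ suppFun K v) → s ≤ ρ := by
    intro s h
    rw [hρ]
    exact aux_le_radial (suppFun K) hu h
  have hρ0 : 0 ≤ ρ := hρle fun v hv => by simpa using (hspos v hv).le
  have hρR : ρ ≤ |R| := by
    have h1 := hρmem u hu
    rw [real_inner_self_eq_norm_sq, hu] at h1
    have h2 := (hR u (by simpa using hu))
    rw [Real.norm_eq_abs] at h2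
    have := le_abs_self R
    have := le_abs_self (suppFun K u)
    linarith
  set g := fun w => suppFun K w + t * f w with hg
  set σ := radialFun (wulff g) u with hσ
  have hσmem := aux_radial_mem g (hpos t ht) hu
  rw [← hσ] at hσmem
  have hσle : ∀ {s : ℝ}, (∀ v : Eu n, ‖v‖ = 1 → s * ⟪u, v⟫ ≤ g v) → s ≤ σ := by
    intro s h
    rw [hσ]
    exact aux_le_radial g hu h
  have hσ0 : 0 ≤ σ := hσle fun v hv => by simpa using (hpos t ht v hv).le
  set ε := (|C| / r) * |t| with hε
  have hε0 : 0 ≤ ε := by positivity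
  have htf : ∀ v : Eu n, ‖v‖ = 1 → |t * f v| ≤ ε * suppFun K v := by
    intro v hv
    have h1 := hC v (by simpa using hv)
    rw [Real.norm_eq_abs] at h1
    have h2 := h1.trans (le_abs_self C)
    have h3 : ε * r = |C| * |t| := by rw [hε]; field_simp
    have h4 : ε * r ≤ ε * suppFun K v := by gcongr; exact hrs v hv
    rw [abs_mul]
    nlinarith [abs_nonneg t]
  have hup : σ ≤ (1 + ε) * ρ := by
    have : σ / (1 + ε) ≤ ρ := hρle fun v hv => by
      rw [div_mul_eq_mul_div, div_le_iff₀ (by positivity)]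
      have h1 := hσmem v hv
      have h2 := (abs_le.1 (htf v hv)).2
      simp only [hg] at h1
      linarith
    rwa [div_le_iff₀ (by positivity), mul_comm] at this
  have hlow : (1 - ε) * ρ ≤ σ := by
    rcases le_or_gt 1 ε with h | h
    · exact (mul_nonpos_of_nonpos_of_nonneg (by linarith) hρ0).trans hσ0
    · refine hσle fun v hv => ?_
      have h1 := hρmem v hv
      have h2 := (abs_le.1 (htf v hv)).1
      have h3 : (1 - ε) * (ρ * ⟪u, v⟫) ≤ (1 - ε) * suppFun K v := by
        apply mul_le_mul_of_nonneg_left h1; linarith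
      simp only [hg]
      linarith
  have h5 : ε * ρ ≤ ε * |R| := by gcongr
  have h6 : ((|C| / r) * |R| + 1) * |t| = ε * |R| + |t| := by rw [hε]; ring
  rw [h6, abs_le]
  have := abs_nonneg t
  constructor <;> linarith

/-- existence of a normal -/
lemma aux_exists_normal (hc : Convex ℝ K) (hK : IsCompact K) (hK0 : (0 : Eu n) ∈ interior K)
    {u : Eu n} (hu : ‖u‖ = 1) :
    ∃ v : Eu n, ‖v‖ = 1 ∧ radialFun K u * ⟪u, v⟫ = suppFun K v := by
  have hne : K.Nonempty := ⟨0, interior_subset hK0⟩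
  obtain ⟨r, hr, hrs⟩ := aux_supp_lower hK hK0
  have hspos : ∀ v : Eu n, ‖v‖ = 1 → 0 < suppFun K v := fun v hv => hr.trans_le (hrs v hv)
  set ρ := radialFun K u with hρ
  rw [← aux_wulff_supp hc hK hne] at hρ
  have hρmem := aux_radial_mem (suppFun K) hspos hu
  rw [← hρ] at hρmem
  have hρle : ∀ {s : ℝ}, (∀ v : Eu n, ‖v‖ = 1 → s * ⟪u, v⟫ ≤ suppFun K v) → s ≤ ρ := by
    intro s h
    rw [hρ]
    exact aux_le_radial (suppFun K) hu h
  obtain ⟨v, hv, hmin⟩ := (isCompact_sphere (0 : Eu n) 1).exists_isMinOn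
    (f := fun v => suppFun K v - ρ * ⟪u, v⟫) ⟨u, by simpa using hu⟩
    (((aux_supp_cont hK hne).sub (by fun_prop)).continuousOn)
  have hv1 : ‖v‖ = 1 := by simpa using hv
  refine ⟨v, hv1, le_antisymm (hρmem v hv1) ?_⟩
  by_contra! hlt
  have := hρle (s := ρ + (suppFun K v - ρ * ⟪u, v⟫)) fun w hw => by
    have h1 : suppFun K v - ρ * ⟪u, v⟫ ≤ suppFun K w - ρ * ⟪u, w⟫ := hmin (by simpa using hw)
    have h2 := real_inner_le_norm u w
    rw [hu, hw] at h2
    nlinarith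
  linarith

lemma aux_gauge_normal (hc : Convex ℝ K) (hK : IsCompact K) (hK0 : (0 : Eu n) ∈ interior K)
    (y v : Eu n) : ⟪y, v⟫ ≤ gauge K y * suppFun K v := by
  have hnh := mem_interior_iff_mem_nhds.1 hK0
  rcases eq_or_ne y 0 with rfl | hy
  · simp
  have hg : 0 < gauge K y :=
    (gauge_pos (absorbent_nhds_zero hnh) (NormedSpace.isVonNBounded_of_isBounded ℝ hK.isBounded)).2 hy
  have hmem : (gauge K y)⁻¹ • y ∈ K := by
    refine hK.isClosed.closure_eq.subset ?_
    rw [← gauge_le_one_iff_mem_closure hc hnh,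
      gauge_smul_of_nonneg (inv_nonneg.2 hg.le), smul_eq_mul, inv_mul_cancel₀ hg.ne']
  have h := aux_le_supp hK hmem v
  rwa [real_inner_smul_left, inv_mul_le_iff₀ hg] at h

lemma aux_gauge_mul_radial (hc : Convex ℝ K) (hK : IsCompact K) (hK0 : (0 : Eu n) ∈ interior K)
    {u : Eu n} (hu : ‖u‖ = 1) : gauge K u * radialFun K u ≤ 1 := by
  have hne : K.Nonempty := ⟨0, interior_subset hK0⟩
  obtain ⟨r, hr, hrs⟩ := aux_supp_lower hK hK0
  have hspos : ∀ v : Eu n, ‖v‖ = 1 → 0 < suppFun K v := fun v hv => hr.trans_le (hrs v hv)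
  set ρ := radialFun K u with hρ
  rw [← aux_wulff_supp hc hK hne] at hρ
  have hρmem := aux_radial_mem (suppFun K) hspos hu
  rw [← hρ] at hρmem
  have hρle : ∀ {s : ℝ}, (∀ v : Eu n, ‖v‖ = 1 → s * ⟪u, v⟫ ≤ suppFun K v) → s ≤ ρ := by
    intro s h
    rw [hρ]
    exact aux_le_radial (suppFun K) hu h
  have hρ0 : 0 ≤ ρ := hρle fun v hv => by simpa using (hspos v hv).le
  have : ρ • u ∈ K := aux_HB hc hK hne fun v hv => by
    rw [real_inner_smul_left]; exact hρmem v hv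
  have := gauge_le_one_of_mem this
  rwa [gauge_smul_of_nonneg hρ0, smul_eq_mul, mul_comm] at this

lemma aux_unique (hc : Convex ℝ K) (hK : IsCompact K) (hK0 : (0 : Eu n) ∈ interior K)
    {u : Eu n} (hu : ‖u‖ = 1) (hd : DifferentiableAt ℝ (gauge K) u) {v w : Eu n}
    (hv : ‖v‖ = 1) (hw : ‖w‖ = 1) (hv' : radialFun K u * ⟪u, v⟫ = suppFun K v)
    (hw' : radialFun K u * ⟪u, w⟫ = suppFun K w) : v = w := by
  obtain ⟨r, hr, hrs⟩ := aux_supp_lower hK hK0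
  have key : ∀ v : Eu n, ‖v‖ = 1 → radialFun K u * ⟪u, v⟫ = suppFun K v →
      suppFun K v • fderiv ℝ (gauge K) u = innerSL ℝ v := by
    intro v hv hv'
    have hs : 0 < suppFun K v := hr.trans_le (hrs v hv)
    have hd1 : HasFDerivAt (fun y => suppFun K v * gauge K y - innerSL ℝ v y)
        (suppFun K v • fderiv ℝ (gauge K) u - innerSL ℝ v) u :=
      (hd.hasFDerivAt.const_mul _).sub (innerSL ℝ v).hasFDerivAt
    have hz : suppFun K v * gauge K u - innerSL ℝ v u ≤ 0 := by
      rw [innerSL_apply_apply, real_inner_comm]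
      have h1 := aux_gauge_mul_radial hc hK hK0 hu
      have h2 := aux_gauge_normal hc hK hK0 u v
      have h0 : 0 < ⟪u, v⟫ := by
        by_contra! hle
        have h3 : 0 ≤ radialFun K u := by
          refine le_csSup ?_ ?_
          · refine ⟨suppFun K u, fun r hr => ?_⟩
            have := aux_le_supp hK hr u
            rwa [real_inner_smul_left, real_inner_self_eq_norm_sq, hu, one_pow, mul_one] at this
          · simpa using interior_subset hK0
        nlinarith
      rw [← hv']
      nlinarith
    have hmin : IsLocalMin (fun y => suppFun K v * gauge K y - innerSL ℝ v y) u := by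
      refine Filter.Eventually.of_forall fun y => hz.trans ?_
      beta_reduce
      rw [innerSL_apply_apply, real_inner_comm]
      have := aux_gauge_normal hc hK hK0 y v
      linarith
    exact sub_eq_zero.1 (hmin.hasFDerivAt_eq_zero hd1)
  have hsv : 0 < suppFun K v := hr.trans_le (hrs v hv)
  have hsw : 0 < suppFun K w := hr.trans_le (hrs w hw)
  have e1 := key v hv hv'
  have e2 := key w hw hw'
  have n1 := congrArg norm e1
  have n2 := congrArg norm e2
  rw [norm_smul, innerSL_apply_norm, hv, Real.norm_of_nonneg hsv.le] at n1
  rw [norm_smul, innerSL_apply_norm, hw, Real.norm_of_nonneg hsw.le] at n2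
  have hG : ‖fderiv ℝ (gauge K) u‖ ≠ 0 := by intro h; simp [h] at n1
  have : suppFun K v = suppFun K w := mul_right_cancel₀ hG (n1.trans n2.symm)
  rw [this, e2] at e1
  refine ext_inner_right ℝ fun y => ?_
  have := congrArg (fun T => T y) e1
  simpa [innerSL_apply_apply] using this.symm

/-- the derivative -/
lemma aux_deriv (hc : Convex ℝ K) (hK : IsCompact K) (hK0 : (0 : Eu n) ∈ interior K)
    (f : Eu n → ℝ) (hf : ContinuousOn f (sphere (0 : Eu n) 1))
    (δ : ℝ) (hδ : 0 < δ)
    (hpos : ∀ t ∈ Ioo (-δ) δ, ∀ v : Eu n, ‖v‖ = 1 → 0 < suppFun K v + t * f v)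
    {u : Eu n} (hu : ‖u‖ = 1) {v : Eu n} (hv : ‖v‖ = 1)
    (hv' : radialFun K u * ⟪u, v⟫ = suppFun K v)
    (huniq : ∀ w : Eu n, ‖w‖ = 1 → radialFun K u * ⟪u, w⟫ = suppFun K w → w = v) :
    Tendsto
      (fun t : ℝ =>
        (radialFun (wulff fun w => suppFun K w + t * f w) u - radialFun K u) / t)
      (𝓝[≠] (0 : ℝ)) (𝓝 (f v * radialFun K u / suppFun K v)) := by
  have hne : K.Nonempty := ⟨0, interior_subset hK0⟩
  obtain ⟨r, hr, hrs⟩ := aux_supp_lower hK hK0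
  obtain ⟨C, hC⟩ := (isCompact_sphere (0 : Eu n) 1).exists_bound_of_continuousOn hf
  have hspos : ∀ v : Eu n, ‖v‖ = 1 → 0 < suppFun K v := fun v hv => hr.trans_le (hrs v hv)
  set ρ := radialFun K u with hρ
  rw [← aux_wulff_supp hc hK hne] at hρ
  have hρmem := aux_radial_mem (suppFun K) hspos hu
  rw [← hρ] at hρmem
  have hρle : ∀ {s : ℝ}, (∀ v : Eu n, ‖v‖ = 1 → s * ⟪u, v⟫ ≤ suppFun K v) → s ≤ ρ := by
    intro s h
    rw [hρ]
    exact aux_le_radial (suppFun K) hu h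
  have hρ0 : 0 ≤ ρ := hρle fun v hv => by simpa using (hspos v hv).le
  have hs := hspos v hv
  have huv : 0 < ⟪u, v⟫ := by
    by_contra! h
    nlinarith
  have hρpos : 0 < ρ := by
    rcases hρ0.eq_or_lt with h | h
    · rw [← h] at hv'; linarith
    · exact h
  set L := f v * ρ / suppFun K v with hL
  have hLf : L * ⟪u, v⟫ = f v := by
    rw [hL, ← hv']; field_simp
  have hupper : ∀ t ∈ Ioo (-δ) δ,
      radialFun (wulff fun w => suppFun K w + t * f w) u - ρ ≤ t * L := by
    intro t ht
    have h1 := aux_radial_mem _ (hpos t ht) hu v hv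
    rw [← hv', ← hLf] at h1
    have : radialFun (wulff fun w => suppFun K w + t * f w) u * ⟪u, v⟫ ≤ (ρ + t * L) * ⟪u, v⟫ := by
      linarith
    have := le_of_mul_le_mul_right this huv
    linarith
  have hlower : ∀ ε > 0, ∀ᶠ t in 𝓝 (0 : ℝ),
      t * L - ε * |t| ≤ radialFun (wulff fun w => suppFun K w + t * f w) u - ρ := by
    intro ε hε
    have hAcl : IsClosed {w | w ∈ sphere (0 : Eu n) 1 ∧ ε * ⟪u, w⟫ ≤ |L * ⟪u, w⟫ - f w|} := by
      refine isClosed_sphere.isClosed_le (by fun_prop) ?_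
      exact ContinuousOn.abs (ContinuousOn.sub (by fun_prop) hf)
    set A := {w | w ∈ sphere (0 : Eu n) 1 ∧ ε * ⟪u, w⟫ ≤ |L * ⟪u, w⟫ - f w|} with hA
    have hAc : IsCompact A :=
      (isCompact_sphere (0 : Eu n) 1).of_isClosed_subset hAcl fun w hw => hw.1
    have hcex : ∃ c > 0, ∀ w ∈ A, c ≤ suppFun K w - ρ * ⟪u, w⟫ := by
      rcases A.eq_empty_or_nonempty with h | h
      · exact ⟨1, one_pos, by simp [h]⟩
      obtain ⟨w, hw, hmin⟩ := hAc.exists_isMinOn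
        (f := fun v => suppFun K v - ρ * ⟪u, v⟫) h
        (((aux_supp_cont hK hne).sub (by fun_prop)).continuousOn)
      refine ⟨_, ?_, fun z hz => hmin hz⟩
      have hw1 : ‖w‖ = 1 := by simpa using hw.1
      have h1 := hρmem w hw1
      rcases h1.eq_or_lt with h2 | h2
      · have := huniq w hw1 h2
        subst this
        have h3 := hw.2
        rw [hLf, sub_self, abs_zero] at h3
        nlinarith
      · simpa using h2
    obtain ⟨c, hc0, hcA⟩ := hcex
    have hev : ∀ᶠ t in 𝓝 (0 : ℝ), |t| * (|L| + ε + |C|) < c := by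
      have : Tendsto (fun t : ℝ => |t| * (|L| + ε + |C|)) (𝓝 0) (𝓝 (|0| * (|L| + ε + |C|))) :=
        Continuous.tendsto (by fun_prop) 0
      rw [abs_zero, zero_mul] at this
      exact this.eventually_lt_const hc0
    filter_upwards [hev] with t ht
    have := aux_le_radial (fun w => suppFun K w + t * f w) hu (r := ρ + (t * L - ε * |t|))
      fun w hw => by
        have hws : w ∈ sphere (0 : Eu n) 1 := by simpa using hw
        by_cases hwA : w ∈ A
        · have h1 := hcA w hwA
          have h2 : |⟪u, w⟫| ≤ 1 := by
            have := abs_real_inner_le_norm u w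
            rwa [hu, hw, one_mul] at this
          have h3 : |f w| ≤ |C| := (hC w hws).trans (le_abs_self C)
          have h4 : |t * L * ⟪u, w⟫ - ε * |t| * ⟪u, w⟫ - t * f w| ≤ |t| * (|L| + ε + |C|) := by
            have a1 : |t * L * ⟪u, w⟫| ≤ |t| * |L| := by
              rw [abs_mul, abs_mul]
              exact mul_le_of_le_one_right (by positivity) h2
            have a2 : |ε * |t| * ⟪u, w⟫| ≤ ε * |t| := by
              rw [abs_mul, abs_of_nonneg (show 0 ≤ ε * |t| by positivity)]
              exact mul_le_of_le_one_right (by positivity) h2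
            have a3 : |t * f w| ≤ |t| * |C| := by
              rw [abs_mul]; gcongr
            have a4 := abs_sub (t * L * ⟪u, w⟫ - ε * |t| * ⟪u, w⟫) (t * f w)
            have a5 := abs_sub (t * L * ⟪u, w⟫) (ε * |t| * ⟪u, w⟫)
            linarith
          have h5 := (abs_le.1 h4).2
          linarith
        · have h1 : |L * ⟪u, w⟫ - f w| < ε * ⟪u, w⟫ := by
            by_contra! h
            exact hwA ⟨hws, h⟩
          have h2 : t * (L * ⟪u, w⟫ - f w) ≤ |t| * (ε * ⟪u, w⟫) := by
            refine (le_abs_self _).trans ?_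
            rw [abs_mul]
            gcongr
          have h3 := hρmem w hw
          linarith
    linarith
  rw [Metric.tendsto_nhdsWithin_nhds]
  intro ε hε
  obtain ⟨η, hη, hball⟩ := Metric.eventually_nhds_iff.1
    ((hlower (ε / 2) (by positivity)).and (Ioo_mem_nhds (neg_lt_zero.2 hδ) hδ))
  refine ⟨η, hη, fun t ht0 ht => ?_⟩
  obtain ⟨h1, h2⟩ := hball ht
  have h3 := hupper t h2
  have ht0' : t ≠ 0 := ht0
  have htp : 0 < |t| := abs_pos.2 ht0'
  rw [Real.dist_eq]
  set D := radialFun (wulff fun w => suppFun K w + t * f w) u - ρ with hD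
  have : D / t - L = (D - t * L) / t := by field_simp
  rw [this, abs_div, div_lt_iff₀ htp, abs_lt]
  constructor <;> nlinarith

end Aux

section AE

/-- the affine chart -/
def auxPsi {m : ℕ} (i : Fin (m + 1)) (s : ℝ) (w : Fin m → ℝ) : Eu (m + 1) :=
  WithLp.toLp 2 (i.insertNth (α := fun _ => ℝ) s w)

lemma auxPsi_same {m : ℕ} (i : Fin (m + 1)) (s : ℝ) (w : Fin m → ℝ) : auxPsi i s w i = s := by
  simp [auxPsi]

lemma auxPsi_lip {m : ℕ} (i : Fin (m + 1)) (s : ℝ) : ∃ C, LipschitzWith C (auxPsi i s) := by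
  have h1 : LipschitzWith 1 (fun w : Fin m → ℝ => i.insertNth (α := fun _ => ℝ) s w) := by
    refine LipschitzWith.of_dist_le_mul fun x y => ?_
    rw [NNReal.coe_one, one_mul, dist_pi_le_iff dist_nonneg, i.forall_iff_succAbove]
    refine ⟨by simp, fun j => ?_⟩
    simpa using dist_le_pi_dist x y j
  exact ⟨_, (PiLp.lipschitzWith_toLp 2 (fun _ : Fin (m + 1) => ℝ)).comp h1⟩

lemma aux_normalize_lip {E : Type*} [NormedAddCommGroup E] [NormedSpace ℝ E] :
    LipschitzOnWith 2 (fun x : E => ‖x‖⁻¹ • x) {x | 1 ≤ ‖x‖} := by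
  refine LipschitzOnWith.of_dist_le_mul fun x hx y hy => ?_
  have hx' : 1 ≤ ‖x‖ := hx
  have hy' : 1 ≤ ‖y‖ := hy
  have hx0 : 0 < ‖x‖ := by linarith
  have hy0 : 0 < ‖y‖ := by linarith
  rw [dist_eq_norm, dist_eq_norm]
  have e : ‖x‖⁻¹ • x - ‖y‖⁻¹ • y = ‖x‖⁻¹ • (x - y) + (‖x‖⁻¹ - ‖y‖⁻¹) • y := by
    rw [smul_sub, sub_smul]; abel
  have hi : ‖x‖⁻¹ ≤ 1 := inv_le_one_of_one_le₀ hx'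
  have h1 : ‖‖x‖⁻¹ • (x - y)‖ ≤ ‖x - y‖ := by
    rw [norm_smul, norm_inv, norm_norm]
    exact mul_le_of_le_one_left (norm_nonneg _) hi
  have h2 : ‖(‖x‖⁻¹ - ‖y‖⁻¹) • y‖ ≤ ‖x - y‖ := by
    rw [norm_smul, Real.norm_eq_abs]
    have : |‖x‖⁻¹ - ‖y‖⁻¹| * ‖y‖ = ‖x‖⁻¹ * |‖y‖ - ‖x‖| := by
      rw [← abs_of_pos hy0, ← abs_mul, abs_of_pos hy0, sub_mul, inv_mul_cancel₀ hy0.ne',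
        ← abs_of_pos (inv_pos.2 hx0), ← abs_mul, abs_of_pos (inv_pos.2 hx0), mul_sub,
        inv_mul_cancel₀ hx0.ne']
    rw [this]
    refine (mul_le_of_le_one_left (abs_nonneg _) hi).trans ?_
    rw [norm_sub_rev]
    exact abs_norm_sub_norm_le y x
  rw [e]
  refine (norm_add_le _ _).trans ?_
  change _ ≤ (2 : ℝ) * _
  linarith

lemma aux_diff {m : ℕ} (g : Eu (m + 1) → ℝ) (hg : ∀ c : ℝ, 0 ≤ c → ∀ x, g (c • x) = c * g x)
    (i : Fin (m + 1)) (s : ℝ) (hs : s * s = 1) (u : Eu (m + 1)) (hu : 0 < s * u i)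
    (hd : DifferentiableAt ℝ (fun w => g (auxPsi i s w))
      (fun j => (s * u i)⁻¹ * u (i.succAbove j))) :
    DifferentiableAt ℝ g u := by
  have hc : ∀ k, Differentiable ℝ (fun x : Eu (m + 1) => x k) := fun k =>
    (EuclideanSpace.proj (𝕜 := ℝ) k : Eu (m + 1) →L[ℝ] ℝ).differentiable
  have hmap : DifferentiableAt ℝ
      (fun x : Eu (m + 1) => (fun j => (s * x i)⁻¹ * x (i.succAbove j) : Fin m → ℝ)) u := by
    rw [differentiableAt_pi]
    intro j
    exact (((hc i u).const_mul s).inv hu.ne').mul (hc _ u)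
  have hcomp : DifferentiableAt ℝ (fun x : Eu (m + 1) =>
      (s * x i) * g (auxPsi i s (fun j => (s * x i)⁻¹ * x (i.succAbove j)))) u :=
    ((hc i u).const_mul s).mul
      (DifferentiableAt.comp (g := fun w => g (auxPsi i s w)) u hd hmap)
  refine hcomp.congr_of_eventuallyEq ?_
  have hev : ∀ᶠ x : Eu (m + 1) in 𝓝 u, 0 < s * x i :=
    (continuous_const.mul (hc i).continuous).continuousAt.eventually_const_lt hu
  filter_upwards [hev] with x hx
  rw [← hg _ hx.le]
  congr 1
  ext k
  revert k
  rw [i.forall_iff_succAbove]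
  refine ⟨?_, fun j => ?_⟩
  · simp only [auxPsi, PiLp.smul_apply, Fin.insertNth_apply_same, smul_eq_mul]
    linear_combination (-x i) * hs
  · simp only [auxPsi, PiLp.smul_apply, Fin.insertNth_apply_succAbove, smul_eq_mul]
    rw [mul_inv_cancel_left₀ hx.ne']

lemma aux_ae_diff {m : ℕ} (g : Eu (m + 1) → ℝ)
    (hg : ∀ c : ℝ, 0 ≤ c → ∀ x, g (c • x) = c * g x) (hlip : ∃ C, LipschitzWith C g) :
    ∀ᵐ u ∂(μH[(m : ℝ)]).restrict (sphere (0 : Eu (m + 1)) 1), DifferentiableAt ℝ g u := by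
  obtain ⟨C, hC⟩ := hlip
  let Z : Fin (m + 1) → ℝ → Set (Fin m → ℝ) := fun i s =>
    {w | ¬ DifferentiableAt ℝ (fun w => g (auxPsi i s w)) w}
  have hZ : ∀ i s, μH[(m : ℝ)] (Z i s) = 0 := by
    intro i s
    obtain ⟨D, hD⟩ := auxPsi_lip i s
    have h1 : ∀ᵐ w ∂(volume : Measure (Fin m → ℝ)),
        DifferentiableAt ℝ (fun w => g (auxPsi i s w)) w := (hC.comp hD).ae_differentiableAt
    have h2 := hausdorffMeasure_pi_real (ι := Fin m)
    rw [Fintype.card_fin] at h2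
    rw [h2]
    exact ae_iff.1 h1
  let N : Fin (m + 1) → ℝ → Set (Eu (m + 1)) := fun i s =>
    (fun w => ‖auxPsi i s w‖⁻¹ • auxPsi i s w) '' Z i s
  have hN : ∀ i s, s * s = 1 → μH[(m : ℝ)] (N i s) = 0 := by
    intro i s hs
    obtain ⟨D, hD⟩ := auxPsi_lip i s
    have hL : LipschitzOnWith (2 * D) (fun w => ‖auxPsi i s w‖⁻¹ • auxPsi i s w) (Z i s) := by
      refine aux_normalize_lip.comp (hD.lipschitzOnWith (s := Z i s)) fun w _ => ?_
      have h1 := PiLp.norm_apply_le (auxPsi i s w) i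
      rw [auxPsi_same, Real.norm_eq_abs] at h1
      have h2 : |s| = 1 := by
        have : |s| * |s| = 1 := by rw [abs_mul_abs_self, hs]
        nlinarith [abs_nonneg s]
      rwa [h2] at h1
    have := hL.hausdorffMeasure_image_le (d := m) (Nat.cast_nonneg m)
    rw [hZ, mul_zero] at this
    exact le_antisymm this zero_le
  rw [ae_restrict_iff' isClosed_sphere.measurableSet]
  have hnull : ∀ᵐ u ∂(μH[(m : ℝ)] : Measure (Eu (m + 1))),
      ∀ i, u ∉ N i 1 ∧ u ∉ N i (-1) := by
    rw [ae_all_iff]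
    intro i
    exact (measure_eq_zero_iff_ae_notMem.1 (hN i 1 (by norm_num))).and
      (measure_eq_zero_iff_ae_notMem.1 (hN i (-1) (by norm_num)))
  filter_upwards [hnull] with u hu husph
  have hu1 : ‖u‖ = 1 := by simpa using husph
  obtain ⟨i, hi⟩ : ∃ i, u i ≠ 0 := by
    by_contra! h
    have : u = 0 := by ext k; simpa using h k
    rw [this] at hu1
    simp at hu1
  have main : ∀ s : ℝ, s * s = 1 → 0 < s * u i → u ∉ N i s → DifferentiableAt ℝ g u := by
    intro s hs hsu hun
    refine aux_diff g hg i s hs u hsu ?_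
    by_contra hnd
    refine hun ⟨_, hnd, ?_⟩
    have e : auxPsi i s (fun j => (s * u i)⁻¹ * u (i.succAbove j)) = (s * u i)⁻¹ • u := by
      ext k
      revert k
      rw [i.forall_iff_succAbove]
      refine ⟨?_, fun j => ?_⟩
      · simp only [auxPsi, PiLp.smul_apply, Fin.insertNth_apply_same, smul_eq_mul]
        rw [eq_inv_mul_iff_mul_eq₀ hsu.ne']
        linear_combination (u i) * hs
      · simp [auxPsi]
    beta_reduce
    rw [e, norm_smul, hu1, mul_one, Real.norm_of_nonneg (inv_nonneg.2 hsu.le), inv_inv,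
      smul_smul, mul_inv_cancel₀ hsu.ne', one_smul]
  rcases lt_or_gt_of_ne hi with h | h
  · exact main (-1) (by norm_num) (by linarith) (hu i).2
  · exact main 1 (by norm_num) (by linarith) (hu i).1

end AE

/-- Variation of the radial function of the Wulff shapes `[h_K + t f]`:
(i) for a.e. unit `u`, the boundary point `ρ_K(u)u` has a unique outer unit normal `v`
and `(ρ_{[h_K+tf]}(u) - ρ_K(u))/t → f(v) ρ_K(u)/h_K(v)` as `t → 0`;
(ii) `|ρ_{[h_K+tf]}(u) - ρ_K(u)| ≤ M|t|` uniformly. -/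
theorem radial_function_variation
    (n : ℕ) (hn : 2 ≤ n) (K : Set (Eu n)) (hK : IsConvexBody K)
    (hK0 : (0 : Eu n) ∈ interior K)
    (f : Eu n → ℝ) (hf : ContinuousOn f (sphere (0 : Eu n) 1))
    (δ : ℝ) (hδ : 0 < δ)
    (hpos : ∀ t ∈ Ioo (-δ) δ, ∀ v : Eu n, ‖v‖ = 1 → 0 < suppFun K v + t * f v) :
    (∀ᵐ u ∂(μH[(n : ℝ) - 1]).restrict (sphere (0 : Eu n) 1),
        (∃! v : Eu n, ‖v‖ = 1 ∧ radialFun K u * ⟪u, v⟫ = suppFun K v) ∧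
        ∀ v : Eu n, ‖v‖ = 1 → radialFun K u * ⟪u, v⟫ = suppFun K v →
          Tendsto
            (fun t : ℝ =>
              (radialFun (wulff fun w => suppFun K w + t * f w) u - radialFun K u) / t)
            (𝓝[≠] (0 : ℝ)) (𝓝 (f v * radialFun K u / suppFun K v))) ∧
      ∃ M > 0, ∀ u : Eu n, ‖u‖ = 1 → ∀ t ∈ Ioo (-δ) δ,
        |radialFun (wulff fun w => suppFun K w + t * f w) u - radialFun K u| ≤ M * |t| := by
  obtain ⟨hc, hKc, -⟩ := hK
  refine ⟨?_, aux_lip hc hKc hK0 f hf δ hpos⟩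
  obtain ⟨m, rfl⟩ : ∃ m, n = m + 1 := ⟨n - 1, by omega⟩
  have hcast : ((m + 1 : ℕ) : ℝ) - 1 = (m : ℝ) := by push_cast; ring
  rw [hcast]
  have hd := aux_ae_diff (gauge K) (fun c hc x => by
    rw [gauge_smul_of_nonneg hc, smul_eq_mul])
    (hc.lipschitz_gauge (mem_interior_iff_mem_nhds.1 hK0))
  filter_upwards [hd, ae_restrict_mem isClosed_sphere.measurableSet] with u hu hus
  have hu1 : ‖u‖ = 1 := by simpa using hus
  obtain ⟨v, hv, hv'⟩ := aux_exists_normal hc hKc hK0 hu1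
  refine ⟨⟨v, ⟨hv, hv'⟩, fun w hw => aux_unique hc hKc hK0 hu1 hu hw.1 hv hw.2 hv'⟩, ?_⟩
  intro w hw hw'
  exact aux_deriv hc hKc hK0 f hf δ hδ hpos hu1 hw hw'
    fun z hz hz' => aux_unique hc hKc hK0 hu1 hu hz hw hz' hw'
end
end

section
/- (Ehrhard inequality) Let K and L be convex bodies in ℝⁿ and let 0 < t < 1. Then Φ^{-1}(γ_n((1−t)K + tL)) ≥ (1−t) Φ^{-1}(γ_n(K)) + t Φ^{-1}(γ_n(L)), where (1−t)K + tL = {(1−t)x + ty : x ∈ K, y ∈ L} is the Minkowski combination. Moreover, equality holds if and only if K = L. -/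
open MeasureTheory Metric Set Filter
open scoped RealInnerProductSpace Topology Pointwise NNReal ENNReal

noncomputable section

open ProbabilityTheory

/-- standard Gaussian density on the line -/
def gphi (x : ℝ) : ℝ := (Real.sqrt (2 * Real.pi))⁻¹ * Real.exp (-x ^ 2 / 2)

lemma gphi_eq (x : ℝ) : gphi x = gaussianPDFReal 0 1 x := by
  simp [gphi, gaussianPDFReal]

lemma gphi_pos (x : ℝ) : 0 < gphi x := by unfold gphi; positivity

lemma gphi_cont : Continuous gphi := by unfold gphi; fun_prop

lemma gphi_neg (x : ℝ) : gphi (-x) = gphi x := by simp [gphi]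

lemma gphi_int : Integrable gphi := by
  have : gphi = gaussianPDFReal 0 1 := funext gphi_eq
  rw [this]; exact integrable_gaussianPDFReal 0 1

lemma gphi_hasDerivAt (x : ℝ) : HasDerivAt gphi (-x * gphi x) x := by
  unfold gphi
  have h : HasDerivAt (fun x : ℝ => -x ^ 2 / 2) (-x) x := by
    exact (((hasDerivAt_pow 2 x).neg).div_const 2).congr_deriv (by simp; ring)
  exact ((h.exp).const_mul (Real.sqrt (2 * Real.pi))⁻¹).congr_deriv (by ring)

lemma Phi_eq_int (x : ℝ) : Phi x = ∫ s in Iic x, gphi s := by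
  unfold Phi gphi; rw [integral_const_mul]

/-- the one-dimensional Gaussian measure -/
abbrev g1 : Measure ℝ := gaussianReal 0 1

lemma Phi_eq (x : ℝ) : Phi x = g1.real (Iic x) := by
  rw [Phi_eq_int, measureReal_def, gaussianReal_apply_eq_integral 0 one_ne_zero, ENNReal.toReal_ofReal]
  · simp_rw [gphi_eq]
  · exact integral_nonneg fun s => gaussianPDFReal_nonneg _ _ _

instance : NullSingletonClass g1 := nullSingletonClass_gaussianReal one_ne_zero

lemma Phi_sub (a b : ℝ) : Phi b - Phi a = ∫ s in a..b, gphi s := by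
  rw [Phi_eq_int, Phi_eq_int, intervalIntegral.integral_Iic_sub_Iic gphi_int.integrableOn gphi_int.integrableOn]

lemma Phi_hasDerivAt (x : ℝ) : HasDerivAt Phi (gphi x) x := by
  have h : Phi = fun y => Phi 0 + ∫ s in (0:ℝ)..y, gphi s := by
    funext y; rw [← Phi_sub]; ring
  rw [h]
  exact (intervalIntegral.integral_hasDerivAt_right (gphi_cont.intervalIntegrable _ _)
    (gphi_cont.stronglyMeasurableAtFilter _ _) gphi_cont.continuousAt).const_add _

lemma Phi_cont : Continuous Phi := continuous_iff_continuousAt.2 fun x => (Phi_hasDerivAt x).continuousAt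

lemma Phi_strictMono : StrictMono Phi :=
  strictMono_of_hasDerivAt_pos (fun x => Phi_hasDerivAt x) fun x => gphi_pos x

lemma Phi_nonneg (x : ℝ) : 0 ≤ Phi x := by rw [Phi_eq]; exact measureReal_nonneg
lemma Phi_pos (x : ℝ) : 0 < Phi x :=
  (Phi_nonneg (x-1)).trans_lt (Phi_strictMono (by linarith))
lemma Phi_le_one (x : ℝ) : Phi x ≤ 1 := by rw [Phi_eq]; exact measureReal_le_one
lemma Phi_lt_one (x : ℝ) : Phi x < 1 :=
  (Phi_strictMono (show x < x+1 by linarith)).trans_le (Phi_le_one _)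

lemma Phi_atTop : Tendsto Phi atTop (𝓝 1) := by
  have h := tendsto_measure_Iic_atTop g1
  rw [measure_univ] at h
  have := (ENNReal.tendsto_toReal ENNReal.one_ne_top).comp h
  refine (this.congr fun x => ?_)
  rw [Phi_eq]; rfl

lemma g1_neg : g1.map (fun x => -x) = g1 := by
  rw [g1, gaussianReal_map_neg]; simp

lemma g1_real_Ici (x : ℝ) : g1.real (Ici x) = Phi (-x) := by
  rw [Phi_eq]
  conv_lhs => rw [← g1_neg]
  rw [map_measureReal_apply (by fun_prop) measurableSet_Ici]
  congr 1; ext y; simp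

lemma Phi_neg (x : ℝ) : Phi (-x) = 1 - Phi x := by
  rw [← g1_real_Ici, Phi_eq]
  have : g1.real (Ici x) = g1.real (Ioi x) := measureReal_congr Ioi_ae_eq_Ici.symm
  rw [this, ← compl_Iic, probReal_compl_eq_one_sub measurableSet_Iic]

lemma Phi_atBot : Tendsto Phi atBot (𝓝 0) := by
  have := (Phi_atTop.comp tendsto_neg_atBot_atTop).const_sub 1
  simp only [sub_self] at this
  refine this.congr fun x => ?_
  simp [Phi_neg]

lemma Phi_surj {m : ℝ} (h0 : 0 < m) (h1 : m < 1) : ∃ x, Phi x = m := by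
  obtain ⟨a, ha⟩ := (Phi_atBot.eventually (gt_mem_nhds h0)).exists
  obtain ⟨b, hb⟩ := (Phi_atTop.eventually (lt_mem_nhds h1)).exists
  exact mem_range_of_exists_le_of_exists_ge Phi_cont ⟨a, ha.le⟩ ⟨b, hb.le⟩

lemma PhiInv_Phi (x : ℝ) : PhiInv (Phi x) = x :=
  Function.leftInverse_invFun Phi_strictMono.injective x

lemma Phi_PhiInv {m : ℝ} (h0 : 0 < m) (h1 : m < 1) : Phi (PhiInv m) = m :=
  Function.invFun_eq (Phi_surj h0 h1)

lemma g1_real_Icc {a b : ℝ} (h : a ≤ b) : g1.real (Icc a b) = Phi b - Phi a := by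
  have : g1.real (Icc a b) = g1.real (Ioc a b) := measureReal_congr Ioc_ae_eq_Icc.symm
  rw [this, Phi_eq, Phi_eq, ← Iic_sdiff_Iic, measureReal_diff (Iic_subset_Iic.2 h) measurableSet_Iic]

/-! Mills ratio -/

lemma mills {x : ℝ} (hx : 0 < x) : x / (1 + x ^ 2) * gphi x < 1 - Phi x := by
  set g : ℝ → ℝ := fun y => 1 - Phi y - y / (1 + y ^ 2) * gphi y with hg
  have hd : ∀ y, HasDerivAt g (- (2 / (1 + y ^ 2) ^ 2 * gphi y)) y := by
    intro y
    have h1 : (1 + y ^ 2) ≠ 0 := by positivity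
    have h2 : HasDerivAt (fun y : ℝ => 1 + y ^ 2) (2 * y) y := by
      simpa using (hasDerivAt_pow 2 y).const_add 1
    refine (((Phi_hasDerivAt y).const_sub 1).sub
      (((hasDerivAt_id y).div h2 h1).mul (gphi_hasDerivAt y))).congr_deriv ?_
    simp
    field_simp
    ring
  have hanti : StrictAnti g := strictAnti_of_hasDerivAt_neg hd fun y => by
    have := gphi_pos y
    have : 0 < 2 / (1 + y ^ 2) ^ 2 * gphi y := by positivity
    linarith
  have hlim : Tendsto g atTop (𝓝 0) := by
    have h1 : Tendsto (fun y => 1 - Phi y) atTop (𝓝 0) := by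
      simpa using Phi_atTop.const_sub 1
    have h2 : Tendsto (fun y : ℝ => y / (1 + y ^ 2) * gphi y) atTop (𝓝 0) := by
      have hp : Tendsto gphi atTop (𝓝 0) := by
        have : Tendsto (fun y : ℝ => -y ^ 2 / 2) atTop atBot := by
          have : Tendsto (fun y : ℝ => y ^ 2 / 2) atTop atTop :=
            (tendsto_pow_atTop two_ne_zero).atTop_div_const two_pos
          refine (tendsto_neg_atTop_atBot.comp this).congr fun y => ?_
          simp [neg_div]
        have := (Real.tendsto_exp_atBot.comp this).const_mul (Real.sqrt (2 * Real.pi))⁻¹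
        rw [mul_zero] at this
        exact this
      refine squeeze_zero' (g := gphi) ?_ ?_ hp
      · filter_upwards [eventually_ge_atTop 0] with y hy
        have := gphi_pos y
        positivity
      · filter_upwards [eventually_ge_atTop 0] with y hy
        have := gphi_pos y
        have : y / (1 + y ^ 2) ≤ 1 := by
          rw [div_le_one (by positivity)]; nlinarith [sq_nonneg (y-1)]
        nlinarith
    simpa using h1.sub h2
  have h0 : 0 ≤ g (x+1) := hanti.antitone.le_of_tendsto hlim (x+1)
  have := hanti (show x < x + 1 by linarith)
  simp only [hg] at *
  linarith

/-- tail function -/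
def Qt (x : ℝ) : ℝ := 1 - Phi x

lemma Qt_pos (x : ℝ) : 0 < Qt x := by have := Phi_lt_one x; unfold Qt; linarith

lemma ratio_anti : StrictAntiOn (fun x => gphi x / (x * Qt x)) (Ioi 0) := by
  have hd : ∀ x ∈ Ioi (0:ℝ), HasDerivAt (fun x => gphi x / (x * Qt x))
      (((-x * gphi x) * (x * Qt x) - gphi x * (1 * Qt x + x * (- gphi x))) / (x * Qt x) ^ 2) x := by
    intro x hx
    have hx : 0 < x := hx
    have := Qt_pos x
    exact (gphi_hasDerivAt x).div ((hasDerivAt_id x).mul ((Phi_hasDerivAt x).const_sub 1)) (by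
      exact (mul_pos hx this).ne')
  refine strictAntiOn_of_deriv_neg (convex_Ioi 0) (fun x hx => (hd x hx).continuousAt.continuousWithinAt) ?_
  intro x hx
  rw [interior_Ioi] at hx
  rw [(hd x hx).deriv]
  have hx : 0 < x := hx
  have h1 := mills hx
  change _ < Qt x at h1
  have h2 := Qt_pos x
  have h3 := gphi_pos x
  rw [div_mul_eq_mul_div, div_lt_iff₀ (by positivity)] at h1
  apply div_neg_of_neg_of_pos _ (by positivity)
  nlinarith

lemma superadd {p A b : ℝ} (hp : 0 < p) (hA : 0 < A) (hb : 0 < b) (h : Qt p = Qt A + Qt b) :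
    gphi A / A + gphi b / b < gphi p / p := by
  have anti : StrictAnti Qt := fun x y hxy => by
    have := Phi_strictMono hxy; unfold Qt; linarith
  have hpA : p < A := by
    rw [← anti.lt_iff_gt]; have := Qt_pos b; linarith
  have hpb : p < b := by
    rw [← anti.lt_iff_gt]; have := Qt_pos A; linarith
  have h1 := ratio_anti hp hA hpA
  have h2 := ratio_anti hp hb hpb
  simp only at h1 h2
  have e : ∀ x, 0 < x → gphi x / x = Qt x * (gphi x / (x * Qt x)) := by
    intro x hx; have := Qt_pos x; field_simp
  rw [e p hp, e A hA, e b hb]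
  have := Qt_pos A
  have := Qt_pos b
  generalize gphi p / (p * Qt p) = X at *
  rw [h]
  nlinarith


lemma PhiInv_contAt (x : ℝ) : ContinuousAt PhiInv (Phi x) := by
  rw [Metric.continuousAt_iff']
  intro ε hε
  rw [PhiInv_Phi]
  have h1 : Phi (x - ε) < Phi x := Phi_strictMono (by linarith)
  have h2 : Phi x < Phi (x + ε) := Phi_strictMono (by linarith)
  filter_upwards [Ioo_mem_nhds h1 h2] with y hy
  have hy0 : 0 < y := (Phi_pos _).trans hy.1
  have hy1 : y < 1 := hy.2.trans (Phi_lt_one _)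
  have e := Phi_PhiInv hy0 hy1
  rw [← e] at hy
  have l := Phi_strictMono.lt_iff_lt.1 hy.1
  have r := Phi_strictMono.lt_iff_lt.1 hy.2
  rw [Real.dist_eq, abs_lt]
  constructor <;> linarith

lemma PhiInv_hasDerivAt (x : ℝ) : HasDerivAt PhiInv (gphi x)⁻¹ (Phi x) := by
  have h : HasDerivAt Phi (gphi x) (PhiInv (Phi x)) := by
    rw [PhiInv_Phi]; exact Phi_hasDerivAt x
  refine h.of_local_left_inverse (PhiInv_contAt x) (gphi_pos x).ne' ?_
  filter_upwards [Ioo_mem_nhds (Phi_pos x) (Phi_lt_one x)] with y hy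
  exact Phi_PhiInv hy.1 hy.2

/-- `x / φ(x)` -/
def fq (x : ℝ) : ℝ := x / gphi x

lemma fq_neg (x : ℝ) : fq (-x) = - fq x := by simp [fq, gphi_neg, neg_div]

lemma fq_strictMono : StrictMono fq := by
  refine strictMono_of_hasDerivAt_pos (f' := fun x => (1 * gphi x - x * (-x * gphi x)) / gphi x ^ 2)
    (fun x => (hasDerivAt_id x).div (gphi_hasDerivAt x) (gphi_pos x).ne') fun x => ?_
  have := gphi_pos x
  apply div_pos _ (by positivity)
  have : 0 ≤ x ^ 2 * gphi x := by positivity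
  nlinarith

lemma fq_zero : fq 0 = 0 := by simp [fq]
lemma fq_pos {x : ℝ} (h : 0 < x) : 0 < fq x := by rw [← fq_zero]; exact fq_strictMono h

lemma Qt_anti : StrictAnti Qt := fun x y hxy => by
    have := Phi_strictMono hxy; unfold Qt; linarith

lemma superadd' {p A b : ℝ} (hp : 0 < p) (hA : 0 < A) (hb : 0 < b) (h : Qt p = Qt A + Qt b) :
    fq p * (fq A + fq b) < fq A * fq b := by
  have := superadd hp hA hb h
  have e : ∀ x, gphi x / x = (fq x)⁻¹ := by intro x; simp [fq]
  rw [e, e, e] at this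
  have h1 := fq_pos hp
  have h2 := fq_pos hA
  have h3 := fq_pos hb
  rw [inv_add_inv h2.ne' h3.ne', inv_eq_one_div, div_lt_div_iff₀ (by positivity) h1] at this
  linarith

lemma det_aux {p A b : ℝ} (h : Qt p = Qt A + Qt b) (hA : A < 0) :
    fq p * (fq A + fq b) < fq A * fq b := by
  have hQ : ∀ x, Qt (-x) = 1 - Qt x := by intro x; simp [Qt, Phi_neg]
  have hpA : p < A := by
    rw [← Qt_anti.lt_iff_gt]; have := Qt_pos b; linarith
  have hAb : -b < A := by
    rw [← Qt_anti.lt_iff_gt, hQ]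
    have : Qt p < 1 := by have := Phi_pos p; unfold Qt; linarith
    linarith
  have := superadd' (p := -A) (A := -p) (b := b) (by linarith) (by linarith) (by linarith) (by
    rw [hQ, hQ]; linarith)
  rw [fq_neg, fq_neg] at this
  linarith

lemma det_pos {p A b : ℝ} (h : Qt p = Qt A + Qt b) :
    fq p < fq A ∧ fq p < fq b ∧ fq p * (fq A + fq b) < fq A * fq b := by
  have hQ : ∀ x, Qt (-x) = 1 - Qt x := by intro x; simp [Qt, Phi_neg]
  have hpA : p < A := by
    rw [← Qt_anti.lt_iff_gt]; have := Qt_pos b; linarith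
  have hpb : p < b := by
    rw [← Qt_anti.lt_iff_gt]; have := Qt_pos A; linarith
  refine ⟨fq_strictMono hpA, fq_strictMono hpb, ?_⟩
  rcases lt_trichotomy p 0 with hp | hp | hp
  · have hp' : fq p < 0 := by rw [← fq_zero]; exact fq_strictMono hp
    rcases lt_or_ge A 0 with hA | hA
    · exact det_aux h hA
    rcases lt_or_ge b 0 with hb | hb
    · have := det_aux (p := p) (A := b) (b := A) (by linarith) hb
      linarith
    have h1 : 0 ≤ fq A := by rw [← fq_zero]; exact fq_strictMono.monotone hA
    have h2 : 0 ≤ fq b := by rw [← fq_zero]; exact fq_strictMono.monotone hb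
    have hAb : -b < A := by
      rw [← Qt_anti.lt_iff_gt, hQ]
      have : Qt p < 1 := by have := Phi_pos p; unfold Qt; linarith
      linarith
    have h3 := fq_strictMono hAb
    rw [fq_neg] at h3
    have : fq p * (fq A + fq b) < 0 := mul_neg_of_neg_of_pos hp' (by linarith)
    have : 0 ≤ fq A * fq b := by positivity
    linarith
  · subst hp
    rw [fq_zero, zero_mul]
    exact mul_pos (fq_pos hpA) (fq_pos hpb)
  · exact superadd' hp (hp.trans hpA) (hp.trans hpb) h

lemma negdef {P A B : ℝ} (h1 : P < A) (h2 : P < B) (h3 : P * (A + B) < A * B) {U V : ℝ}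
    (h : U ≠ 0 ∨ V ≠ 0) : P * (V - U) ^ 2 - B * V ^ 2 - A * U ^ 2 < 0 := by
  have key : (B - P) * (P * (V - U) ^ 2 - B * V ^ 2 - A * U ^ 2) =
    - (((B - P) * V + P * U) ^ 2 + (A * B - P * (A + B)) * U ^ 2) := by ring
  have hpos : 0 < ((B - P) * V + P * U) ^ 2 + (A * B - P * (A + B)) * U ^ 2 := by
    have h3' : 0 < A * B - P * (A + B) := by linarith
    by_cases hU : U = 0
    · subst hU
      have hV : V ≠ 0 := by simpa using h
      have : (B - P) * V ≠ 0 := mul_ne_zero (by linarith) hV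
      simp only [mul_zero, add_zero, ne_eq, OfNat.ofNat_ne_zero, not_false_eq_true, zero_pow]
      positivity
    · positivity
  have hBP : 0 < B - P := by linarith
  by_contra hc
  push Not at hc
  have := mul_nonneg hBP.le hc
  linarith

lemma ehrhard1_strict {a0 b0 a1 b1 t p0 p1 : ℝ} (h0 : a0 < b0) (h1 : a1 < b1)
    (hne : a1 - a0 ≠ 0 ∨ b1 - b0 ≠ 0) (ht0 : 0 < t) (ht1 : t < 1)
    (hp0 : Phi p0 = Phi b0 - Phi a0) (hp1 : Phi p1 = Phi b1 - Phi a1) :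
    Phi ((1 - t) * p0 + t * p1) < Phi ((1 - t) * b0 + t * b1) - Phi ((1 - t) * a0 + t * a1) := by
  set u := a1 - a0 with hu
  set v := b1 - b0 with hv
  set a : ℝ → ℝ := fun s => a0 + s * u with ha
  set b : ℝ → ℝ := fun s => b0 + s * v with hb
  set m : ℝ → ℝ := fun s => Phi (b s) - Phi (a s) with hm
  set p : ℝ → ℝ := fun s => PhiInv (m s) with hp
  have hda : ∀ s, HasDerivAt a u s := fun s => by
    exact (((hasDerivAt_id s).mul_const u).const_add a0).congr_deriv (one_mul _)
  have hdb : ∀ s, HasDerivAt b v s := fun s => by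
    exact (((hasDerivAt_id s).mul_const v).const_add b0).congr_deriv (one_mul _)
  set O : Set ℝ := {s | a s < b s} with hO
  have hOo : IsOpen O := isOpen_lt (by fun_prop) (by fun_prop)
  have hDO : ∀ s ∈ Icc (0:ℝ) 1, s ∈ O := by
    intro s hs
    simp only [hO, ha, hb, hu, hv, mem_ofPred_eq]
    nlinarith [hs.1, hs.2, mul_nonneg hs.1 (sub_pos.2 h1).le, mul_nonneg (sub_nonneg.2 hs.2) (sub_pos.2 h0).le]
  have hPp : ∀ s ∈ O, Phi (p s) = m s := by
    intro s hs
    have := Phi_strictMono hs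
    exact Phi_PhiInv (by simp only [hm]; linarith) (by
      simp only [hm]; linarith [Phi_lt_one (b s), Phi_pos (a s)])
  have hdm : ∀ s, HasDerivAt m (v * gphi (b s) - u * gphi (a s)) s := by
    intro s
    refine (((Phi_hasDerivAt (b s)).comp s (hdb s)).sub ((Phi_hasDerivAt (a s)).comp s (hda s))).congr_deriv ?_
    ring
  set q : ℝ → ℝ := fun s => (v * gphi (b s) - u * gphi (a s)) / gphi (p s) with hq
  have hdp : ∀ s ∈ O, HasDerivAt p (q s) s := by
    intro s hs
    have h := PhiInv_hasDerivAt (p s)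
    rw [hPp s hs] at h
    refine (h.comp s (hdm s)).congr_deriv ?_
    simp only [hq]; ring
  have hdq : ∀ s ∈ O, ∃ d, HasDerivAt q d s ∧ d < 0 := by
    intro s hs
    have hn : HasDerivAt (fun s => v * gphi (b s) - u * gphi (a s))
        (v * (-(b s) * gphi (b s) * v) - u * (-(a s) * gphi (a s) * u)) s :=
      (((gphi_hasDerivAt (b s)).comp s (hdb s)).const_mul v).sub
        (((gphi_hasDerivAt (a s)).comp s (hda s)).const_mul u)
    have hdn : HasDerivAt (fun s => gphi (p s)) (-(p s) * gphi (p s) * q s) s :=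
      (gphi_hasDerivAt (p s)).comp s (hdp s hs)
    refine ⟨_, hn.div hdn (gphi_pos _).ne', ?_⟩
    have hQ : Qt (p s) = Qt (- a s) + Qt (b s) := by
      have := hPp s hs
      simp only [Qt, Phi_neg, this, hm]; ring
    obtain ⟨k1, k2, k3⟩ := det_pos hQ
    have kk := negdef k1 k2 k3 (U := u * gphi (a s)) (V := v * gphi (b s)) (by
      rcases hne with h | h
      · exact Or.inl (mul_ne_zero h (gphi_pos _).ne')
      · exact Or.inr (mul_ne_zero h (gphi_pos _).ne'))
    have e : ((v * (-b s * gphi (b s) * v) - u * (-a s * gphi (a s) * u)) * gphi (p s) -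
          (v * gphi (b s) - u * gphi (a s)) * (-p s * gphi (p s) * q s)) / gphi (p s) ^ 2
        = (fq (p s) * (v * gphi (b s) - u * gphi (a s)) ^ 2 - fq (b s) * (v * gphi (b s)) ^ 2 -
          fq (-a s) * (u * gphi (a s)) ^ 2) / gphi (p s) := by
      have i1 := (gphi_pos (p s)).ne'
      have i2 := (gphi_pos (a s)).ne'
      have i3 := (gphi_pos (b s)).ne'
      simp only [hq, fq, gphi_neg]
      field_simp
      ring
    rw [e]
    exact div_neg_of_neg_of_pos kk (gphi_pos _)
  have hconc : StrictConcaveOn ℝ (Icc (0:ℝ) 1) p := by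
    refine StrictAntiOn.strictConcaveOn_of_deriv (convex_Icc 0 1)
      (fun s hs => (hdp s (hDO s hs)).continuousAt.continuousWithinAt) ?_
    have hqa : StrictAntiOn q (Icc 0 1) := by
      refine strictAntiOn_of_deriv_neg (convex_Icc 0 1) (fun s hs => ?_) (fun s hs => ?_)
      · obtain ⟨d, hd, _⟩ := hdq s (hDO s hs)
        exact hd.continuousAt.continuousWithinAt
      · obtain ⟨d, hd, hd0⟩ := hdq s (hDO s (interior_subset hs))
        rw [hd.deriv]; exact hd0
    intro x hx y hy hxy
    rw [(hdp x (hDO x (interior_subset hx))).deriv, (hdp y (hDO y (interior_subset hy))).deriv]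
    exact hqa (interior_subset hx) (interior_subset hy) hxy
  have := hconc.2 (show (0:ℝ) ∈ Icc (0:ℝ) 1 by simp) (show (1:ℝ) ∈ Icc (0:ℝ) 1 by simp)
    (by simp) (show 0 < 1 - t by linarith) ht0 (by ring)
  simp only [smul_eq_mul, mul_zero, mul_one, zero_add] at this
  have e0 : p 0 = p0 := by
    simp only [hp, hm, ha, hb, zero_mul, add_zero, ← hp0, PhiInv_Phi]
  have e1 : p 1 = p1 := by
    simp only [hp, hm, ha, hb, one_mul, hu, hv, add_sub_cancel, ← hp1, PhiInv_Phi]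
  rw [e0, e1] at this
  have := Phi_strictMono this
  rw [hPp t (hDO t ⟨ht0.le, ht1.le⟩)] at this
  have ea : a t = (1 - t) * a0 + t * a1 := by simp only [ha, hu]; ring
  have eb : b t = (1 - t) * b0 + t * b1 := by simp only [hb, hv]; ring
  simp only [hm] at this
  rwa [ea, eb] at this


lemma ehrhard1_le {a0 b0 a1 b1 t p0 p1 : ℝ} (h0 : a0 < b0) (h1 : a1 < b1)
    (ht0 : 0 < t) (ht1 : t < 1)
    (hp0 : Phi p0 = Phi b0 - Phi a0) (hp1 : Phi p1 = Phi b1 - Phi a1) :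
    Phi ((1 - t) * p0 + t * p1) ≤ Phi ((1 - t) * b0 + t * b1) - Phi ((1 - t) * a0 + t * a1) := by
  by_cases hne : a1 - a0 ≠ 0 ∨ b1 - b0 ≠ 0
  · exact (ehrhard1_strict h0 h1 hne ht0 ht1 hp0 hp1).le
  · push Not at hne
    have e1 : a1 = a0 := by linarith [hne.1]
    have e2 : b1 = b0 := by linarith [hne.2]
    subst e1 e2
    have e3 : p0 = p1 := Phi_strictMono.injective (hp0.trans hp1.symm)
    subst e3
    have : ∀ x, (1 - t) * x + t * x = x := fun x => by ring
    rw [this, this, this, hp0]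

lemma approx_Icc {I : Set ℝ} (hI : IsClosed I) (hc : Convex ℝ I) {p : ℝ} (h : Phi p < g1.real I) :
    ∃ a b, a < b ∧ a ∈ I ∧ b ∈ I ∧ Phi p ≤ Phi b - Phi a := by
  have h' : ENNReal.ofReal (Phi p) < g1 I := by
    rw [ENNReal.ofReal_lt_iff_lt_toReal (Phi_nonneg _) (measure_ne_top _ _)]
    exact h
  obtain ⟨C, hCI, hC, hlt⟩ := hI.measurableSet.exists_lt_isCompact h'
  have hlt' : Phi p < g1.real C := by
    rwa [ENNReal.ofReal_lt_iff_lt_toReal (Phi_nonneg _) (measure_ne_top _ _)] at hlt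
  have hne : C.Nonempty := by
    by_contra hne
    rw [not_nonempty_iff_eq_empty] at hne
    rw [hne] at hlt'
    simp at hlt'
    linarith [Phi_pos p]
  have ha := hC.sInf_mem hne
  have hb := hC.sSup_mem hne
  have hab : sInf C ≤ sSup C := csInf_le hC.bddBelow hb
  have hsub : C ⊆ Icc (sInf C) (sSup C) := fun x hx => ⟨csInf_le hC.bddBelow hx, le_csSup hC.bddAbove hx⟩
  have hle : g1.real C ≤ Phi (sSup C) - Phi (sInf C) := by
    rw [← g1_real_Icc hab]; exact measureReal_mono hsub
  refine ⟨sInf C, sSup C, ?_, hCI ha, hCI hb, by linarith⟩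
  rw [← Phi_strictMono.lt_iff_lt]
  linarith [Phi_pos p]

lemma Phi_diff_surj {a b : ℝ} (h : a < b) : ∃ p, Phi p = Phi b - Phi a :=
  Phi_surj (by linarith [Phi_strictMono h]) (by linarith [Phi_lt_one b, Phi_pos a])

lemma Icc_le_real {M : Set ℝ} (hc : Convex ℝ M) {a b : ℝ} (hab : a ≤ b) (ha : a ∈ M) (hb : b ∈ M) :
    Phi b - Phi a ≤ g1.real M := by
  rw [← g1_real_Icc hab]
  exact measureReal_mono (hc.ordConnected.out ha hb)

/-- Ehrhard's inequality on the line. -/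
lemma ehrhard1 {I J M : Set ℝ} (hI : IsClosed I) (hIc : Convex ℝ I) (hJ : IsClosed J)
    (hJc : Convex ℝ J) (hMc : Convex ℝ M) {t : ℝ} (ht0 : 0 < t) (ht1 : t < 1)
    (hsub : ∀ x ∈ I, ∀ y ∈ J, (1 - t) * x + t * y ∈ M) {p q : ℝ}
    (hp : Phi p ≤ g1.real I) (hq : Phi q ≤ g1.real J) :
    Phi ((1 - t) * p + t * q) ≤ g1.real M := by
  have main : ∀ ε : ℝ, 0 < ε → Phi ((1 - t) * p + t * q - ε) ≤ g1.real M := by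
    intro ε hε
    obtain ⟨a, b, hab, ha, hb, h⟩ := approx_Icc hI hIc ((Phi_strictMono (show p - ε < p by linarith)).trans_le hp)
    obtain ⟨c, d, hcd, hc, hd, h'⟩ := approx_Icc hJ hJc ((Phi_strictMono (show q - ε < q by linarith)).trans_le hq)
    obtain ⟨p', hp'⟩ := Phi_diff_surj hab
    obtain ⟨q', hq'⟩ := Phi_diff_surj hcd
    rw [← hp', Phi_strictMono.le_iff_le] at h
    rw [← hq', Phi_strictMono.le_iff_le] at h'
    have k := ehrhard1_le hab hcd ht0 ht1 hp' hq'
    have k2 := Icc_le_real hMc (a := (1 - t) * a + t * c) (b := (1 - t) * b + t * d) (by nlinarith)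
      (hsub a ha c hc) (hsub b hb d hd)
    refine le_trans (Phi_strictMono.monotone ?_) (k.trans k2)
    nlinarith
  have hl : Tendsto (fun ε : ℝ => Phi ((1 - t) * p + t * q - ε)) (𝓝[>] 0) (𝓝 (Phi ((1 - t) * p + t * q - 0))) :=
    ((Phi_cont.comp (continuous_const.sub continuous_id)).tendsto 0).mono_left nhdsWithin_le_nhds
  rw [sub_zero] at hl
  refine le_of_tendsto hl ?_
  filter_upwards [self_mem_nhdsWithin] with ε hε using main ε hε

lemma compact_convex_Icc {I : Set ℝ} (hI : IsCompact I) (hc : Convex ℝ I) (hpos : 0 < g1.real I) :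
    ∃ a b, a < b ∧ I = Icc a b := by
  have hne : I.Nonempty := by
    by_contra hne
    rw [not_nonempty_iff_eq_empty] at hne
    rw [hne] at hpos
    simp at hpos
  have hsub : I = Icc (sInf I) (sSup I) := by
    apply Subset.antisymm
    · exact fun x hx => ⟨csInf_le hI.bddBelow hx, le_csSup hI.bddAbove hx⟩
    · exact hc.ordConnected.out (hI.sInf_mem hne) (hI.sSup_mem hne)
  refine ⟨_, _, ?_, hsub⟩
  by_contra hle
  push Not at hle
  have hab : sInf I ≤ sSup I := csInf_le hI.bddBelow (hI.sSup_mem hne)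
  rw [hsub, g1_real_Icc hab, le_antisymm hab hle] at hpos
  simp at hpos

lemma ehrhard1_eq {I J M : Set ℝ} (hI : IsCompact I) (hIc : Convex ℝ I) (hJ : IsCompact J)
    (hJc : Convex ℝ J) (hM : IsCompact M) (hMc : Convex ℝ M) {t : ℝ} (ht0 : 0 < t) (ht1 : t < 1)
    (hsub : ∀ x ∈ I, ∀ y ∈ J, (1 - t) * x + t * y ∈ M) {p q : ℝ}
    (hp : Phi p ≤ g1.real I) (hq : Phi q ≤ g1.real J)
    (hle : g1.real M ≤ Phi ((1 - t) * p + t * q)) : I = M ∧ J = M := by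
  obtain ⟨a, b, hab, rfl⟩ := compact_convex_Icc hI hIc ((Phi_pos p).trans_le hp)
  obtain ⟨c, d, hcd, rfl⟩ := compact_convex_Icc hJ hJc ((Phi_pos q).trans_le hq)
  obtain ⟨p', hp'⟩ := Phi_diff_surj hab
  obtain ⟨q', hq'⟩ := Phi_diff_surj hcd
  rw [g1_real_Icc hab.le, ← hp', Phi_strictMono.le_iff_le] at hp
  rw [g1_real_Icc hcd.le, ← hq', Phi_strictMono.le_iff_le] at hq
  have hle' : g1.real M ≤ Phi ((1 - t) * p' + t * q') :=
    hle.trans (Phi_strictMono.monotone (by nlinarith))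
  have la := hsub a ⟨le_rfl, hab.le⟩ c ⟨le_rfl, hcd.le⟩
  have lb := hsub b ⟨hab.le, le_rfl⟩ d ⟨hcd.le, le_rfl⟩
  have k2 := Icc_le_real hMc (a := (1 - t) * a + t * c) (b := (1 - t) * b + t * d) (by nlinarith) la lb
  by_cases hne : c - a ≠ 0 ∨ d - b ≠ 0
  · have := ehrhard1_strict hab hcd hne ht0 ht1 hp' hq'
    linarith
  · push Not at hne
    have e1 : c = a := by linarith [hne.1]
    have e2 : d = b := by linarith [hne.2]
    subst e1 e2
    have e3 : p' = q' := Phi_strictMono.injective (hp'.trans hq'.symm)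
    subst e3
    have e : ∀ x, (1 - t) * x + t * x = x := fun x => by ring
    rw [e] at la lb hle'
    obtain ⟨x, y, hxy, rfl⟩ := compact_convex_Icc hM hMc (by
      rw [e, e] at k2
      linarith [Phi_strictMono hcd])
    rw [g1_real_Icc hxy.le, hp'] at hle'
    have h1 := Phi_strictMono.monotone la.1
    have h2 := Phi_strictMono.monotone lb.2
    have e4 : c = x := Phi_strictMono.injective (by linarith)
    have e5 : d = y := Phi_strictMono.injective (by linarith)
    rw [e4, e5]; simp


/-- the standard Gaussian measure on Euclidean space -/
abbrev Gn (n : ℕ) : Measure (Eu n) := stdGaussian (Eu n)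

/-- its density -/
def dens (n : ℕ) (x : Eu n) : ℝ := (Real.sqrt (2 * Real.pi))⁻¹ ^ n * Real.exp (-‖x‖ ^ 2 / 2)

lemma dens_pos {n : ℕ} (x : Eu n) : 0 < dens n x := by unfold dens; positivity

lemma dens_cont (n : ℕ) : Continuous (dens n) := by unfold dens; fun_prop

lemma exp_int (n : ℕ) : Integrable (fun x : Eu n => Real.exp (-‖x‖ ^ 2 / 2)) := by
  have h := GaussianFourier.integrable_cexp_neg_mul_sq_norm_add (V := Eu n) (b := 1 / 2)
    (by norm_num) 0 0
  refine h.norm.congr (Eventually.of_forall fun x => ?_)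
  simp only [Complex.norm_exp]
  congr 1
  have : (-(1 / 2 : ℂ) * (‖x‖ : ℂ) ^ 2 + 0 * ((⟪(0 : Eu n), x⟫ : ℝ) : ℂ)) = ((-‖x‖ ^ 2 / 2 : ℝ) : ℂ) := by
    push_cast; ring
  rw [this, Complex.ofReal_re]

lemma dens_int (n : ℕ) : Integrable (dens n) := (exp_int n).const_mul _

lemma Gn_eq (n : ℕ) : Gn n = volume.withDensity (fun x => ENNReal.ofReal (dens n x)) := by
  have hfin : IsFiniteMeasure (volume.withDensity (fun x : Eu n => ENNReal.ofReal (dens n x))) :=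
    isFiniteMeasure_withDensity_ofReal (dens_int n).2
  apply Measure.ext_of_charFun
  funext t
  rw [charFun_stdGaussian, charFun_apply, integral_withDensity_eq_integral_toReal_smul
    (by exact (dens_cont n).measurable.ennreal_ofReal) (Eventually.of_forall fun x => ENNReal.ofReal_lt_top)]
  have h := GaussianFourier.integral_cexp_neg_mul_sq_norm_add (V := Eu n) (b := 1 / 2)
    (by norm_num) Complex.I t
  have e : ∀ x : Eu n, (ENNReal.ofReal (dens n x)).toReal • Complex.exp (⟪x, t⟫ * Complex.I) =
      (((Real.sqrt (2 * Real.pi))⁻¹ ^ n : ℝ) : ℂ) *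
        Complex.exp (-(1 / 2 : ℂ) * ‖x‖ ^ 2 + Complex.I * ⟪t, x⟫) := by
    intro x
    rw [ENNReal.toReal_ofReal (dens_pos x).le, Complex.exp_add, Complex.real_smul, dens,
      real_inner_comm]
    push_cast
    rw [mul_assoc]
    congr 2
    · congr 1; ring
    · congr 1; ring
  simp_rw [e]
  rw [integral_const_mul, h]
  have h2 : ((Real.pi : ℂ) / (1 / 2)) ^ ((Module.finrank ℝ (Eu n) : ℂ) / 2) =
      ((Real.sqrt (2 * Real.pi) ^ n : ℝ) : ℂ) := by
    rw [finrank_euclideanSpace_fin, Real.sqrt_eq_rpow, ← Real.rpow_natCast, ← Real.rpow_mul (by positivity)]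
    rw [Complex.ofReal_cpow (by positivity)]
    push_cast
    congr 1 <;> ring
  rw [h2, ← mul_assoc, ← Complex.ofReal_mul, ← mul_pow, inv_mul_cancel₀ (by positivity), one_pow,
    Complex.ofReal_one, one_mul]
  congr 1
  simp
  ring

lemma gaussVol_eq {n : ℕ} {A : Set (Eu n)} (hA : MeasurableSet A) : gaussVol n A = (Gn n).real A := by
  rw [Gn_eq, measureReal_def, withDensity_apply _ hA, ← ofReal_integral_eq_lintegral_ofReal
    (dens_int n).integrableOn (Eventually.of_forall fun x => (dens_pos x).le),
    ENNReal.toReal_ofReal (integral_nonneg fun x => (dens_pos x).le), gaussVol]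
  unfold dens
  rw [integral_const_mul]

lemma Gn_ac (n : ℕ) : Gn n ≪ volume := by rw [Gn_eq]; exact withDensity_absolutelyContinuous _ _

lemma Gn_ac' (n : ℕ) : (volume : Measure (Eu n)) ≪ Gn n := by
  rw [Gn_eq]
  refine withDensity_absolutelyContinuous' (by exact (dens_cont n).measurable.ennreal_ofReal.aemeasurable)
    (Eventually.of_forall fun x => ?_)
  simp [dens_pos x]

instance (n : ℕ) : (Gn n).IsOpenPosMeasure := (Gn_ac' n).isOpenPosMeasure

/-- move `x` along direction `e` to height `s` -/
def mv {n : ℕ} (e x : Eu n) (s : ℝ) : Eu n := x + (s - ⟪x, e⟫) • e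

lemma mv_cont {n : ℕ} (e : Eu n) : Continuous (fun z : Eu n × ℝ => mv e z.1 z.2) := by
  unfold mv; fun_prop

lemma Gn_fib {n : ℕ} {e : Eu n} (he : ‖e‖ = 1) :
    ((Gn n).prod g1).map (fun z => mv e z.1 z.2) = Gn n := by
  have hp := Measure.isProbabilityMeasure_map (μ := (Gn n).prod g1) (mv_cont e).aemeasurable
  apply Measure.ext_of_charFun
  funext t
  rw [charFun_apply, integral_map (mv_cont e).aemeasurable (by fun_prop)]
  have h : ∀ z : Eu n × ℝ, Complex.exp (⟪mv e z.1 z.2, t⟫ * Complex.I) =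
      Complex.exp (⟪z.1, t - ⟪e, t⟫ • e⟫ * Complex.I) * Complex.exp (⟪e, t⟫ * z.2 * Complex.I) := by
    intro z
    rw [← Complex.exp_add, ← add_mul, mv]
    congr 2
    rw [← Complex.ofReal_mul, ← Complex.ofReal_add]
    congr 1
    simp only [inner_add_left, inner_sub_right, inner_smul_left, inner_smul_right]
    simp
    ring
  simp_rw [h]
  rw [integral_prod_mul (fun x => Complex.exp (⟪x, t - ⟪e, t⟫ • e⟫ * Complex.I))
    (fun s : ℝ => Complex.exp (⟪e, t⟫ * s * Complex.I)), ← charFun_apply, ← charFun_apply_real,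
    charFun_stdGaussian, charFun_stdGaussian, charFun_gaussianReal, ← Complex.exp_add]
  congr 1
  have : ‖t - ⟪e, t⟫ • e‖ ^ 2 = ‖t‖ ^ 2 - ⟪e, t⟫ ^ 2 := by
    rw [norm_sub_sq_real, norm_smul, mul_pow, he, inner_smul_right, real_inner_comm]
    simp; ring
  rw [← Complex.ofReal_pow, this]
  push_cast
  simp
  ring


section sym
variable {n : ℕ}

lemma mv_mv {e : Eu n} (he : ‖e‖ = 1) (x : Eu n) (s r : ℝ) : mv e (mv e x s) r = mv e x r := by
  have h : ⟪e, e⟫ = 1 := by rw [real_inner_self_eq_norm_sq, he]; norm_num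
  simp only [mv, inner_add_left, inner_smul_left, h]
  rw [add_assoc, ← add_smul]
  congr 2
  simp

lemma inner_mv {e : Eu n} (he : ‖e‖ = 1) (x : Eu n) (s : ℝ) : ⟪mv e x s, e⟫ = s := by
  have h : ⟪e, e⟫ = 1 := by rw [real_inner_self_eq_norm_sq, he]; norm_num
  simp only [mv, inner_add_left, inner_smul_left, h]
  simp

lemma mv_self (e x : Eu n) : mv e x ⟪x, e⟫ = x := by simp [mv]

lemma mv_combo (e x y : Eu n) (s r t : ℝ) :
    (1 - t) • mv e x s + t • mv e y r = mv e ((1 - t) • x + t • y) ((1 - t) * s + t * r) := by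
  simp only [mv, inner_add_left, inner_smul_left]
  simp only [conj_trivial]
  module

/-- fiber of `A` over `x` in direction `e` -/
def fb (e : Eu n) (A : Set (Eu n)) (x : Eu n) : Set ℝ := {s | mv e x s ∈ A}

lemma mem_fb {e : Eu n} {A : Set (Eu n)} {x : Eu n} {s : ℝ} : s ∈ fb e A x ↔ mv e x s ∈ A := Iff.rfl

lemma mv_cont_right (e x : Eu n) : Continuous (mv e x) := by unfold mv; fun_prop
lemma mv_cont_left (e : Eu n) (s : ℝ) : Continuous (fun x => mv e x s) := by unfold mv; fun_prop

lemma fb_closed {e : Eu n} {A : Set (Eu n)} (hA : IsClosed A) (x : Eu n) : IsClosed (fb e A x) :=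
  hA.preimage (mv_cont_right e x)

lemma fb_meas {e : Eu n} {A : Set (Eu n)} (hA : MeasurableSet A) (x : Eu n) : MeasurableSet (fb e A x) :=
  (mv_cont_right e x).measurable hA

lemma convex_of_combo {E : Type*} [AddCommGroup E] [Module ℝ E] {A : Set E}
    (h : ∀ t : ℝ, 0 < t → t < 1 → ∀ x ∈ A, ∀ y ∈ A, (1 - t) • x + t • y ∈ A) : Convex ℝ A := by
  rw [convex_iff_forall_pos]
  intro x hx y hy a b ha hb hab
  have : a = 1 - b := by linarith
  subst this
  exact h b hb (by linarith) x hx y hy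

lemma combo_mem {E : Type*} [AddCommGroup E] [Module ℝ E] {A : Set E} (hA : Convex ℝ A) {t : ℝ}
    (h0 : 0 < t) (h1 : t < 1) {x y : E} (hx : x ∈ A) (hy : y ∈ A) : (1 - t) • x + t • y ∈ A :=
  hA hx hy (by linarith) h0.le (by ring)

lemma fb_convex {e : Eu n} {A : Set (Eu n)} (hA : Convex ℝ A) (x : Eu n) : Convex ℝ (fb e A x) := by
  refine convex_of_combo fun t h0 h1 s hs r hr => ?_
  have := combo_mem hA h0 h1 hs hr
  rw [mv_combo] at this
  have e : (1 - t) • x + t • x = x := by module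
  rw [e] at this
  exact this

/-- Ehrhard symmetrization in direction `e` -/
def Sy (e : Eu n) (A : Set (Eu n)) : Set (Eu n) := {x | Phi (-⟪x, e⟫) ≤ g1.real (fb e A x)}

lemma mem_Sy {e : Eu n} {A : Set (Eu n)} {x : Eu n} :
    x ∈ Sy e A ↔ Phi (-⟪x, e⟫) ≤ g1.real (fb e A x) := Iff.rfl

lemma fb_mv {e : Eu n} (he : ‖e‖ = 1) (A : Set (Eu n)) (x : Eu n) (s : ℝ) :
    fb e A (mv e x s) = fb e A x := by
  ext r; simp only [mem_fb, mv_mv he]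

lemma fb_Sy {e : Eu n} (he : ‖e‖ = 1) (A : Set (Eu n)) (x : Eu n) :
    fb e (Sy e A) x = {s | Phi (-s) ≤ g1.real (fb e A x)} := by
  ext s
  rw [mem_fb, mem_Sy, fb_mv he, inner_mv he]; rfl

lemma upset_eq (p : ℝ) : {s | Phi (-s) ≤ Phi p} = Ici (-p) := by
  ext s
  simp only [mem_ofPred_eq, Phi_strictMono.le_iff_le, mem_Ici]
  constructor <;> intro h <;> linarith

lemma upset_real {m : ℝ} (h0 : 0 ≤ m) (h1 : m ≤ 1) : g1.real {s | Phi (-s) ≤ m} = m := by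
  rcases h0.eq_or_lt with rfl | h0
  · have : {s | Phi (-s) ≤ 0} = ∅ := by
      ext s; simp [Phi_pos]
    rw [this]; simp
  rcases h1.eq_or_lt with rfl | h1
  · have : {s | Phi (-s) ≤ 1} = univ := by
      ext s; simp [Phi_le_one]
    rw [this]; simp
  obtain ⟨p, rfl⟩ := Phi_surj h0 h1
  rw [upset_eq, g1_real_Ici, neg_neg]

lemma upset_meas (m : ℝ) : MeasurableSet {s | Phi (-s) ≤ m} :=
  (isClosed_le (Phi_cont.comp continuous_neg) continuous_const).measurableSet

lemma Gn_apply_fib {e : Eu n} (he : ‖e‖ = 1) {A : Set (Eu n)} (hA : MeasurableSet A) :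
    Gn n A = ∫⁻ x, g1 (fb e A x) ∂(Gn n) := by
  conv_lhs => rw [← Gn_fib he]
  rw [Measure.map_apply (mv_cont e).measurable hA, Measure.prod_apply ((mv_cont e).measurable hA)]
  rfl

lemma Sy_closed {e : Eu n} {A : Set (Eu n)} (hA : IsClosed A) : IsClosed (Sy e A) := by
  rw [← isSeqClosed_iff_isClosed]
  intro x y hx hxy
  rw [mem_Sy]
  set U : ℕ → Set ℝ := fun N => ⋂ k ≥ N, (fb e A (x k))ᶜ with hU
  have hmono : Monotone U := by
    intro a b hab
    exact biInter_mono (fun k hk => le_trans hab hk) fun k hk => Subset.rfl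
  have hsub : (fb e A y)ᶜ ⊆ ⋃ N, U N := by
    intro s hs
    have hlim : Tendsto (fun k => mv e (x k) s) atTop (𝓝 (mv e y s)) :=
      ((mv_cont_left e s).tendsto y).comp hxy
    have := hlim.eventually (hA.isOpen_compl.mem_nhds hs)
    obtain ⟨N, hN⟩ := eventually_atTop.1 this
    simp only [hU, mem_iUnion, mem_iInter]
    exact ⟨N, fun k hk => hN k hk⟩
  have h1 := tendsto_measure_iUnion_atTop (μ := g1) hmono
  have h2 : Tendsto (fun N => g1.real (U N)) atTop (𝓝 (g1.real (⋃ N, U N))) :=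
    (ENNReal.tendsto_toReal (measure_ne_top _ _)).comp h1
  have h3 : ∀ N, g1.real (U N) ≤ 1 - Phi (-⟪x N, e⟫) := by
    intro N
    have : g1.real (U N) ≤ g1.real (fb e A (x N))ᶜ := measureReal_mono (biInter_subset_of_mem (le_refl N))
    rw [probReal_compl_eq_one_sub (fb_meas hA.measurableSet _)] at this
    have := mem_Sy.1 (hx N)
    linarith
  have h4 : Tendsto (fun N => 1 - Phi (-⟪x N, e⟫)) atTop (𝓝 (1 - Phi (-⟪y, e⟫))) := by
    have : Continuous fun y : Eu n => 1 - Phi (-⟪y, e⟫) := by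
      have := Phi_cont
      fun_prop
    exact (this.tendsto y).comp hxy
  have h5 := le_of_tendsto_of_tendsto' h2 h4 h3
  have h6 : g1.real (fb e A y)ᶜ ≤ _ := (measureReal_mono hsub).trans h5
  rw [probReal_compl_eq_one_sub (fb_meas hA.measurableSet _)] at h6
  linarith

lemma Sy_measure {e : Eu n} (he : ‖e‖ = 1) {A : Set (Eu n)} (hA : IsClosed A) :
    Gn n (Sy e A) = Gn n A := by
  rw [Gn_apply_fib he (Sy_closed hA).measurableSet, Gn_apply_fib he hA.measurableSet]
  congr 1
  funext x
  have := upset_real (m := g1.real (fb e A x)) measureReal_nonneg measureReal_le_one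
  rw [fb_Sy he]
  exact (measureReal_eq_measureReal_iff).1 this

lemma Sy_combo {e : Eu n} {A B M : Set (Eu n)} (hA : IsClosed A) (hAc : Convex ℝ A)
    (hB : IsClosed B) (hBc : Convex ℝ B) (hMc : Convex ℝ M) {t : ℝ} (ht0 : 0 < t) (ht1 : t < 1)
    (hsub : ∀ x ∈ A, ∀ y ∈ B, (1 - t) • x + t • y ∈ M) {x y : Eu n} (hx : x ∈ Sy e A)
    (hy : y ∈ Sy e B) : (1 - t) • x + t • y ∈ Sy e M := by
  rw [mem_Sy] at *
  have := ehrhard1 (fb_closed hA x) (fb_convex hAc x) (fb_closed hB y) (fb_convex hBc y)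
    (fb_convex hMc ((1 - t) • x + t • y)) ht0 ht1 (fun s hs r hr => by
      rw [mem_fb, ← mv_combo]
      exact hsub _ hs _ hr) hx hy
  convert this using 2
  simp only [inner_add_left, inner_smul_left, conj_trivial]
  ring

lemma Sy_convex {e : Eu n} {A : Set (Eu n)} (hA : IsClosed A) (hAc : Convex ℝ A) : Convex ℝ (Sy e A) :=
  convex_of_combo fun _ h0 h1 _ hx _ hy => Sy_combo hA hAc hA hAc hAc h0 h1
    (fun _ hx _ hy => combo_mem hAc h0 h1 hx hy) hx hy

lemma Sy_up {e : Eu n} (he : ‖e‖ = 1) {A : Set (Eu n)} {x : Eu n} (hx : x ∈ Sy e A) {s : ℝ} (hs : 0 ≤ s) :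
    x + s • e ∈ Sy e A := by
  have h : x + s • e = mv e x (⟪x, e⟫ + s) := by simp [mv]
  rw [h, mem_Sy, fb_mv he, inner_mv he]
  exact (Phi_strictMono.monotone (by linarith)).trans hx
end sym


section jfun
variable {n : ℕ}

lemma fibJ {I : Set ℝ} (hI : MeasurableSet I) {f : ℝ → ℝ} (hf : StrictMono f) (hfi : Integrable f g1) :
    (∫ s in I, f s ∂g1) ≤ (∫ s in {s | Phi (-s) ≤ g1.real I}, f s ∂g1) ∧
    ((∫ s in {s | Phi (-s) ≤ g1.real I}, f s ∂g1) ≤ (∫ s in I, f s ∂g1) →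
      {s | Phi (-s) ≤ g1.real I} =ᵐ[g1] I) := by
  have hm0 : 0 ≤ g1.real I := measureReal_nonneg
  have hm1 : g1.real I ≤ 1 := measureReal_le_one
  have key : {s | Phi (-s) ≤ g1.real I} =ᵐ[g1] I → (∫ s in I, f s ∂g1) ≤ (∫ s in {s | Phi (-s) ≤ g1.real I}, f s ∂g1) ∧
    ((∫ s in {s | Phi (-s) ≤ g1.real I}, f s ∂g1) ≤ (∫ s in I, f s ∂g1) →
      {s | Phi (-s) ≤ g1.real I} =ᵐ[g1] I) := fun h => ⟨(setIntegral_congr_set h).ge, fun _ => h⟩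
  rcases hm0.eq_or_lt with h0 | h0
  · apply key
    have h1 : {s | Phi (-s) ≤ g1.real I} = ∅ := by
      rw [← h0]; ext s; simp [Phi_pos]
    rw [h1]
    refine (ae_eq_empty.2 ?_).symm
    exact (measureReal_eq_zero_iff).1 h0.symm
  rcases hm1.eq_or_lt with h1 | h1
  · apply key
    have h2 : {s | Phi (-s) ≤ g1.real I} = univ := by
      rw [h1]; ext s; simp [Phi_le_one]
    rw [h2]
    refine (ae_eq_univ.2 ?_).symm
    rw [← measureReal_eq_zero_iff, probReal_compl_eq_one_sub hI, h1, sub_self]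
  obtain ⟨p, hp⟩ := Phi_surj h0 h1
  rw [← hp, upset_eq]
  set r := -p with hr
  have hmr : g1.real (Ici r) = g1.real I := by rw [g1_real_Ici, hr, neg_neg, hp]
  set g : ℝ → ℝ := fun s => ((Ici r).indicator 1 s - I.indicator 1 s) * (f s - f r) with hg
  have hg0 : ∀ s, 0 ≤ g s := by
    intro s
    simp only [hg]
    by_cases h1 : s ∈ Ici r
    · have : f r ≤ f s := hf.monotone h1
      by_cases h2 : s ∈ I <;> simp [h1, h2] <;> linarith
    · have : f s ≤ f r := hf.monotone (not_le.1 h1).le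
      by_cases h2 : s ∈ I <;> simp [h1, h2] <;> linarith
  have hge : g = fun s => (((Ici r).indicator f s - I.indicator f s) -
      ((Ici r).indicator (fun _ => f r) s - I.indicator (fun _ => f r) s)) := by
    funext s
    simp only [hg]
    by_cases h1 : s ∈ Ici r <;> by_cases h2 : s ∈ I <;> simp [h1, h2] <;> ring
  have hi1 : Integrable ((Ici r).indicator f) g1 := hfi.indicator measurableSet_Ici
  have hi2 : Integrable (I.indicator f) g1 := hfi.indicator hI
  have hi3 : Integrable ((Ici r).indicator (fun _ => f r)) g1 := (integrable_const _).indicator measurableSet_Ici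
  have hi4 : Integrable (I.indicator (fun _ => f r)) g1 := (integrable_const _).indicator hI
  have hgi : Integrable g g1 := by rw [hge]; exact (hi1.sub hi2).sub (hi3.sub hi4)
  have intgPhi : ∫ s, g s ∂g1 = (∫ s in Ici r, f s ∂g1) - ∫ s in I, f s ∂g1 := by
    have hs1 := integral_sub (hi1.sub hi2) (hi3.sub hi4)
    simp only [Pi.sub_apply] at hs1
    rw [hge, hs1, integral_sub hi1 hi2, integral_sub hi3 hi4,
      integral_indicator measurableSet_Ici, integral_indicator hI, integral_indicator measurableSet_Ici,
      integral_indicator hI, setIntegral_const, setIntegral_const, hmr]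
    ring
  refine ⟨?_, fun hle => ?_⟩
  · have := integral_nonneg (μ := g1) (f := g) (fun x => hg0 x)
    linarith
  · have h0 : ∫ s, g s ∂g1 = 0 := le_antisymm (by linarith) (integral_nonneg (fun x => hg0 x))
    rw [integral_eq_zero_iff_of_nonneg hg0 hgi] at h0
    have hne : ∀ᵐ s ∂g1, s ≠ r := by
      have : NullSingletonClass g1 := nullSingletonClass_gaussianReal one_ne_zero
      exact (measure_singleton r : g1 {r} = 0) |> fun h => measure_eq_zero_iff_ae_notMem.1 h
    filter_upwards [h0, hne] with s hs hsr
    simp only [hg, Pi.zero_apply] at hs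
    have hfs : f s - f r ≠ 0 := sub_ne_zero.2 (fun h => hsr (hf.injective h))
    have hs' := (mul_eq_zero.1 hs).resolve_right hfs
    by_cases h1 : s ∈ Ici r <;> by_cases h2 : s ∈ I <;> simp [h1, h2] at hs' <;>
     · apply propext; constructor <;> intro h <;> first | exact h1 | exact h2 | exact (h1 h).elim | exact (h2 h).elim

/-- linear-type functional -/
def Jf (θ : Eu n) (A : Set (Eu n)) : ℝ := ∫ x in A, Phi ⟪x, θ⟫ ∂(Gn n)

lemma intgPhi (θ : Eu n) : Integrable (fun x : Eu n => Phi ⟪x, θ⟫) (Gn n) := by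
  have := Phi_cont
  refine Integrable.of_bound (C := 1) (by fun_prop) (Eventually.of_forall fun x => ?_)
  rw [Real.norm_eq_abs, abs_of_nonneg (Phi_nonneg _)]
  exact Phi_le_one _

lemma Jf_nonneg (θ : Eu n) (A : Set (Eu n)) : 0 ≤ Jf θ A := integral_nonneg fun x => Phi_nonneg _

lemma Jf_le_one (θ : Eu n) (A : Set (Eu n)) : Jf θ A ≤ 1 := by
  have h1 : Jf θ A ≤ ∫ x, Phi ⟪x, θ⟫ ∂(Gn n) :=
    setIntegral_le_integral (intgPhi θ) (Eventually.of_forall fun x => Phi_nonneg _)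
  have h2 : ∫ x, Phi ⟪x, θ⟫ ∂(Gn n) ≤ ∫ x, (1 : ℝ) ∂(Gn n) :=
    integral_mono (intgPhi θ) (integrable_const _) (fun x => Phi_le_one _)
  simp at h2
  linarith

lemma inner_mv' (e x θ : Eu n) (s : ℝ) : ⟪mv e x s, θ⟫ = (⟪x, θ⟫ - ⟪x, e⟫ * ⟪e, θ⟫) + ⟪e, θ⟫ * s := by
  simp only [mv, inner_add_left, inner_smul_left]
  simp
  ring

lemma Jind (θ : Eu n) {e : Eu n} {A : Set (Eu n)} (hA : MeasurableSet A) :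
    Integrable (fun z : Eu n × ℝ => A.indicator (fun x => Phi ⟪x, θ⟫) (mv e z.1 z.2)) ((Gn n).prod g1) := by
  have h1 : Measurable (A.indicator (fun x => Phi ⟪x, θ⟫)) := by
    have := Phi_cont
    exact Measurable.indicator (by fun_prop) hA
  refine Integrable.of_bound (C := 1) (h1.comp (mv_cont e).measurable).aestronglyMeasurable
    (Eventually.of_forall fun z => ?_)
  refine (norm_indicator_le_norm_self _ _).trans ?_
  rw [Real.norm_eq_abs, abs_of_nonneg (Phi_nonneg _)]
  exact Phi_le_one _

lemma Jf_fib (θ : Eu n) {e : Eu n} (he : ‖e‖ = 1) {A : Set (Eu n)} (hA : MeasurableSet A) :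
    Jf θ A = ∫ x, (∫ s in fb e A x, Phi ⟪mv e x s, θ⟫ ∂g1) ∂(Gn n) := by
  have h1 : Measurable (A.indicator (fun x => Phi ⟪x, θ⟫)) := by
    have := Phi_cont
    exact Measurable.indicator (by fun_prop) hA
  rw [Jf, ← integral_indicator hA]
  conv_lhs => rw [← Gn_fib he]
  rw [integral_map (mv_cont e).aemeasurable h1.aestronglyMeasurable, integral_prod _ (Jind θ hA)]
  congr 1
  funext x
  rw [← integral_indicator (fb_meas hA x)]
  rfl

lemma Jf_fib_int (θ : Eu n) {e : Eu n} {A : Set (Eu n)} (hA : MeasurableSet A) :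
    Integrable (fun x => ∫ s in fb e A x, Phi ⟪mv e x s, θ⟫ ∂g1) (Gn n) := by
  refine (Jind (e := e) θ hA).integral_prod_left.congr (Eventually.of_forall fun x => ?_)
  simp only
  rw [← integral_indicator (fb_meas hA x)]
  rfl

lemma Jf_Sy {θ e : Eu n} (he : ‖e‖ = 1) (heθ : 0 < ⟪e, θ⟫) {A : Set (Eu n)} (hA : IsClosed A) :
    Jf θ A ≤ Jf θ (Sy e A) ∧ (Jf θ (Sy e A) ≤ Jf θ A → Sy e A =ᵐ[Gn n] A) := by
  have hS := Sy_closed (e := e) hA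
  have hmono : ∀ x, StrictMono (fun s => Phi ⟪mv e x s, θ⟫) := by
    intro x s r hsr
    apply Phi_strictMono
    rw [inner_mv', inner_mv']
    have := mul_lt_mul_of_pos_left hsr heθ
    linarith
  have hfi : ∀ x, Integrable (fun s => Phi ⟪mv e x s, θ⟫) g1 := by
    intro x
    have h1 := Phi_cont
    have h2 := mv_cont_right e x
    refine Integrable.of_bound (C := 1) (by fun_prop) (Eventually.of_forall fun x => ?_)
    rw [Real.norm_eq_abs, abs_of_nonneg (Phi_nonneg _)]
    exact Phi_le_one _
  have hk := fun x => fibJ (fb_meas (e := e) hA.measurableSet x) (hmono x) (hfi x)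
  simp only [← fb_Sy he] at hk
  have hle : ∀ x, 0 ≤ (∫ s in fb e (Sy e A) x, Phi ⟪mv e x s, θ⟫ ∂g1) - ∫ s in fb e A x, Phi ⟪mv e x s, θ⟫ ∂g1 :=
    fun x => sub_nonneg.2 (hk x).1
  have hi1 := Jf_fib_int (e := e) θ hA.measurableSet
  have hi2 := Jf_fib_int (e := e) θ hS.measurableSet
  have hJ : ∫ x, ((∫ s in fb e (Sy e A) x, Phi ⟪mv e x s, θ⟫ ∂g1) - ∫ s in fb e A x, Phi ⟪mv e x s, θ⟫ ∂g1) ∂(Gn n)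
      = Jf θ (Sy e A) - Jf θ A := by
    rw [integral_sub hi2 hi1, Jf_fib θ he hA.measurableSet, Jf_fib θ he hS.measurableSet]
  have h0 : 0 ≤ ∫ x, ((∫ s in fb e (Sy e A) x, Phi ⟪mv e x s, θ⟫ ∂g1) - ∫ s in fb e A x, Phi ⟪mv e x s, θ⟫ ∂g1) ∂(Gn n) :=
    integral_nonneg (fun x => hle x)
  refine ⟨by linarith, fun h => ?_⟩
  have h0' := le_antisymm (by linarith) h0
  rw [integral_eq_zero_iff_of_nonneg hle (hi2.sub hi1)] at h0'
  have hae : ∀ᵐ x ∂(Gn n), ∀ᵐ s ∂g1, (mv e x s ∈ Sy e A ↔ mv e x s ∈ A) := by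
    filter_upwards [h0'] with x hx
    have := (hk x).2 (by simp only [Pi.zero_apply] at hx; linarith)
    filter_upwards [this] with s hs
    exact iff_of_eq hs
  have hms : MeasurableSet {x : Eu n | x ∈ Sy e A ↔ x ∈ A} := by
    exact MeasurableSet.iff hS.measurableSet hA.measurableSet
  have h3 : ∀ᵐ z ∂((Gn n).prod g1), (mv e z.1 z.2 ∈ Sy e A ↔ mv e z.1 z.2 ∈ A) := by
    exact (Measure.ae_prod_iff_ae_ae (p := fun z : Eu n × ℝ => (mv e z.1 z.2 ∈ Sy e A ↔ mv e z.1 z.2 ∈ A))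
      ((mv_cont e).measurable hms)).2 hae
  have h4 : ∀ᵐ x ∂(Gn n), (x ∈ Sy e A ↔ x ∈ A) := by
    rw [← Gn_fib he, ae_map_iff (mv_cont e).aemeasurable hms]
    exact h3
  filter_upwards [h4] with x hx
  exact propext hx
end jfun


section cvx
variable {n : ℕ}

lemma frontier_null {A : Set (Eu n)} (hA : Convex ℝ A) : Gn n (frontier A) = 0 :=
  Gn_ac n (hA.addHaar_frontier volume)

lemma int_nonempty {S : Set (Eu n)} (hS : IsClosed S) (hSc : Convex ℝ S) (hpos : Gn n S ≠ 0) :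
    (interior S).Nonempty := by
  by_contra h
  rw [not_nonempty_iff_eq_empty] at h
  apply hpos
  have := frontier_null hSc
  rwa [frontier, h, hS.closure_eq, sdiff_empty] at this

lemma closure_int {S : Set (Eu n)} (hS : IsClosed S) (hSc : Convex ℝ S) (hpos : (interior S).Nonempty) :
    closure (interior S) = S := by
  rw [hSc.closure_interior_eq_closure_of_nonempty_interior hpos, hS.closure_eq]

lemma sub_of_null {W S : Set (Eu n)} (hW : IsClosed W) (hS : IsClosed S) (hSc : Convex ℝ S)
    (hpos : Gn n S ≠ 0) (h : Gn n (S \ W) = 0) : S ⊆ W := by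
  have h1 : IsOpen (interior S \ W) := isOpen_interior.sdiff hW
  have h2 : Gn n (interior S \ W) = 0 :=
    measure_mono_null (sdiff_subset_sdiff_left interior_subset) h
  have h3 := (h1.measure_eq_zero_iff (Gn n)).1 h2
  rw [← closure_int hS hSc (int_nonempty hS hSc hpos)]
  refine closure_minimal ?_ hW
  exact sdiff_eq_empty.1 h3

lemma sub_of_le {W S : Set (Eu n)} (hW : IsClosed W) (hS : IsClosed S) (hSc : Convex ℝ S)
    (hpos : Gn n S ≠ 0) (hWS : W ⊆ S) (h : (Gn n).real S ≤ (Gn n).real W) : S = W := by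
  refine Subset.antisymm (sub_of_null hW hS hSc hpos ?_) hWS
  rw [← measureReal_eq_zero_iff, measureReal_sdiff hWS hW.measurableSet]
  have := measureReal_mono (μ := Gn n) hWS
  linarith

lemma eq_of_ae {W S : Set (Eu n)} (hW : IsClosed W) (hWc : Convex ℝ W) (hS : IsClosed S) (hSc : Convex ℝ S)
    (hpos : Gn n S ≠ 0) (h : S =ᵐ[Gn n] W) : S = W := by
  refine Subset.antisymm (sub_of_null hW hS hSc hpos ?_) (sub_of_null hS hW hWc ?_ ?_)
  · exact (ae_eq_set.1 h).1
  · rwa [← measure_congr h]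
  · exact (ae_eq_set.1 h).2
end cvx


section cpt
variable {n : ℕ}

/-- lower limit of a sequence of sets -/
def Lo (A : ℕ → Set (Eu n)) : Set (Eu n) := {x | ∀ r > 0, ∀ᶠ j in atTop, (A j ∩ ball x r).Nonempty}

/-- convergence of sets to `Lo A` -/
def Cv (A : ℕ → Set (Eu n)) : Prop := ∀ x, x ∉ Lo A → ∀ᶠ j in atTop, x ∉ A j

lemma Lo_closed (A : ℕ → Set (Eu n)) : IsClosed (Lo A) := by
  rw [← closure_subset_iff_isClosed]
  intro x hx r hr
  rw [Metric.mem_closure_iff] at hx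
  obtain ⟨y, hy, hxy⟩ := hx (r / 2) (by linarith)
  filter_upwards [hy (r / 2) (by linarith)] with j hj
  refine hj.mono (inter_subset_inter_right _ (ball_subset_ball' ?_))
  rw [dist_comm] at hxy
  linarith

lemma Lo_convex {A : ℕ → Set (Eu n)} (hA : ∀ j, Convex ℝ (A j)) : Convex ℝ (Lo A) := by
  refine convex_of_combo fun t h0 h1 x hx y hy r hr => ?_
  filter_upwards [hx r hr, hy r hr] with j hj1 hj2
  obtain ⟨a, ha, hax⟩ := hj1
  obtain ⟨b, hb, hby⟩ := hj2
  refine ⟨_, combo_mem (hA j) h0 h1 ha hb, ?_⟩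
  have hc := convex_ball (0 : Eu n) r
  rw [mem_ball_iff_norm] at *
  have h3 := combo_mem hc h0 h1 (x := a - x) (y := b - y) (by simpa using hax) (by simpa using hby)
  have e : (1 - t) • a + t • b - ((1 - t) • x + t • y) = (1 - t) • (a - x) + t • (b - y) := by module
  rw [e]
  simpa using h3

lemma exists_cv (A : ℕ → Set (Eu n)) : ∃ φ : ℕ → ℕ, StrictMono φ ∧ ∀ ψ : ℕ → ℕ, StrictMono ψ →
    Cv (fun j => A (φ (ψ j))) := by
  classical
  let ι := TopologicalSpace.countableBasis (Eu n)
  let s : ℕ → ι → Bool := fun j U => decide (A j ∩ U.1).Nonempty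
  obtain ⟨l, φ, hφ, hl⟩ := CompactSpace.tendsto_subseq s
  refine ⟨φ, hφ, fun ψ hψ x hx => ?_⟩
  simp only [Lo, mem_ofPred_eq] at hx
  push Not at hx
  obtain ⟨r, hr, hx⟩ := hx
  obtain ⟨U, hU, hxU, hUr⟩ := (TopologicalSpace.isBasis_countableBasis (Eu n)).exists_subset_of_mem_open
    (mem_ball_self hr) isOpen_ball
  have h1 := (tendsto_pi_nhds.1 hl) ⟨U, hU⟩
  have h2 : ∀ᶠ j in atTop, s (φ (ψ j)) ⟨U, hU⟩ = l ⟨U, hU⟩ := by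
    have := (h1.comp hψ.tendsto_atTop).eventually (isOpen_discrete {l ⟨U, hU⟩} |>.mem_nhds rfl)
    exact this
  obtain ⟨j, hj1, hj2⟩ := (hx.and_eventually h2).exists
  have h3 : l ⟨U, hU⟩ = false := by
    rw [← hj2]
    simp only [s, decide_eq_false_iff_not, not_nonempty_iff_eq_empty]
    rw [← subset_empty_iff, ← hj1]
    exact inter_subset_inter_right _ hUr
  filter_upwards [h2] with j hj hxj
  rw [h3] at hj
  simp only [s, decide_eq_false_iff_not] at hj
  exact hj ⟨x, hxj, hxU⟩

lemma int_Lo {A : ℕ → Set (Eu n)} (hA : ∀ j, IsClosed (A j)) (hAc : ∀ j, Convex ℝ (A j)) {a : Eu n}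
    (ha : a ∈ interior (Lo A)) : ∀ᶠ j in atTop, a ∈ A j := by
  obtain ⟨ρ, hρ, hball⟩ := Metric.mem_nhds_iff.1 (mem_interior_iff_mem_nhds.1 ha)
  obtain ⟨N, hN, hNf, hcov⟩ := (isCompact_sphere (0 : Eu n) 1).finite_cover_balls (e := 1 / 4) (by norm_num)
  have hev : ∀ᶠ j in atTop, ∀ ν ∈ N, (A j ∩ ball (a + (ρ / 2) • ν) (ρ / 8)).Nonempty := by
    rw [hNf.eventually_all]
    intro ν hν
    have hν1 : ‖ν‖ = 1 := by simpa using hN hν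
    refine (hball (?_ : a + (ρ / 2) • ν ∈ ball a ρ)) (ρ / 8) (by linarith)
    rw [mem_ball_iff_norm, add_sub_cancel_left, norm_smul, hν1, Real.norm_eq_abs, abs_of_pos (by linarith)]
    linarith
  have hev0 : ∀ᶠ j in atTop, (A j).Nonempty := by
    filter_upwards [(hball (mem_ball_self hρ)) 1 one_pos] with j hj
    exact hj.mono inter_subset_left
  filter_upwards [hev, hev0] with j hj hj0
  by_contra hcon
  obtain ⟨f, u, hf1, hf2⟩ := geometric_hahn_banach_closed_point (hAc j) (hA j) hcon
  set w := (InnerProductSpace.toDual ℝ (Eu n)).symm f with hw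
  have hfw : ∀ y, f y = ⟪w, y⟫ := fun y => by rw [hw, InnerProductSpace.toDual_symm_apply]
  have hw0 : w ≠ 0 := by
    intro h
    obtain ⟨y, hy⟩ := hj0
    have := hf1 y hy
    rw [hfw, h] at this hf2
    simp at this hf2
    linarith
  have hwn : 0 < ‖w‖ := norm_pos_iff.2 hw0
  set v := ‖w‖⁻¹ • w with hv
  have hv1 : ‖v‖ = 1 := by rw [hv, norm_smul, norm_inv, norm_norm, inv_mul_cancel₀ hwn.ne']
  have hcv := hcov (by simpa using hv1 : v ∈ sphere (0 : Eu n) 1)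
  simp only [mem_iUnion] at hcv
  obtain ⟨ν, hν, hνv⟩ := hcv
  obtain ⟨y, hyA, hy⟩ := hj ν hν
  have h1 : ⟪w, y⟫ < ⟪w, a⟫ := by
    have := hf1 y hyA
    rw [← hfw, ← hfw]; linarith
  have h2 : ⟪v, y - a⟫ < 0 := by
    rw [hv, inner_smul_left, inner_sub_right]
    simp only [conj_trivial]
    exact mul_neg_of_pos_of_neg (inv_pos.2 hwn) (by linarith)
  clear_value v
  rw [mem_ball_iff_norm] at hy hνv
  have e : y - a = (y - (a + (ρ / 2) • ν)) + (ρ / 2) • v - (ρ / 2) • (v - ν) := by module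
  rw [e, inner_sub_right, inner_add_right, inner_smul_right, inner_smul_right, real_inner_self_eq_norm_sq, hv1] at h2
  have h3 := (abs_le.1 ((abs_real_inner_le_norm v (y - (a + (ρ / 2) • ν))).trans_eq (by rw [hv1, one_mul]))).1
  have h4 := (abs_le.1 ((abs_real_inner_le_norm v (v - ν)).trans_eq (by rw [hv1, one_mul]))).2
  nlinarith

lemma cv_ind {A : ℕ → Set (Eu n)} (hA : ∀ j, IsClosed (A j)) (hAc : ∀ j, Convex ℝ (A j)) (h : Cv A)
    {f : Eu n → ℝ} (hf : Integrable f (Gn n)) :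
    Tendsto (fun j => ∫ x in A j, f x ∂(Gn n)) atTop (𝓝 (∫ x in Lo A, f x ∂(Gn n))) := by
  simp_rw [← integral_indicator (hA _).measurableSet, ← integral_indicator (Lo_closed A).measurableSet]
  refine tendsto_integral_of_dominated_convergence (fun x => ‖f x‖)
    (fun j => (hf.indicator (hA j).measurableSet).aestronglyMeasurable) hf.norm
    (fun j => Eventually.of_forall fun x => norm_indicator_le_norm_self _ _) ?_
  have h0 := measure_eq_zero_iff_ae_notMem.1 (frontier_null (Lo_convex hAc))
  filter_upwards [h0] with x hx
  apply tendsto_const_nhds.congr'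
  by_cases hxL : x ∈ Lo A
  · have hxi : x ∈ interior (Lo A) := by
      by_contra hc
      exact hx ⟨subset_closure hxL, hc⟩
    filter_upwards [int_Lo hA hAc hxi] with j hj
    rw [indicator_of_mem hj, indicator_of_mem hxL]
  · filter_upwards [h x hxL] with j hj
    rw [indicator_of_notMem hj, indicator_of_notMem hxL]

lemma cv_meas {A : ℕ → Set (Eu n)} (hA : ∀ j, IsClosed (A j)) (hAc : ∀ j, Convex ℝ (A j)) (h : Cv A) :
    Tendsto (fun j => (Gn n).real (A j)) atTop (𝓝 ((Gn n).real (Lo A))) := by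
  have := cv_ind hA hAc h (f := fun _ => 1) (integrable_const _)
  simpa using this

lemma meas_le_lim {C : ℕ → Set (Eu n)} {O : Set (Eu n)} {v : ℝ}
    (h : ∀ x ∈ O, ∀ᶠ j in atTop, x ∈ C j) (hv : Tendsto (fun j => (Gn n).real (C j)) atTop (𝓝 v)) :
    (Gn n).real O ≤ v := by
  set U : ℕ → Set (Eu n) := fun N => ⋂ k ≥ N, C k with hU
  have hmono : Monotone U := by
    intro a b hab
    exact biInter_mono (fun k hk => le_trans hab hk) fun k hk => Subset.rfl
  have hsub : O ⊆ ⋃ N, U N := by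
    intro s hs
    obtain ⟨N, hN⟩ := eventually_atTop.1 (h s hs)
    simp only [hU, mem_iUnion, mem_iInter]
    exact ⟨N, fun k hk => hN k hk⟩
  have h1 := tendsto_measure_iUnion_atTop (μ := Gn n) hmono
  have h2 : Tendsto (fun N => (Gn n).real (U N)) atTop (𝓝 ((Gn n).real (⋃ N, U N))) :=
    (ENNReal.tendsto_toReal (measure_ne_top _ _)).comp h1
  have h3 : ∀ N, (Gn n).real (U N) ≤ (Gn n).real (C N) :=
    fun N => measureReal_mono (biInter_subset_of_mem (le_refl N))
  exact (measureReal_mono hsub).trans (le_of_tendsto_of_tendsto' h2 hv h3)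

/-- closed Minkowski combination -/
def Cb (t : ℝ) (A B : Set (Eu n)) : Set (Eu n) := closure ((1 - t) • A + t • B)

lemma Cb_closed (t : ℝ) (A B : Set (Eu n)) : IsClosed (Cb t A B) := isClosed_closure

lemma Cb_convex (t : ℝ) {A B : Set (Eu n)} (hA : Convex ℝ A) (hB : Convex ℝ B) : Convex ℝ (Cb t A B) :=
  ((hA.smul _).add (hB.smul _)).closure

lemma Cb_mem {t : ℝ} {A B : Set (Eu n)} {x y : Eu n} (hx : x ∈ A) (hy : y ∈ B) :
    (1 - t) • x + t • y ∈ Cb t A B :=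
  subset_closure (add_mem_add (smul_mem_smul_set hx) (smul_mem_smul_set hy))

lemma Cb_sub {t : ℝ} {A B M : Set (Eu n)} (hM : IsClosed M)
    (h : ∀ x ∈ A, ∀ y ∈ B, (1 - t) • x + t • y ∈ M) : Cb t A B ⊆ M := by
  refine closure_minimal ?_ hM
  rintro _ ⟨_, ⟨x, hx, rfl⟩, _, ⟨y, hy, rfl⟩, rfl⟩
  exact h x hx y hy

lemma Cb_lsc {t : ℝ} {A B : ℕ → Set (Eu n)} (hA : ∀ j, IsClosed (A j)) (hAc : ∀ j, Convex ℝ (A j))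
    (hB : ∀ j, IsClosed (B j)) (hBc : ∀ j, Convex ℝ (B j))
    (hAp : Gn n (Lo A) ≠ 0) (hBp : Gn n (Lo B) ≠ 0) {v : ℝ}
    (hv : Tendsto (fun j => (Gn n).real (Cb t (A j) (B j))) atTop (𝓝 v)) :
    (Gn n).real (Cb t (Lo A) (Lo B)) ≤ v := by
  set O := (1 - t) • interior (Lo A) + t • interior (Lo B) with hO
  have hLA := Lo_convex hAc
  have hLB := Lo_convex hBc
  have hOc : Convex ℝ O := (hLA.interior.smul _).add (hLB.interior.smul _)
  have hOv : (Gn n).real O ≤ v := by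
    refine meas_le_lim ?_ hv
    rintro _ ⟨_, ⟨x, hx, rfl⟩, _, ⟨y, hy, rfl⟩, rfl⟩
    filter_upwards [int_Lo hA hAc hx, int_Lo hB hBc hy] with j h1 h2
    exact Cb_mem h1 h2
  have hsub : Cb t (Lo A) (Lo B) ⊆ closure O := by
    refine Cb_sub isClosed_closure fun x hx y hy => ?_
    rw [← closure_int (Lo_closed A) hLA (int_nonempty (Lo_closed A) hLA hAp)] at hx
    rw [← closure_int (Lo_closed B) hLB (int_nonempty (Lo_closed B) hLB hBp)] at hy
    have hc : Continuous fun z : Eu n × Eu n => (1 - t) • z.1 + t • z.2 := by fun_prop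
    refine map_mem_closure hc (s := interior (Lo A) ×ˢ interior (Lo B)) (x := (x, y)) ?_ ?_
    · rw [closure_prod_eq]; exact ⟨hx, hy⟩
    · rintro ⟨a, b⟩ ⟨ha, hb⟩
      exact add_mem_add (smul_mem_smul_set ha) (smul_mem_smul_set hb)
  have hcl : (Gn n).real (closure O) ≤ (Gn n).real O := by
    have h1 : closure O ⊆ O ∪ frontier O := by
      rw [closure_eq_self_union_frontier]
    refine (measureReal_mono h1).trans ((measureReal_union_le _ _).trans ?_)
    have : (Gn n).real (frontier O) = 0 := (measureReal_eq_zero_iff).2 (frontier_null hOc)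
    linarith
  exact (measureReal_mono hsub).trans (hcl.trans hOv)
end cpt


section mainineq
variable {n : ℕ}

/-- admissible pairs -/
def Adm (a b : ℝ) (A B : Set (Eu n)) : Prop :=
  IsClosed A ∧ Convex ℝ A ∧ (Gn n).real A = Phi a ∧ IsClosed B ∧ Convex ℝ B ∧ (Gn n).real B = Phi b

/-- the penalized functional -/
def Fn (t ε : ℝ) (θ : Eu n) (A B : Set (Eu n)) : ℝ :=
  (Gn n).real (Cb t A B) - ε * (Jf θ A + Jf θ B)

lemma ne_zero_of_real {A : Set (Eu n)} {a : ℝ} (h : (Gn n).real A = Phi a) : Gn n A ≠ 0 := by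
  intro h0
  have := Phi_pos a
  rw [← h, measureReal_def, h0] at this
  simp at this

lemma Sy_real {e : Eu n} (he : ‖e‖ = 1) {A : Set (Eu n)} (hA : IsClosed A) :
    (Gn n).real (Sy e A) = (Gn n).real A := by
  rw [measureReal_def, measureReal_def, Sy_measure he hA]

lemma exists_min {t ε a b : ℝ} (hε : 0 < ε) (θ : Eu n) {A₀ B₀ : Set (Eu n)} (h₀ : Adm a b A₀ B₀) :
    ∃ A B : Set (Eu n), Adm a b A B ∧ ∀ A' B', Adm a b A' B' → Fn t ε θ A B ≤ Fn t ε θ A' B' := by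
  set V : Set ℝ := {v | ∃ A B : Set (Eu n), Adm a b A B ∧ Fn t ε θ A B = v} with hV
  have hne : V.Nonempty := ⟨_, A₀, B₀, h₀, rfl⟩
  have hbdd : BddBelow V := by
    refine ⟨-(ε * 2), ?_⟩
    rintro _ ⟨A, B, -, rfl⟩
    have h1 : 0 ≤ (Gn n).real (Cb t A B) := measureReal_nonneg
    have h2 := Jf_le_one θ A
    have h3 := Jf_le_one θ B
    have := mul_le_mul_of_nonneg_left (by linarith : Jf θ A + Jf θ B ≤ 2) hε.le
    unfold Fn
    linarith
  obtain ⟨u, -, hu, huV⟩ := exists_seq_tendsto_sInf hne hbdd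
  choose A B hAB hF using huV
  obtain ⟨φ, hφ, hcA⟩ := exists_cv A
  obtain ⟨ψ, hψ, hcB⟩ := exists_cv (fun j => B (φ j))
  set A' : ℕ → Set (Eu n) := fun j => A (φ (ψ j)) with hA'
  set B' : ℕ → Set (Eu n) := fun j => B (φ (ψ j)) with hB'
  have hcA' : Cv A' := hcA ψ hψ
  have hcB' : Cv B' := hcB id strictMono_id
  have a1 : ∀ j, IsClosed (A' j) := fun j => (hAB _).1
  have a2 : ∀ j, Convex ℝ (A' j) := fun j => (hAB _).2.1
  have a3 : ∀ j, (Gn n).real (A' j) = Phi a := fun j => (hAB _).2.2.1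
  have b1 : ∀ j, IsClosed (B' j) := fun j => (hAB _).2.2.2.1
  have b2 : ∀ j, Convex ℝ (B' j) := fun j => (hAB _).2.2.2.2.1
  have b3 : ∀ j, (Gn n).real (B' j) = Phi b := fun j => (hAB _).2.2.2.2.2
  have mA : (Gn n).real (Lo A') = Phi a :=
    tendsto_nhds_unique (cv_meas a1 a2 hcA') (by simp only [a3]; exact tendsto_const_nhds)
  have mB : (Gn n).real (Lo B') = Phi b :=
    tendsto_nhds_unique (cv_meas b1 b2 hcB') (by simp only [b3]; exact tendsto_const_nhds)
  have jA : Tendsto (fun j => Jf θ (A' j)) atTop (𝓝 (Jf θ (Lo A'))) := cv_ind a1 a2 hcA' (intgPhi θ)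
  have jB : Tendsto (fun j => Jf θ (B' j)) atTop (𝓝 (Jf θ (Lo B'))) := cv_ind b1 b2 hcB' (intgPhi θ)
  have hu' : Tendsto (fun j => Fn t ε θ (A' j) (B' j)) atTop (𝓝 (sInf V)) := by
    have := hu.comp (hφ.comp hψ).tendsto_atTop
    refine this.congr fun j => ?_
    exact (hF _).symm
  have hm : Tendsto (fun j => (Gn n).real (Cb t (A' j) (B' j))) atTop
      (𝓝 (sInf V + ε * (Jf θ (Lo A') + Jf θ (Lo B')))) := by
    refine (hu'.add ((jA.add jB).const_mul ε)).congr fun j => ?_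
    unfold Fn
    ring
  have hl := Cb_lsc a1 a2 b1 b2 (ne_zero_of_real mA) (ne_zero_of_real mB) hm
  refine ⟨Lo A', Lo B', ⟨Lo_closed _, Lo_convex a2, mA, Lo_closed _, Lo_convex b2, mB⟩, ?_⟩
  intro A1 B1 h1
  have : sInf V ≤ Fn t ε θ A1 B1 := csInf_le hbdd ⟨A1, B1, h1, rfl⟩
  refine le_trans ?_ this
  unfold Fn
  linarith

lemma half_of_inv {θ : Eu n} (hθ : ‖θ‖ = 1) {A : Set (Eu n)} (hA : IsClosed A) (hne : A.Nonempty)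
    (huniv : A ≠ univ) (h : ∀ e : Eu n, ‖e‖ = 1 → 0 < ⟪e, θ⟫ → Sy e A = A) :
    ∃ c, A = {x | c ≤ ⟪x, θ⟫} := by
  have hθθ : ⟪θ, θ⟫ = 1 := by rw [real_inner_self_eq_norm_sq, hθ]; norm_num
  have hup : ∀ x ∈ A, ∀ y, ⟪x, θ⟫ < ⟪y, θ⟫ → y ∈ A := by
    intro x hx y hxy
    have hne : y - x ≠ 0 := by
      intro h0
      rw [sub_eq_zero] at h0
      rw [h0] at hxy
      exact lt_irrefl _ hxy
    have hn : 0 < ‖y - x‖ := norm_pos_iff.2 hne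
    set e := ‖y - x‖⁻¹ • (y - x) with he
    have he1 : ‖e‖ = 1 := by rw [he, norm_smul, norm_inv, norm_norm, inv_mul_cancel₀ hn.ne']
    have heθ : 0 < ⟪e, θ⟫ := by
      rw [he, inner_smul_left, inner_sub_left]
      simp only [conj_trivial]
      exact mul_pos (inv_pos.2 hn) (by linarith)
    have hS := h e he1 heθ
    have hx' : x ∈ Sy e A := by rw [hS]; exact hx
    have := Sy_up he1 hx' hn.le
    rw [hS, he, smul_smul, mul_inv_cancel₀ hn.ne', one_smul, add_sub_cancel] at this
    exact this
  set H : Set ℝ := (fun x => ⟪x, θ⟫) '' A with hH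
  have hHne : H.Nonempty := hne.image _
  have hHb : BddBelow H := by
    by_contra hb
    apply huniv
    rw [eq_univ_iff_forall]
    intro y
    rw [not_bddBelow_iff] at hb
    obtain ⟨_, ⟨x, hx, rfl⟩, hxy⟩ := hb ⟪y, θ⟫
    exact hup x hx y hxy
  refine ⟨sInf H, Subset.antisymm (fun x hx => csInf_le hHb ⟨x, hx, rfl⟩) fun y hy => ?_⟩
  have hev : ∀ s : ℝ, 0 < s → y + s • θ ∈ A := by
    intro s hs
    obtain ⟨_, ⟨x, hx, rfl⟩, hxy⟩ := exists_lt_of_csInf_lt hHne (lt_add_of_pos_right (sInf H) hs)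
    refine hup x hx _ ?_
    rw [inner_add_left, inner_smul_left, hθθ]
    simp only [mem_ofPred_eq] at hy
    simp only [conj_trivial, mul_one]
    simp only at hxy
    linarith
  have hlim : Tendsto (fun s : ℝ => y + s • θ) (𝓝[>] 0) (𝓝 y) := by
    have hc : Continuous fun s : ℝ => y + s • θ := by fun_prop
    have := hc.tendsto 0
    simp only [zero_smul, add_zero] at this
    exact this.mono_left nhdsWithin_le_nhds
  exact hA.mem_of_tendsto hlim (by filter_upwards [self_mem_nhdsWithin] with s hs using hev s hs)

lemma half_real {θ : Eu n} (hθ : ‖θ‖ = 1) (c : ℝ) : (Gn n).real {x | c ≤ ⟪x, θ⟫} = Phi (-c) := by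
  have hm : MeasurableSet {x : Eu n | c ≤ ⟪x, θ⟫} :=
    (isClosed_le continuous_const (by fun_prop)).measurableSet
  have hf : ∀ x, fb θ {x : Eu n | c ≤ ⟪x, θ⟫} x = Ici c := by
    intro x; ext s
    rw [mem_fb, mem_ofPred_eq, inner_mv hθ]; rfl
  rw [measureReal_def, Gn_apply_fib hθ hm]
  simp only [hf, lintegral_const, measure_univ, mul_one]
  rw [← g1_real_Ici]; rfl

lemma exists_unit (hn : 1 ≤ n) : ∃ θ : Eu n, ‖θ‖ = 1 :=
  ⟨EuclideanSpace.single ⟨0, hn⟩ 1, by simp⟩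

theorem ehrhard_closed (hn : 1 ≤ n) {t : ℝ} (ht0 : 0 < t) (ht1 : t < 1) {a b : ℝ} {A₀ B₀ : Set (Eu n)}
    (h₀ : Adm a b A₀ B₀) : Phi ((1 - t) * a + t * b) ≤ (Gn n).real (Cb t A₀ B₀) := by
  obtain ⟨θ, hθ⟩ := exists_unit hn
  have hθθ : ⟪θ, θ⟫ = 1 := by rw [real_inner_self_eq_norm_sq, hθ]; norm_num
  refine le_of_forall_pos_le_add fun δ hδ => ?_
  set ε := δ / 2 with hεd
  have hε : 0 < ε := by positivity
  obtain ⟨A, B, hAB, hmin⟩ := exists_min (t := t) hε θ h₀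
  have h1 := hmin _ _ h₀
  obtain ⟨hA, hAc, mA, hB, hBc, mB⟩ := hAB
  have hinv : ∀ e : Eu n, ‖e‖ = 1 → 0 < ⟪e, θ⟫ → Sy e A = A ∧ Sy e B = B := by
    intro e he heθ
    have hSA := Sy_closed (e := e) hA
    have hSB := Sy_closed (e := e) hB
    have hSAc : Convex ℝ (Sy e A) := Sy_convex hA hAc
    have hSBc : Convex ℝ (Sy e B) := Sy_convex hB hBc
    have h2 := hmin (Sy e A) (Sy e B) ⟨hSA, hSAc, by rw [Sy_real he hA, mA], hSB, hSBc, by rw [Sy_real he hB, mB]⟩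
    have hsub : Cb t (Sy e A) (Sy e B) ⊆ Sy e (Cb t A B) := by
      refine Cb_sub (Sy_closed (Cb_closed _ _ _)) ?_
      exact fun x hx y hy => Sy_combo hA hAc hB hBc (Cb_convex t hAc hBc) ht0 ht1 (fun x hx y hy => Cb_mem hx hy) hx hy
    have h3 : (Gn n).real (Cb t (Sy e A) (Sy e B)) ≤ (Gn n).real (Cb t A B) := by
      rw [← Sy_real he (Cb_closed t A B)]; exact measureReal_mono hsub
    obtain ⟨jA, jA'⟩ := Jf_Sy he heθ hA
    obtain ⟨jB, jB'⟩ := Jf_Sy he heθ hB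
    unfold Fn at h2
    have h4 : Jf θ (Sy e A) + Jf θ (Sy e B) ≤ Jf θ A + Jf θ B :=
      le_of_mul_le_mul_left (by linarith) hε
    constructor
    · exact eq_of_ae hA hAc hSA hSAc (by rw [Sy_measure he hA]; exact ne_zero_of_real mA) (jA' (by linarith))
    · exact eq_of_ae hB hBc hSB hSBc (by rw [Sy_measure he hB]; exact ne_zero_of_real mB) (jB' (by linarith))
  have hnu : ∀ {S : Set (Eu n)} {p : ℝ}, (Gn n).real S = Phi p → S ≠ univ := by
    intro S p hS h
    have := Phi_lt_one p
    rw [← hS, h] at this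
    simp at this
  obtain ⟨c, hc⟩ := half_of_inv hθ hA (nonempty_of_measure_ne_zero (ne_zero_of_real mA)) (hnu mA)
    (fun e h h' => (hinv e h h').1)
  obtain ⟨d, hd⟩ := half_of_inv hθ hB (nonempty_of_measure_ne_zero (ne_zero_of_real mB)) (hnu mB)
    (fun e h h' => (hinv e h h').2)
  have hca : -c = a := by
    rw [hc, half_real hθ] at mA; exact Phi_strictMono.injective mA
  have hdb : -d = b := by
    rw [hd, half_real hθ] at mB; exact Phi_strictMono.injective mB
  have hsup : {x : Eu n | (1 - t) * c + t * d ≤ ⟪x, θ⟫} ⊆ Cb t A B := by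
    intro x hx
    have hx' : (1 - t) * c + t * d ≤ ⟪x, θ⟫ := hx
    set y := x - (t * (d - c)) • θ with hy
    set z := x + ((1 - t) * (d - c)) • θ with hz
    have e : (1 - t) • y + t • z = x := by rw [hy, hz]; module
    rw [← e]
    refine Cb_mem ?_ ?_
    · rw [hc, mem_ofPred_eq, hy, inner_sub_left, inner_smul_left, hθθ]
      simp only [conj_trivial]; linarith
    · rw [hd, mem_ofPred_eq, hz, inner_add_left, inner_smul_left, hθθ]
      simp only [conj_trivial]; linarith
  have h5 : Phi ((1 - t) * a + t * b) ≤ (Gn n).real (Cb t A B) := by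
    have := measureReal_mono (μ := Gn n) hsup
    rw [half_real hθ, ← neg_neg ((1 - t) * a + t * b)] at *
    convert this using 2
    rw [← hca, ← hdb]; ring
  have j1 := Jf_nonneg θ A₀
  have j2 := Jf_nonneg θ B₀
  have j3 := Jf_le_one θ A
  have j4 := Jf_le_one θ B
  have h6 := mul_nonneg hε.le (add_nonneg j1 j2)
  have h7 := mul_le_mul_of_nonneg_left (by linarith : Jf θ A + Jf θ B ≤ 2) hε.le
  unfold Fn at h1
  linarith
end mainineq


section eqcase
variable {n : ℕ}

lemma abs_inner_unit {e : Eu n} (he : ‖e‖ = 1) (x : Eu n) : |⟪x, e⟫| ≤ ‖x‖ := by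
  have := abs_real_inner_le_norm x e
  rwa [he, mul_one] at this

lemma fb_sub_Icc {e : Eu n} (he : ‖e‖ = 1) {K : Set (Eu n)} {R : ℝ} (hR : ∀ x ∈ K, ‖x‖ ≤ R) (x : Eu n) :
    fb e K x ⊆ Icc (-R) R := by
  intro s hs
  have h1 := abs_inner_unit he (mv e x s)
  rw [inner_mv he] at h1
  exact abs_le.1 (h1.trans (hR _ hs))

lemma fb_compact {e : Eu n} (he : ‖e‖ = 1) {K : Set (Eu n)} (hK : IsCompact K) (x : Eu n) :
    IsCompact (fb e K x) := by
  obtain ⟨R, hR⟩ := hK.isBounded.exists_norm_le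
  exact isCompact_Icc.of_isClosed_subset (fb_closed hK.isClosed x) (fb_sub_Icc he hR x)

lemma Sy_low {e : Eu n} (he : ‖e‖ = 1) {K : Set (Eu n)} {R : ℝ} (hR : ∀ x ∈ K, ‖x‖ ≤ R) {u : Eu n}
    (hu : u ∈ Sy e K) : -R ≤ ⟪u, e⟫ ∧ ‖u‖ ≤ 2 * R + |⟪u, e⟫| := by
  have h0 : fb e K u ⊆ Iic R := (fb_sub_Icc he hR u).trans Icc_subset_Iic_self
  have h1 : Phi (-⟪u, e⟫) ≤ Phi R := by
    rw [Phi_eq R]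
    exact (mem_Sy.1 hu).trans (measureReal_mono h0)
  have h2 := Phi_strictMono.le_iff_le.1 h1
  refine ⟨by linarith, ?_⟩
  have h3 : (fb e K u).Nonempty := by
    apply nonempty_of_measureReal_ne_zero (μ := g1)
    exact ((Phi_pos _).trans_le (mem_Sy.1 hu)).ne'
  obtain ⟨s, hs⟩ := h3
  have hsR := fb_sub_Icc he hR u hs
  have hw := hR _ hs
  have e1 : u = mv e u s + (⟪u, e⟫ - s) • e := by
    rw [mv]; module
  calc ‖u‖ = ‖mv e u s + (⟪u, e⟫ - s) • e‖ := by rw [← e1]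
    _ ≤ ‖mv e u s‖ + ‖(⟪u, e⟫ - s) • e‖ := norm_add_le _ _
    _ ≤ R + (|⟪u, e⟫| + R) := by
      rw [norm_smul, he, mul_one, Real.norm_eq_abs]
      have : |⟪u, e⟫ - s| ≤ |⟪u, e⟫| + |s| := abs_sub _ _
      have : |s| ≤ R := abs_le.2 hsR
      linarith
    _ = _ := by ring

lemma eq_key (hn : 1 ≤ n) {t : ℝ} (ht0 : 0 < t) (ht1 : t < 1) {a b : ℝ} {K L M : Set (Eu n)}
    (hK : IsCompact K) (hL : IsCompact L) (hAdm : Adm a b K L)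
    (hM : M = (1 - t) • K + t • L) (hMk : IsCompact M) (hMc : Convex ℝ M)
    (hle : (Gn n).real M ≤ Phi ((1 - t) * a + t * b))
    {e : Eu n} (he : ‖e‖ = 1) {x : Eu n} (hx : x ∈ M) (hpos : 0 < g1.real (fb e M x)) :
    ∃ k ∈ K, ∃ l ∈ L, (1 - t) • k + t • l = x ∧ ⟪k, e⟫ = ⟪l, e⟫ := by
  obtain ⟨hKc, hKv, mK, hLc, hLv, mL⟩ := hAdm
  have hcomb : ∀ u ∈ K, ∀ v ∈ L, (1 - t) • u + t • v ∈ M := by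
    intro u hu v hv
    rw [hM]
    exact add_mem_add (smul_mem_smul_set hu) (smul_mem_smul_set hv)
  have ht1' : 0 < 1 - t := by linarith
  -- the symmetrized combination is everything
  have hAdm' : Adm a b (Sy e K) (Sy e L) := ⟨Sy_closed hKc, Sy_convex hKc hKv, by rw [Sy_real he hKc, mK],
    Sy_closed hLc, Sy_convex hLc hLv, by rw [Sy_real he hLc, mL]⟩
  have hW := ehrhard_closed hn ht0 ht1 hAdm'
  have hWsub : Cb t (Sy e K) (Sy e L) ⊆ Sy e M := Cb_sub (Sy_closed hMk.isClosed) fun u hu v hv =>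
    Sy_combo hKc hKv hLc hLv hMc ht0 ht1 hcomb hu hv
  have hWle : (Gn n).real (Sy e M) ≤ (Gn n).real (Cb t (Sy e K) (Sy e L)) := by
    rw [Sy_real he hMk.isClosed]; linarith
  have hSne : Gn n (Sy e M) ≠ 0 := by
    intro h0
    have h1 : (Gn n).real (Sy e M) = 0 := (measureReal_eq_zero_iff).2 h0
    have h2 := measureReal_mono (μ := Gn n) hWsub
    have := Phi_pos ((1 - t) * a + t * b)
    linarith
  have hSW := sub_of_le (Cb_closed _ _ _) (Sy_closed hMk.isClosed) (Sy_convex hMk.isClosed hMc) hSne hWsub hWle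
  -- the fiber over x
  have hlt : g1.real (fb e M x) < 1 := by
    obtain ⟨R, hR⟩ := hMk.isBounded.exists_norm_le
    have h1 := measureReal_mono (μ := g1) ((fb_sub_Icc he hR x).trans Icc_subset_Iic_self)
    rw [← Phi_eq] at h1
    exact h1.trans_lt (Phi_lt_one R)
  obtain ⟨p, hp⟩ := Phi_surj hpos hlt
  set z := mv e x (-p) with hz
  have hze : ⟪z, e⟫ = -p := inner_mv he _ _
  have hfz : fb e M z = fb e M x := fb_mv he _ _ _
  have hzS : z ∈ Sy e M := by
    rw [mem_Sy, hze, hfz, ← hp, neg_neg]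
  rw [hSW, Cb, mem_closure_iff_seq_limit] at hzS
  obtain ⟨zk, hzk, hzlim⟩ := hzS
  have hdec : ∀ k, ∃ u ∈ Sy e K, ∃ v ∈ Sy e L, (1 - t) • u + t • v = zk k := by
    intro k
    obtain ⟨_, ⟨u, hu, rfl⟩, _, ⟨v, hv, rfl⟩, h⟩ := hzk k
    exact ⟨u, hu, v, hv, h⟩
  choose u hu v hv huv using hdec
  obtain ⟨R, hR⟩ := hK.isBounded.exists_norm_le
  obtain ⟨R', hR'⟩ := hL.isBounded.exists_norm_le
  have hzb : ∃ C, ∀ k, ⟪zk k, e⟫ ≤ C := by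
    have h1 : Tendsto (fun k => ⟪zk k, e⟫) atTop (𝓝 ⟪z, e⟫) := by
      have hc : Continuous fun y : Eu n => ⟪y, e⟫ := by fun_prop
      exact (hc.tendsto z).comp hzlim
    obtain ⟨C, hC⟩ := h1.bddAbove_range
    exact ⟨C, fun k => hC ⟨k, rfl⟩⟩
  obtain ⟨C, hC⟩ := hzb
  have hub : ∀ k, u k ∈ closedBall (0 : Eu n) (2 * R + (R + |(C + t * R') / (1 - t)|)) := by
    intro k
    obtain ⟨h1, h2⟩ := Sy_low he hR (hu k)
    obtain ⟨h3, -⟩ := Sy_low he hR' (hv k)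
    have h4 := hC k
    rw [← huv k, inner_add_left, inner_smul_left, inner_smul_left] at h4
    simp only [conj_trivial] at h4
    have h5 : ⟪u k, e⟫ ≤ (C + t * R') / (1 - t) := by
      rw [le_div_iff₀ ht1']
      nlinarith
    have h6 : |⟪u k, e⟫| ≤ R + |(C + t * R') / (1 - t)| := by
      have hR0 : 0 ≤ R := by
        obtain ⟨y, hy⟩ := nonempty_of_measure_ne_zero (ne_zero_of_real mK)
        exact (norm_nonneg y).trans (hR y hy)
      have h7 := le_abs_self ((C + t * R') / (1 - t))
      have h8 := abs_nonneg ((C + t * R') / (1 - t))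
      rw [abs_le]
      constructor <;> linarith
    rw [mem_closedBall_zero_iff]
    linarith
  obtain ⟨u₀, -, φ, hφ, hulim⟩ := (isCompact_closedBall (0 : Eu n) _).tendsto_subseq hub
  set v₀ := t⁻¹ • (z - (1 - t) • u₀) with hv₀
  have hvlim : Tendsto (fun k => v (φ k)) atTop (𝓝 v₀) := by
    have h1 : Tendsto (fun k => t⁻¹ • (zk (φ k) - (1 - t) • u (φ k))) atTop (𝓝 v₀) :=
      ((hzlim.comp hφ.tendsto_atTop).sub (hulim.const_smul (1 - t))).const_smul t⁻¹
    refine h1.congr fun k => ?_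
    rw [← huv, add_sub_cancel_left, smul_smul, inv_mul_cancel₀ ht0.ne', one_smul]
  have hu₀ : u₀ ∈ Sy e K := (Sy_closed hKc).mem_of_tendsto hulim (Eventually.of_forall fun k => hu _)
  have hv₀m : v₀ ∈ Sy e L := (Sy_closed hLc).mem_of_tendsto hvlim (Eventually.of_forall fun k => hv _)
  have hz₀ : (1 - t) • u₀ + t • v₀ = z := by
    rw [hv₀, smul_smul, mul_inv_cancel₀ ht0.ne', one_smul, add_sub_cancel]
  have hpq : (1 - t) * -⟪u₀, e⟫ + t * -⟪v₀, e⟫ = p := by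
    have h1 := hze
    rw [← hz₀, inner_add_left, inner_smul_left, inner_smul_left] at h1
    simp only [conj_trivial] at h1
    linarith
  obtain ⟨hI, hJ⟩ := ehrhard1_eq (fb_compact he hK u₀) (fb_convex hKv u₀) (fb_compact he hL v₀) (fb_convex hLv v₀)
    (fb_compact he hMk x) (fb_convex hMc x) ht0 ht1 (fun s hs r hr => by
      rw [← hfz, mem_fb, ← hz₀, ← mv_combo]
      exact hcomb _ hs _ hr) (mem_Sy.1 hu₀) (mem_Sy.1 hv₀m) (by rw [hpq, hp])
  have hs0 : ⟪x, e⟫ ∈ fb e M x := by rw [mem_fb, mv_self]; exact hx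
  refine ⟨mv e u₀ ⟪x, e⟫, ?_, mv e v₀ ⟪x, e⟫, ?_, ?_, ?_⟩
  · rw [← mem_fb, hI]; exact hs0
  · rw [← mem_fb, hJ]; exact hs0
  · rw [mv_combo, hz₀, hz, mv_mv he]
    have : (1 - t) * ⟪x, e⟫ + t * ⟪x, e⟫ = ⟪x, e⟫ := by ring
    rw [this, mv_self]
  · rw [inner_mv he, inner_mv he]

lemma fb_pos {e : Eu n} {M : Set (Eu n)} {x : Eu n} {s : ℝ} (hs : mv e x s ∈ interior M) :
    0 < g1.real (fb e M x) := by
  have ho : IsOpen (fb e (interior M) x) := isOpen_interior.preimage (mv_cont_right e x)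
  have hinst : (g1).IsOpenPosMeasure := (gaussianReal_absolutelyContinuous' 0 one_ne_zero).isOpenPosMeasure
  have h1 : 0 < g1 (fb e (interior M) x) := ho.measure_pos g1 ⟨s, hs⟩
  have h2 : g1 (fb e (interior M) x) ≤ g1 (fb e M x) := by
    refine measure_mono fun r hr => ?_
    exact (interior_subset (s := M) hr : mv e x r ∈ M)
  exact ENNReal.toReal_pos (h1.trans_le h2).ne' (measure_ne_top _ _)

lemma ext_mem (hn : 1 ≤ n) {t : ℝ} (ht0 : 0 < t) (ht1 : t < 1) {a b : ℝ} {K L M : Set (Eu n)}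
    (hK : IsCompact K) (hL : IsCompact L) (hAdm : Adm a b K L)
    (hM : M = (1 - t) • K + t • L) (hMk : IsCompact M) (hMc : Convex ℝ M) (hMi : (interior M).Nonempty)
    (hle : (Gn n).real M ≤ Phi ((1 - t) * a + t * b)) {x : Eu n} (hx : x ∈ M.extremePoints ℝ) :
    x ∈ K ∩ L := by
  rw [mem_extremePoints] at hx
  obtain ⟨hxM, hext⟩ := hx
  have hcomb : ∀ u ∈ K, ∀ v ∈ L, (1 - t) • u + t • v ∈ M := by
    intro u hu v hv
    rw [hM]
    exact add_mem_add (smul_mem_smul_set hu) (smul_mem_smul_set hv)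
  have hdec : ∃ k ∈ K, ∃ l ∈ L, (1 - t) • k + t • l = x := by
    have := hxM
    rw [hM] at this
    obtain ⟨_, ⟨u, hu, rfl⟩, _, ⟨v, hv, rfl⟩, h⟩ := this
    exact ⟨u, hu, v, hv, h⟩
  obtain ⟨k, hk, l, hl, hkl⟩ := hdec
  have ht1' : 0 < 1 - t := by linarith
  have horth : ∀ c ∈ interior M, ⟪k - l, c - x⟫ = 0 := by
    intro c hc
    by_cases hcx : c - x = 0
    · rw [hcx, inner_zero_right]
    have hnp : 0 < ‖c - x‖ := norm_pos_iff.2 hcx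
    set e := ‖c - x‖⁻¹ • (c - x) with he
    have he1 : ‖e‖ = 1 := by rw [he, norm_smul, norm_inv, norm_norm, inv_mul_cancel₀ hnp.ne']
    have hce : c - x = ‖c - x‖ • e := by rw [he, smul_smul, mul_inv_cancel₀ hnp.ne', one_smul]
    have hmv : mv e x (⟪x, e⟫ + ‖c - x‖) = c := by
      rw [mv, add_sub_cancel_left, ← hce, add_sub_cancel]
    obtain ⟨k', hk', l', hl', hkl', heq⟩ := eq_key hn ht0 ht1 hK hL hAdm hM hMk hMc hle he1 hxM
      (fb_pos (by rw [hmv]; exact hc))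
    obtain ⟨h1, h2⟩ := hext _ (hcomb k hk l' hl') _ (hcomb k' hk' l hl)
      ⟨1 / 2, 1 / 2, by norm_num, by norm_num, by norm_num, by
        have : (1 / 2 : ℝ) • ((1 - t) • k + t • l') + (1 / 2 : ℝ) • ((1 - t) • k' + t • l) =
          (1 / 2 : ℝ) • ((1 - t) • k + t • l) + (1 / 2 : ℝ) • ((1 - t) • k' + t • l') := by module
        rw [this, hkl, hkl']; module⟩
    have hl2 : l' = l := by
      have : t • l' = t • l := by
        have := h1.trans hkl.symm
        exact add_left_cancel this
      exact smul_right_injective _ ht0.ne' this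
    have hk2 : k' = k := by
      have : (1 - t) • k' = (1 - t) • k := by
        have := h2.trans hkl.symm
        exact add_right_cancel this
      exact smul_right_injective _ ht1'.ne' this
    rw [hl2, hk2] at heq
    rw [hce, inner_smul_right, inner_sub_left, heq, sub_self, mul_zero]
  have hkl0 : k = l := by
    by_contra hne
    have hd : 0 < ‖k - l‖ := norm_pos_iff.2 (sub_ne_zero.2 hne)
    obtain ⟨c, hc⟩ := hMi
    have hlim : Tendsto (fun δ : ℝ => c + δ • (k - l)) (𝓝[>] 0) (𝓝 c) := by
      have hcn : Continuous fun s : ℝ => c + s • (k - l) := by fun_prop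
      have := hcn.tendsto 0
      simp only [zero_smul, add_zero] at this
      exact this.mono_left nhdsWithin_le_nhds
    obtain ⟨δ, hδ1, hδ2⟩ := ((hlim.eventually (isOpen_interior.mem_nhds hc)).and self_mem_nhdsWithin).exists
    have h1 := horth _ hδ1
    have h2 := horth _ hc
    have e1 : c + δ • (k - l) - x = (c - x) + δ • (k - l) := by module
    rw [e1, inner_add_right, h2, inner_smul_right, real_inner_self_eq_norm_sq, zero_add] at h1
    have hδ : (0 : ℝ) < δ := hδ2
    have := mul_pos hδ (pow_pos hd 2)
    linarith
  have hxk : x = k := by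
    rw [← hkl, ← hkl0]; module
  exact ⟨hxk ▸ hk, by rw [hxk, hkl0]; exact hl⟩

lemma body_real (hn : 1 ≤ n) {K : Set (Eu n)} (hK : IsConvexBody K) : ∃ a, (Gn n).real K = Phi a := by
  obtain ⟨hKc, hKk, hKi⟩ := hK
  have h1 : 0 < (Gn n).real K :=
    ENNReal.toReal_pos (Measure.measure_pos_of_nonempty_interior (Gn n) hKi).ne' (measure_ne_top _ _)
  have h2 : (Gn n).real K < 1 := by
    obtain ⟨θ, hθ⟩ := exists_unit hn
    obtain ⟨R, hR⟩ := hKk.isBounded.exists_norm_le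
    have hsub : K ⊆ {x | -R ≤ ⟪x, θ⟫} := by
      intro x hx
      exact (abs_le.1 ((abs_inner_unit hθ x).trans (hR x hx))).1
    have := measureReal_mono (μ := Gn n) hsub
    rw [half_real hθ] at this
    exact this.trans_lt (Phi_lt_one _)
  obtain ⟨a, ha⟩ := Phi_surj h1 h2
  exact ⟨a, ha.symm⟩

theorem ehrhard_main (hn : 1 ≤ n) {K L : Set (Eu n)} (hK : IsConvexBody K) (hL : IsConvexBody L)
    {t : ℝ} (ht0 : 0 < t) (ht1 : t < 1) :
    (1 - t) * PhiInv (gaussVol n K) + t * PhiInv (gaussVol n L) ≤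
      PhiInv (gaussVol n ((1 - t) • K + t • L)) ∧
    (PhiInv (gaussVol n ((1 - t) • K + t • L)) =
        (1 - t) * PhiInv (gaussVol n K) + t * PhiInv (gaussVol n L) ↔ K = L) := by
  have ht1' : 0 < 1 - t := by linarith
  have hMk : IsCompact ((1 - t) • K + t • L) := (hK.2.1.smul _).add (hL.2.1.smul _)
  have hMc : Convex ℝ ((1 - t) • K + t • L) := (hK.1.smul _).add (hL.1.smul _)
  have hMi : (interior ((1 - t) • K + t • L)).Nonempty := by
    obtain ⟨l, hl⟩ := hL.2.2
    obtain ⟨k, hk⟩ := hK.2.2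
    have ho : IsOpen ((1 - t) • interior K + {t • l}) := (isOpen_interior.smul₀ ht1'.ne').add_right
    have hs : (1 - t) • interior K + {t • l} ⊆ (1 - t) • K + t • L :=
      add_subset_add (smul_set_mono interior_subset)
        (singleton_subset_iff.2 (smul_mem_smul_set (interior_subset hl)))
    exact ⟨(1 - t) • k + t • l, interior_maximal hs ho (add_mem_add (smul_mem_smul_set hk) rfl)⟩
  have hMb : IsConvexBody ((1 - t) • K + t • L) := ⟨hMc, hMk, hMi⟩
  obtain ⟨a, ha⟩ := body_real hn hK
  obtain ⟨b, hb⟩ := body_real hn hL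
  obtain ⟨m, hm⟩ := body_real hn hMb
  have hAdm : Adm a b K L := ⟨hK.2.1.isClosed, hK.1, ha, hL.2.1.isClosed, hL.1, hb⟩
  rw [gaussVol_eq hK.2.1.isClosed.measurableSet, gaussVol_eq hL.2.1.isClosed.measurableSet,
    gaussVol_eq hMk.isClosed.measurableSet, ha, hb, hm, PhiInv_Phi, PhiInv_Phi, PhiInv_Phi]
  have hmain : (1 - t) * a + t * b ≤ m := by
    have := ehrhard_closed hn ht0 ht1 hAdm
    rw [Cb, hMk.isClosed.closure_eq, hm] at this
    exact Phi_strictMono.le_iff_le.1 this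
  refine ⟨hmain, fun heq => ?_, fun hKL => ?_⟩
  · have hle : (Gn n).real ((1 - t) • K + t • L) ≤ Phi ((1 - t) * a + t * b) := by rw [hm, heq]
    have hsub : (1 - t) • K + t • L ⊆ K ∩ L := by
      rw [← closure_convexHull_extremePoints hMk hMc]
      refine closure_minimal (convexHull_min ?_ (hK.1.inter hL.1)) (hK.2.1.isClosed.inter hL.2.1.isClosed)
      intro x hx
      exact ext_mem hn ht0 ht1 hK.2.1 hL.2.1 hAdm rfl hMk hMc hMi hle hx
    have hma : m ≤ a := by
      have := measureReal_mono (μ := Gn n) (hsub.trans inter_subset_left)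
      rw [hm, ha] at this
      exact Phi_strictMono.le_iff_le.1 this
    have hmb : m ≤ b := by
      have := measureReal_mono (μ := Gn n) (hsub.trans inter_subset_right)
      rw [hm, hb] at this
      exact Phi_strictMono.le_iff_le.1 this
    have ham : a ≤ m := by nlinarith
    have hbm : b ≤ m := by nlinarith
    have h1 := sub_of_le hMk.isClosed hK.2.1.isClosed hK.1 (ne_zero_of_real ha) (hsub.trans inter_subset_left)
      (by rw [ha, hm]; exact Phi_strictMono.monotone ham)
    have h2 := sub_of_le hMk.isClosed hL.2.1.isClosed hL.1 (ne_zero_of_real hb) (hsub.trans inter_subset_right)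
      (by rw [hb, hm]; exact Phi_strictMono.monotone hbm)
    exact h1.trans h2.symm
  · subst hKL
    have e1 : (1 - t) • K + t • K = K := by
      rw [← hK.1.add_smul ht1'.le ht0.le, sub_add_cancel, one_smul]
    have hab : a = b := Phi_strictMono.injective (ha.symm.trans hb)
    rw [e1] at hm
    have ham : a = m := Phi_strictMono.injective (ha.symm.trans hm)
    rw [← hab, ← ham]; ring
end eqcase

/-- Ehrhard's inequality, with its equality condition. -/
theorem ehrhard_inequality
    (n : ℕ) (hn : 1 ≤ n) (K L : Set (Eu n)) (hK : IsConvexBody K) (hL : IsConvexBody L)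
    (t : ℝ) (ht0 : 0 < t) (ht1 : t < 1) :
    (1 - t) * PhiInv (gaussVol n K) + t * PhiInv (gaussVol n L) ≤
      PhiInv (gaussVol n ((1 - t) • K + t • L)) ∧
    (PhiInv (gaussVol n ((1 - t) • K + t • L)) =
        (1 - t) * PhiInv (gaussVol n K) + t * PhiInv (gaussVol n L) ↔ K = L) := by
  exact ehrhard_main hn hK hL ht0 ht1
end
end

section
/- Let K and L be convex bodies in ℝⁿ and let 0 < t < 1. Then γ_n((1−t)K + tL) ≥ γ_n(K)^{1−t} γ_n(L)^t, where (1−t)K + tL = {(1−t)x + ty : x ∈ K, y ∈ L}, with equality if and only if K = L. -/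
open MeasureTheory Metric Set Filter
open scoped RealInnerProductSpace Topology Pointwise NNReal ENNReal

noncomputable section

lemma glc_bm_compact (s t : ℝ) (hs : 0 < s) (ht : 0 < t) (A B : Set ℝ)
    (hA : IsCompact A) (hB : IsCompact B) (hAn : A.Nonempty) (hBn : B.Nonempty) (C : Set ℝ)
    (hC : ∀ a ∈ A, ∀ b ∈ B, s * a + t * b ∈ C) :
    ENNReal.ofReal s * volume A + ENNReal.ofReal t * volume B ≤ volume C := by
  obtain ⟨a, haA, ha⟩ := hA.exists_isGreatest hAn
  obtain ⟨b, hbB, hb⟩ := hB.exists_isLeast hBn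
  have key : ∀ (r c : ℝ) (D : Set ℝ), 0 < r →
      volume ((fun x => r * x + c) '' D) = ENNReal.ofReal r * volume D := by
    intro r c D hr
    have h1 : (fun x => r * x + c) '' D = (fun x => x + c) '' (r • D) := by
      rw [← image_smul, image_image]; rfl
    rw [h1, image_add_right, measure_preimage_add_right, Measure.addHaar_smul]
    simp [abs_of_pos hr]
  rw [← key s (t * b) A hs, ← key t (s * a) B ht]
  have hm : MeasurableSet ((fun x => t * x + s * a) '' B) :=
    (hB.image (by fun_prop)).measurableSet
  have hd : AEDisjoint volume ((fun x => s * x + t * b) '' A) ((fun x => t * x + s * a) '' B) := by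
    refine measure_mono_null (t := {s * a + t * b}) ?_ (by simp)
    rintro z ⟨⟨x, hx, rfl⟩, ⟨y, hy, hxy⟩⟩
    have h1 := ha hx
    have h2 := hb hy
    simp only at hxy
    simp only [mem_singleton_iff]
    nlinarith
  rw [← measure_union₀ hm.nullMeasurableSet hd]
  apply measure_mono
  rintro z (⟨x, hx, rfl⟩ | ⟨y, hy, rfl⟩)
  · exact hC x hx b hbB
  · simp only; rw [add_comm]; exact hC a haA y hy

lemma glc_bm (s t : ℝ) (hs : 0 < s) (ht : 0 < t) (A B : Set ℝ)
    (hA : MeasurableSet A) (hB : MeasurableSet B) (hAn : A.Nonempty) (hBn : B.Nonempty) (C : Set ℝ)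
    (hC : ∀ a ∈ A, ∀ b ∈ B, s * a + t * b ∈ C) :
    ENNReal.ofReal s * volume A + ENNReal.ofReal t * volume B ≤ volume C := by
  obtain ⟨a, ha⟩ := hAn
  obtain ⟨b, hb⟩ := hBn
  rw [hA.measure_eq_iSup_isCompact, hB.measure_eq_iSup_isCompact]
  simp only [ENNReal.mul_iSup, iSup_and']
  refine ENNReal.biSup_add_biSup_le' (p := fun K => K ⊆ A ∧ IsCompact K)
    (q := fun K => K ⊆ B ∧ IsCompact K)
    ⟨∅, empty_subset _, isCompact_empty⟩ ⟨∅, empty_subset _, isCompact_empty⟩ ?_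
  rintro K ⟨hK, hKc⟩ L ⟨hL, hLc⟩
  refine le_trans ?_ (glc_bm_compact s t hs ht (insert a K) (insert b L) (hKc.insert a) (hLc.insert b)
    ⟨a, by simp⟩ ⟨b, by simp⟩ C ?_)
  · gcongr <;> simp
  · intro x hx y hy
    exact hC x (insert_subset ha hK hx) y (insert_subset hb hL hy)

lemma glc_layer (f : ℝ → ℝ≥0∞) (hf : Measurable f) (hft : ∀ x, f x ≠ ⊤) :
    ∫⁻ x, f x = ∫⁻ r in Ioi (0 : ℝ), volume {x | ENNReal.ofReal r < f x} := by
  have h := lintegral_eq_lintegral_meas_lt (volume : Measure ℝ) (f := fun x => (f x).toReal)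
    (Eventually.of_forall fun x => ENNReal.toReal_nonneg) hf.ennreal_toReal.aemeasurable
  simp only [ENNReal.ofReal_toReal (hft _)] at h
  rw [h]
  refine setLIntegral_congr_fun measurableSet_Ioi ?_
  intro r hr
  simp only [ENNReal.ofReal_lt_iff_lt_toReal (le_of_lt hr) (hft _)]

lemma glc_pl_norm (s t : ℝ) (hs : 0 < s) (ht : 0 < t) (hst : s + t = 1) (f g h : ℝ → ℝ≥0∞)
    (hf : Measurable f) (hg : Measurable g) (hh : Measurable h)
    (hf1 : ∀ x, f x ≤ 1) (hg1 : ∀ x, g x ≤ 1)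
    (hf2 : ∀ r < 1, ∃ x, r < f x) (hg2 : ∀ r < 1, ∃ x, r < g x)
    (H : ∀ x y, f x ^ s * g y ^ t ≤ h (s * x + t * y)) :
    ENNReal.ofReal s * (∫⁻ x, f x) + ENNReal.ofReal t * (∫⁻ x, g x) ≤ ∫⁻ x, h x := by
  have h1 : ∫⁻ x, min (h x) 1 ≤ ∫⁻ x, h x := lintegral_mono fun x => min_le_left _ _
  refine le_trans ?_ h1
  rw [glc_layer f hf (fun x => ne_top_of_le_ne_top ENNReal.one_ne_top (hf1 x)),
    glc_layer g hg (fun x => ne_top_of_le_ne_top ENNReal.one_ne_top (hg1 x)),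
    glc_layer (fun x => min (h x) 1) (hh.min measurable_const)
      (fun x => ne_top_of_le_ne_top ENNReal.one_ne_top (min_le_right _ _)),
    ← lintegral_const_mul' _ _ ENNReal.ofReal_ne_top, ← lintegral_const_mul' _ _ ENNReal.ofReal_ne_top]
  refine (le_lintegral_add _ _).trans ?_
  refine lintegral_mono fun r => ?_
  simp only
  rcases lt_or_ge (ENNReal.ofReal r) 1 with hr | hr
  · refine glc_bm s t hs ht _ _ (measurableSet_lt measurable_const hf)
      (measurableSet_lt measurable_const hg) (hf2 _ hr) (hg2 _ hr) _ ?_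
    intro x hx y hy
    simp only [mem_setOf_eq] at hx hy ⊢
    refine lt_min (lt_of_lt_of_le ?_ (H x y)) hr
    calc ENNReal.ofReal r = ENNReal.ofReal r ^ s * ENNReal.ofReal r ^ t := by
          rw [← ENNReal.rpow_add_of_nonneg _ _ hs.le ht.le, hst, ENNReal.rpow_one]
      _ < _ := ENNReal.mul_lt_mul (ENNReal.rpow_lt_rpow hx hs) (ENNReal.rpow_lt_rpow hy ht)
  · have e1 : {x | ENNReal.ofReal r < f x} = ∅ := by
      ext x; simpa using (hf1 x).trans hr
    have e2 : {x | ENNReal.ofReal r < g x} = ∅ := by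
      ext x; simpa using (hg1 x).trans hr
    rw [e1, e2]; simp

lemma glc_amgm (s t : ℝ) (hs : 0 < s) (ht : 0 < t) (hst : s + t = 1) (a b : ℝ≥0∞) :
    a ^ s * b ^ t ≤ ENNReal.ofReal s * a + ENNReal.ofReal t * b := by
  have hp : (s⁻¹).HolderConjugate t⁻¹ :=
    Real.holderConjugate_iff.2 ⟨by rw [one_lt_inv₀ hs]; linarith, by simpa using hst⟩
  have := ENNReal.young_inequality (a ^ s) (b ^ t) hp
  rw [← ENNReal.rpow_mul, ← ENNReal.rpow_mul, mul_inv_cancel₀ hs.ne', mul_inv_cancel₀ ht.ne',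
    ENNReal.rpow_one, ENNReal.rpow_one, ENNReal.ofReal_inv_of_pos hs, ENNReal.ofReal_inv_of_pos ht,
    div_eq_mul_inv, div_eq_mul_inv, inv_inv, inv_inv] at this
  rwa [mul_comm (ENNReal.ofReal s), mul_comm (ENNReal.ofReal t)]

lemma glc_pl_bdd (s t : ℝ) (hs : 0 < s) (ht : 0 < t) (hst : s + t = 1) (f g h : ℝ → ℝ≥0∞)
    (hf : Measurable f) (hg : Measurable g) (hh : Measurable h)
    (M : ℝ≥0∞) (hM : M ≠ ⊤) (hf1 : ∀ x, f x ≤ M) (hg1 : ∀ x, g x ≤ M)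
    (H : ∀ x y, f x ^ s * g y ^ t ≤ h (s * x + t * y)) :
    (∫⁻ x, f x) ^ s * (∫⁻ x, g x) ^ t ≤ ∫⁻ x, h x := by
  have hAt : (⨆ x, f x) ≠ ⊤ := ne_top_of_le_ne_top hM (iSup_le hf1)
  have hBt : (⨆ x, g x) ≠ ⊤ := ne_top_of_le_ne_top hM (iSup_le hg1)
  have hfA : ∀ x, f x ≤ ⨆ x, f x := fun x => le_iSup f x
  have hgB : ∀ x, g x ≤ ⨆ x, g x := fun x => le_iSup g x
  have hfA' : ∀ r < ⨆ x, f x, ∃ x, r < f x := fun r hr => lt_iSup_iff.1 hr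
  have hgB' : ∀ r < ⨆ x, g x, ∃ x, r < g x := fun r hr => lt_iSup_iff.1 hr
  generalize (⨆ x, f x) = A at *
  generalize (⨆ x, g x) = B at *
  rcases eq_or_ne A 0 with rfl | hA
  · have : ∀ x, f x = 0 := fun x => le_antisymm (hfA x) bot_le
    simp [this, hs]
  rcases eq_or_ne B 0 with rfl | hB
  · have : ∀ x, g x = 0 := fun x => le_antisymm (hgB x) bot_le
    simp [this, ht]
  have hAs : A ^ s ≠ 0 := by simp [hA, hAt]
  have hAs' : A ^ s ≠ ⊤ := ENNReal.rpow_ne_top_of_nonneg hs.le hAt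
  have hBs : B ^ t ≠ 0 := by simp [hB, hBt]
  have hBs' : B ^ t ≠ ⊤ := ENNReal.rpow_ne_top_of_nonneg ht.le hBt
  have h1 := glc_pl_norm s t hs ht hst (fun x => f x / A) (fun x => g x / B)
    (fun x => h x / (A ^ s * B ^ t)) (by fun_prop) (by fun_prop) (by fun_prop)
    (fun x => ENNReal.div_le_of_le_mul (by simpa using hfA x))
    (fun x => ENNReal.div_le_of_le_mul (by simpa using hgB x))
    (fun r hr => by
      obtain ⟨x, hx⟩ := hfA' (r * A) (by
        calc r * A < 1 * A := by rw [ENNReal.mul_lt_mul_iff_left hA hAt]; exact hr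
          _ = A := one_mul A)
      exact ⟨x, (ENNReal.lt_div_iff_mul_lt (Or.inl hA) (Or.inl hAt)).2 hx⟩)
    (fun r hr => by
      obtain ⟨x, hx⟩ := hgB' (r * B) (by
        calc r * B < 1 * B := by rw [ENNReal.mul_lt_mul_iff_left hB hBt]; exact hr
          _ = B := one_mul B)
      exact ⟨x, (ENNReal.lt_div_iff_mul_lt (Or.inl hB) (Or.inl hBt)).2 hx⟩)
    (fun x y => by
      rw [ENNReal.div_rpow_of_nonneg _ _ hs.le, ENNReal.div_rpow_of_nonneg _ _ ht.le,
        ← ENNReal.mul_div_mul_comm (Or.inl hAs) (Or.inl hAs')]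
      exact ENNReal.div_le_div_right (H x y) _)
  have h2 := (glc_amgm s t hs ht hst _ _).trans h1
  simp only [div_eq_mul_inv] at h2
  have hi : (A ^ s * B ^ t) ≠ 0 := mul_ne_zero hAs hBs
  have hi' : (A ^ s * B ^ t) ≠ ⊤ := ENNReal.mul_ne_top hAs' hBs'
  rw [lintegral_mul_const' _ _ (by simpa using hA), lintegral_mul_const' _ _ (by simpa using hB),
    lintegral_mul_const' _ _ (by simpa using hi), ← div_eq_mul_inv, ← div_eq_mul_inv,
    ← div_eq_mul_inv, ENNReal.div_rpow_of_nonneg _ _ hs.le, ENNReal.div_rpow_of_nonneg _ _ ht.le,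
        ← ENNReal.mul_div_mul_comm (Or.inl hAs) (Or.inl hAs')] at h2
  rwa [ENNReal.div_le_iff hi hi', ENNReal.div_mul_cancel hi hi'] at h2

lemma glc_pl_one (s t : ℝ) (hs : 0 < s) (ht : 0 < t) (hst : s + t = 1) (f g h : ℝ → ℝ≥0∞)
    (hf : Measurable f) (hg : Measurable g) (hh : Measurable h)
    (H : ∀ x y, f x ^ s * g y ^ t ≤ h (s * x + t * y)) :
    (∫⁻ x, f x) ^ s * (∫⁻ x, g x) ^ t ≤ ∫⁻ x, h x := by
  have trunc : ∀ f : ℝ → ℝ≥0∞, Measurable f →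
      ∫⁻ x, f x = ⨆ N : ℕ, ∫⁻ x, min (f x) N := by
    intro f hf
    rw [← lintegral_iSup (fun N => hf.min measurable_const)]
    · congr with x
      apply le_antisymm
      · refine le_of_forall_lt fun c hc => ?_
        obtain ⟨N, hN⟩ := ENNReal.exists_nat_gt (ne_top_of_lt hc)
        exact lt_of_lt_of_le (lt_min hc hN) (le_iSup (fun N : ℕ => min (f x) N) N)
      · exact iSup_le fun N => min_le_left _ _
    · intro N N' hN x
      exact min_le_min le_rfl (by exact_mod_cast hN)
  have mono : ∀ f : ℝ → ℝ≥0∞, Monotone fun N : ℕ => ∫⁻ x, min (f x) N := by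
    intro f N N' hN
    exact lintegral_mono fun x => min_le_min le_rfl (by exact_mod_cast hN)
  have e : ∀ (r : ℝ), 0 < r → ∀ a : ℕ → ℝ≥0∞, (⨆ N, a N) ^ r = ⨆ N, a N ^ r := by
    intro r hr a
    exact (ENNReal.orderIsoRpow r hr).map_iSup a
  rw [trunc f hf, trunc g hg, e s hs, e t ht, ENNReal.iSup_mul]
  refine iSup_le fun N => ?_
  rw [ENNReal.mul_iSup]
  refine iSup_le fun N' => ?_
  refine le_trans ?_ (glc_pl_bdd s t hs ht hst (fun x => min (f x) (max N N' : ℕ))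
    (fun x => min (g x) (max N N' : ℕ)) h
    (hf.min measurable_const) (hg.min measurable_const) hh (max N N' : ℕ) (by simp)
    (fun x => min_le_right _ _) (fun x => min_le_right _ _) ?_)
  · exact mul_le_mul' (ENNReal.rpow_le_rpow (mono f (le_max_left _ _)) hs.le)
      (ENNReal.rpow_le_rpow (mono g (le_max_right _ _)) ht.le)
  · intro x y
    exact (mul_le_mul' (ENNReal.rpow_le_rpow (min_le_left _ _) hs.le)
      (ENNReal.rpow_le_rpow (min_le_left _ _) ht.le)).trans (H x y)

lemma glc_pl (s t : ℝ) (hs : 0 < s) (ht : 0 < t) (hst : s + t = 1) (n : ℕ) :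
    ∀ (f g h : (Fin n → ℝ) → ℝ≥0∞),
    Measurable f → Measurable g → Measurable h →
    (∀ x y, f x ^ s * g y ^ t ≤ h (s • x + t • y)) →
    (∫⁻ x, f x) ^ s * (∫⁻ x, g x) ^ t ≤ ∫⁻ x, h x := by
  induction n with
  | zero =>
    intro f g h hf hg hh H
    have hv : (volume : Measure (Fin 0 → ℝ)) univ = 1 := by
      rw [volume_pi, Measure.pi_of_empty _ 0]; simp
    rw [lintegral_unique, lintegral_unique, lintegral_unique, hv]
    simp only [mul_one]
    convert H default default
  | succ n ih =>
    intro f g h hf hg hh H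
    let e := (MeasurableEquiv.piFinSuccAbove (fun _ : Fin (n + 1) => ℝ) 0).symm
    have he : MeasurePreserving e :=
      (volume_preserving_piFinSuccAbove (fun _ : Fin (n + 1) => ℝ) 0).symm _
    have fub : ∀ f : (Fin (n + 1) → ℝ) → ℝ≥0∞, Measurable f →
        ∫⁻ x, f x = ∫⁻ a : ℝ, ∫⁻ v : Fin n → ℝ, f (e (a, v)) := by
      intro f hf
      rw [← he.lintegral_comp hf]
      exact lintegral_prod _ (hf.comp e.measurable).aemeasurable
    have fm : ∀ f : (Fin (n + 1) → ℝ) → ℝ≥0∞, Measurable f →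
        Measurable fun a : ℝ => ∫⁻ v : Fin n → ℝ, f (e (a, v)) := by
      intro f hf
      exact (hf.comp e.measurable).lintegral_prod_right'
    rw [fub f hf, fub g hg, fub h hh]
    refine glc_pl_one s t hs ht hst _ _ _ (fm f hf) (fm g hg) (fm h hh) ?_
    intro a b
    refine ih _ _ _ (hf.comp (e.measurable.comp measurable_prodMk_left))
      (hg.comp (e.measurable.comp measurable_prodMk_left))
      (hh.comp (e.measurable.comp measurable_prodMk_left)) ?_
    intro x y
    refine (H (e (a, x)) (e (b, y))).trans (le_of_eq ?_)
    congr 1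
    ext i
    refine Fin.cases ?_ (fun j => ?_) i
    · simp [e, MeasurableEquiv.piFinSuccAbove]
    · simp [e, MeasurableEquiv.piFinSuccAbove]

/-- Unnormalised Gaussian integral over a set. -/
def glcInt {n : ℕ} (A : Set (Eu n)) : ℝ := ∫ x in A, Real.exp (-‖x‖ ^ 2 / 2)

lemma glc_cont {n : ℕ} : Continuous fun x : Eu n => Real.exp (-‖x‖ ^ 2 / 2) := by fun_prop

lemma glc_intOn {n : ℕ} (A : Set (Eu n)) (hA : IsCompact A) :
    IntegrableOn (fun x : Eu n => Real.exp (-‖x‖ ^ 2 / 2)) A :=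
  glc_cont.continuousOn.integrableOn_compact hA

lemma glcInt_nonneg {n : ℕ} (A : Set (Eu n)) : 0 ≤ glcInt A :=
  integral_nonneg fun x => (Real.exp_pos _).le

lemma glcInt_eq {n : ℕ} (A : Set (Eu n)) :
    glcInt A = (∫⁻ x in A, ENNReal.ofReal (Real.exp (-‖x‖ ^ 2 / 2))).toReal :=
  integral_eq_lintegral_of_nonneg_ae (Eventually.of_forall fun x => (Real.exp_pos _).le)
    glc_cont.aestronglyMeasurable

lemma glc_lint_ne_top {n : ℕ} (A : Set (Eu n)) (hA : IsCompact A) :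
    ∫⁻ x in A, ENNReal.ofReal (Real.exp (-‖x‖ ^ 2 / 2)) ≠ ⊤ := by
  have := (glc_intOn A hA).lintegral_lt_top
  exact this.ne

lemma glc_lint_pi {n : ℕ} (F : Eu n → ℝ≥0∞) (hF : Measurable F) :
    ∫⁻ x, F x = ∫⁻ v : Fin n → ℝ, F (WithLp.toLp 2 v) :=
  ((PiLp.volume_preserving_toLp (Fin n)).lintegral_comp hF).symm

lemma glc_pl_eu (s t : ℝ) (hs : 0 < s) (ht : 0 < t) (hst : s + t = 1) (n : ℕ)
    (f g h : Eu n → ℝ≥0∞) (hf : Measurable f) (hg : Measurable g) (hh : Measurable h)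
    (H : ∀ x y, f x ^ s * g y ^ t ≤ h (s • x + t • y)) :
    (∫⁻ x, f x) ^ s * (∫⁻ x, g x) ^ t ≤ ∫⁻ x, h x := by
  have hm : Measurable (WithLp.toLp 2 : (Fin n → ℝ) → Eu n) :=
    (PiLp.volume_preserving_toLp (Fin n)).measurable
  rw [glc_lint_pi f hf, glc_lint_pi g hg, glc_lint_pi h hh]
  exact glc_pl s t hs ht hst n _ _ _ (hf.comp hm) (hg.comp hm) (hh.comp hm)
    (fun x y => H (WithLp.toLp 2 x) (WithLp.toLp 2 y))

lemma glc_gauss (s t : ℝ) (hs : 0 < s) (ht : 0 < t) (hst : s + t = 1) (n : ℕ)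
    (A B : Set (Eu n)) (hA : IsCompact A) (hB : IsCompact B) (δ : ℝ) (hδ0 : 0 ≤ δ)
    (hδ : ∀ x ∈ A, ∀ y ∈ B, δ ≤ ‖x - y‖) :
    glcInt A ^ s * glcInt B ^ t ≤ Real.exp (-(s * t * δ ^ 2 / 2)) * glcInt (s • A + t • B) := by
  have hM : IsCompact (s • A + t • B) := (hA.smul s).add (hB.smul t)
  set w : Eu n → ℝ≥0∞ := fun x => ENNReal.ofReal (Real.exp (-‖x‖ ^ 2 / 2)) with hw
  have hwm : Measurable w := (ENNReal.continuous_ofReal.comp glc_cont).measurable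
  have key := glc_pl_eu s t hs ht hst n (A.indicator w) (B.indicator w)
    ((s • A + t • B).indicator
      fun z => ENNReal.ofReal (Real.exp (-(s * t * δ ^ 2 / 2))) * w z)
    (hwm.indicator hA.measurableSet) (hwm.indicator hB.measurableSet)
    ((hwm.const_mul _).indicator hM.measurableSet) (by
      intro x y
      by_cases hx : x ∈ A
      swap
      · simp [hx, hs]
      by_cases hy : y ∈ B
      swap
      · simp [hy, ht]
      have hz : s • x + t • y ∈ s • A + t • B :=
        add_mem_add (smul_mem_smul_set hx) (smul_mem_smul_set hy)
      rw [indicator_of_mem hx, indicator_of_mem hy, indicator_of_mem hz]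
      simp only [hw]
      rw [ENNReal.ofReal_rpow_of_pos (Real.exp_pos _), ENNReal.ofReal_rpow_of_pos (Real.exp_pos _),
        ← ENNReal.ofReal_mul (by positivity), ← ENNReal.ofReal_mul (by positivity),
        ← Real.exp_mul, ← Real.exp_mul, ← Real.exp_add, ← Real.exp_add]
      refine ENNReal.ofReal_le_ofReal (Real.exp_le_exp.2 ?_)
      have e1 : ‖s • x + t • y‖ ^ 2 = s ^ 2 * ‖x‖ ^ 2 + 2 * (s * t * ⟪x, y⟫) + t ^ 2 * ‖y‖ ^ 2 := by
        rw [norm_add_sq_real, norm_smul, norm_smul, real_inner_smul_left, real_inner_smul_right,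
          mul_pow, mul_pow, Real.norm_eq_abs, Real.norm_eq_abs, sq_abs, sq_abs]
        ring
      have e2 := norm_sub_sq_real x y
      have e3 : δ ^ 2 ≤ ‖x - y‖ ^ 2 := pow_le_pow_left₀ hδ0 (hδ x hx y hy) 2
      have e4 := mul_le_mul_of_nonneg_left e3 (mul_pos hs ht).le
      rw [e2] at e4
      rw [e1]
      obtain rfl : s = 1 - t := by linarith
      nlinarith)
  rw [lintegral_indicator hA.measurableSet, lintegral_indicator hB.measurableSet,
    lintegral_indicator hM.measurableSet, lintegral_const_mul _ hwm] at key
  have k2 := ENNReal.toReal_mono (ENNReal.mul_ne_top ENNReal.ofReal_ne_top (glc_lint_ne_top _ hM)) key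
  rw [ENNReal.toReal_mul, ENNReal.toReal_mul, ← ENNReal.toReal_rpow, ← ENNReal.toReal_rpow,
    ENNReal.toReal_ofReal (Real.exp_pos _).le] at k2
  rw [glcInt_eq, glcInt_eq, glcInt_eq]
  exact k2

lemma glcInt_pos {n : ℕ} (A : Set (Eu n)) (hA : IsCompact A) (U : Set (Eu n)) (hU : IsOpen U)
    (hUn : U.Nonempty) (hUA : U ⊆ A) : 0 < glcInt A := by
  unfold glcInt
  rw [setIntegral_pos_iff_support_of_nonneg_ae
    (Eventually.of_forall fun x => (Real.exp_pos _).le) (glc_intOn A hA)]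
  have : (Function.support fun x : Eu n => Real.exp (-‖x‖ ^ 2 / 2)) = univ := by
    ext x; simp [(Real.exp_pos _).ne']
  rw [this, univ_inter]
  exact (hU.measure_pos volume hUn).trans_le (measure_mono hUA)

lemma glc_hyper {n : ℕ} (l : Eu n →L[ℝ] ℝ) (hl : l ≠ 0) (b : ℝ) :
    volume {x : Eu n | l x = b} = 0 := by
  by_cases h : ∃ x0, l x0 = b
  · obtain ⟨x0, rfl⟩ := h
    have e : {x : Eu n | l x = l x0} = (fun x => x + -x0) ⁻¹' (l.ker : Set (Eu n)) := by
      ext x; simp [add_neg_eq_zero]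
    rw [e, measure_preimage_add_right]
    refine Measure.addHaar_submodule _ _ ?_
    intro h
    apply hl
    ext x
    have : x ∈ l.ker := by rw [h]; trivial
    simpa using this
  · push Not at h
    simp [h]

lemma glc_cut_cont {n : ℕ} (l : Eu n →L[ℝ] ℝ) (hl : l ≠ 0) (A : Set (Eu n)) (hA : IsCompact A) :
    Continuous fun b : ℝ => glcInt (A ∩ {x | b ≤ l x}) := by
  rw [continuous_iff_continuousAt]
  intro b
  have hmeas : ∀ b : ℝ, MeasurableSet {x : Eu n | b ≤ l x} := fun b =>
    measurableSet_le measurable_const l.continuous.measurable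
  have e : ∀ b, glcInt (A ∩ {x | b ≤ l x}) =
      ∫ x in A, {x | b ≤ l x}.indicator (fun x => Real.exp (-‖x‖ ^ 2 / 2)) x := by
    intro b
    rw [setIntegral_indicator (hmeas b)]; rfl
  simp only [e]
  refine continuousAt_of_dominated (bound := fun x => Real.exp (-‖x‖ ^ 2 / 2)) ?_ ?_
    (glc_intOn A hA) ?_
  · exact Eventually.of_forall fun b => (glc_cont.measurable.indicator (hmeas b)).aestronglyMeasurable
  · refine Eventually.of_forall fun b => Eventually.of_forall fun x => ?_
    refine (norm_indicator_le_norm_self _ _).trans ?_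
    simp
  · refine ae_restrict_of_ae ?_
    have : ∀ᵐ x : Eu n, l x ≠ b := by
      rw [ae_iff]; simpa using glc_hyper l hl b
    filter_upwards [this] with x hx
    rcases lt_or_gt_of_ne hx with h | h
    · refine (continuousAt_const (y := (0 : ℝ))).congr ?_
      filter_upwards [lt_mem_nhds h] with c hc
      rw [indicator_of_notMem]; simpa using hc
    · refine (continuousAt_const (y := Real.exp (-‖x‖ ^ 2 / 2))).congr ?_
      filter_upwards [gt_mem_nhds h] with c hc
      rw [indicator_of_mem]; exact hc.le

lemma glc_split {n : ℕ} (l : Eu n →L[ℝ] ℝ) (hl : l ≠ 0) (b : ℝ) (A B : Set (Eu n))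
    (hA : IsCompact A) (hB : IsCompact B) (h1 : ∀ x ∈ A, l x ≤ b) (h2 : ∀ x ∈ B, b ≤ l x) :
    glcInt (A ∪ B) = glcInt A + glcInt B := by
  unfold glcInt
  refine setIntegral_union₀ ?_ hB.measurableSet.nullMeasurableSet (glc_intOn A hA) (glc_intOn B hB)
  refine measure_mono_null ?_ (glc_hyper l hl b)
  rintro x ⟨hx, hy⟩
  exact le_antisymm (h1 x hx) (h2 x hy)

lemma glcInt_mono {n : ℕ} (A B : Set (Eu n)) (hB : IsCompact B) (h : A ⊆ B) :
    glcInt A ≤ glcInt B :=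
  setIntegral_mono_set (glc_intOn B hB) (Eventually.of_forall fun x => (Real.exp_pos _).le)
    h.eventuallyLE

lemma glc_strict (s t : ℝ) (hs : 0 < s) (ht : 0 < t) (hst : s + t = 1) (n : ℕ)
    (K L : Set (Eu n)) (hK : IsConvexBody K) (hL : IsConvexBody L) (hKL : ¬ K ⊆ L) :
    glcInt K ^ s * glcInt L ^ t < glcInt (s • K + t • L) := by
  obtain ⟨hKv, hKc, hKi⟩ := hK
  obtain ⟨hLv, hLc, hLi⟩ := hL
  obtain ⟨x, hxK, hxL⟩ : ∃ x ∈ interior K, x ∉ L := by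
    by_contra! h
    apply hKL
    calc K ⊆ closure K := subset_closure
      _ = closure (interior K) :=
        (hKv.closure_interior_eq_closure_of_nonempty_interior hKi).symm
      _ ⊆ L := hLc.isClosed.closure_subset_iff.2 h
  obtain ⟨l, c, hlL, hlx⟩ := geometric_hahn_banach_closed_point hLv hLc.isClosed hxL
  have hl : l ≠ 0 := by
    rintro rfl
    obtain ⟨y, hy⟩ := hLi
    have := hlL y (interior_subset hy)
    simp at this hlx
    linarith
  obtain ⟨d, hcd, hdx⟩ := exists_between hlx
  have cge : ∀ (A : Set (Eu n)) (b : ℝ), IsCompact A → IsCompact (A ∩ {x | b ≤ l x}) :=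
    fun A b hA => hA.inter_right (isClosed_le continuous_const l.continuous)
  have cle : ∀ (A : Set (Eu n)) (b : ℝ), IsCompact A → IsCompact (A ∩ {x | l x ≤ b}) :=
    fun A b hA => hA.inter_right (isClosed_le l.continuous continuous_const)
  have split : ∀ (A : Set (Eu n)) (b : ℝ), IsCompact A →
      glcInt A = glcInt (A ∩ {x | l x ≤ b}) + glcInt (A ∩ {x | b ≤ l x}) := by
    intro A b hA
    rw [← glc_split l hl b _ _ (cle A b hA) (cge A b hA) (fun x hx => hx.2) (fun x hx => hx.2),
      ← inter_union_distrib_left]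
    congr 1
    ext x
    simp [le_total]
  have hk : 0 < glcInt K := glcInt_pos K hKc _ isOpen_interior hKi interior_subset
  have hl0 : 0 < glcInt L := glcInt_pos L hLc _ isOpen_interior hLi interior_subset
  have hk2 : 0 < glcInt (K ∩ {x | d ≤ l x}) :=
    glcInt_pos _ (cge K d hKc) (interior K ∩ {x | d < l x})
      (isOpen_interior.inter (isOpen_lt continuous_const l.continuous)) ⟨x, hxK, hdx⟩
      (inter_subset_inter interior_subset (ofPred_subset_ofPred.2 fun y hy => le_of_lt hy))
  have hsK := split K d hKc
  have hk1 := glcInt_nonneg (K ∩ {x | l x ≤ d})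
  -- choose the cut of `L`
  obtain ⟨b, hb⟩ : ∃ b, glcInt (L ∩ {x | b ≤ l x}) =
      glcInt (K ∩ {x | d ≤ l x}) / glcInt K * glcInt L := by
    obtain ⟨b0, hb0⟩ := (hLc.image l.continuous).bddBelow
    have hr := mem_range_of_exists_le_of_exists_ge (glc_cut_cont l hl L hLc)
      (c := glcInt (K ∩ {x | d ≤ l x}) / glcInt K * glcInt L) ⟨c, ?_⟩ ⟨b0, ?_⟩
    · exact hr
    · have : L ∩ {x | c ≤ l x} = ∅ := by
        ext y; simp only [mem_inter_iff, mem_setOf_eq, mem_empty_iff_false, iff_false, not_and, not_le]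
        exact hlL y
      rw [this]
      have : glcInt (∅ : Set (Eu n)) = 0 := by simp [glcInt]
      rw [this]; positivity
    · have : L ∩ {x | b0 ≤ l x} = L := by
        rw [inter_eq_left]
        intro y hy
        exact hb0 (mem_image_of_mem _ hy)
      rw [this]
      have : glcInt (K ∩ {x | d ≤ l x}) / glcInt K ≤ 1 := by rw [div_le_one hk]; linarith
      nlinarith
  have hsL := split L b hLc
  set K1 := K ∩ {x | l x ≤ d}
  set K2 := K ∩ {x | d ≤ l x}
  set L1 := L ∩ {x | l x ≤ b}
  set L2 := L ∩ {x | b ≤ l x}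
  have hM : IsCompact (s • K + t • L) := (hKc.smul s).add (hLc.smul t)
  have hM1 : IsCompact (s • K1 + t • L1) := ((cle K d hKc).smul s).add ((cle L b hLc).smul t)
  have hM2 : IsCompact (s • K2 + t • L2) := ((cge K d hKc).smul s).add ((cge L b hLc).smul t)
  have hsum : glcInt (s • K1 + t • L1) + glcInt (s • K2 + t • L2) ≤ glcInt (s • K + t • L) := by
    rw [← glc_split l hl (s * d + t * b) _ _ hM1 hM2]
    · refine glcInt_mono _ _ hM (union_subset ?_ ?_)
      · exact add_subset_add (smul_set_mono inter_subset_left) (smul_set_mono inter_subset_left)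
      · exact add_subset_add (smul_set_mono inter_subset_left) (smul_set_mono inter_subset_left)
    · rintro _ ⟨_, ⟨p, hp, rfl⟩, _, ⟨q, hq, rfl⟩, rfl⟩
      have h1 : l p ≤ d := hp.2
      have h2 : l q ≤ b := hq.2
      simp only [map_add, map_smul, smul_eq_mul]
      gcongr
    · rintro _ ⟨_, ⟨p, hp, rfl⟩, _, ⟨q, hq, rfl⟩, rfl⟩
      have h1 : d ≤ l p := hp.2
      have h2 : b ≤ l q := hq.2
      simp only [map_add, map_smul, smul_eq_mul]
      gcongr
  have hln : 0 < ‖l‖ := norm_pos_iff.2 hl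
  have hδ : 0 < (d - c) / ‖l‖ := div_pos (by linarith) hln
  have g1 := glc_gauss s t hs ht hst n K1 L1 (cle K d hKc) (cle L b hLc) 0 le_rfl
    (fun x _ y _ => norm_nonneg _)
  have g2 := glc_gauss s t hs ht hst n K2 L2 (cge K d hKc) (cge L b hLc) ((d - c) / ‖l‖) hδ.le (by
    intro p hp q hq
    rw [div_le_iff₀ hln, mul_comm]
    have h1 : d ≤ l p := hp.2
    have h2 : l q < c := hlL q hq.1
    have h3 := l.le_opNorm (p - q)
    rw [map_sub, Real.norm_eq_abs] at h3
    have h4 := le_abs_self (l p - l q)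
    linarith)
  set r := glcInt K2 / glcInt K with hr
  have hr0 : 0 < r := div_pos hk2 hk
  have hr1 : r ≤ 1 := by rw [hr, div_le_one hk]; linarith
  have eK2 : glcInt K2 = r * glcInt K := by rw [hr]; field_simp
  have eK1 : glcInt K1 = (1 - r) * glcInt K := by linarith
  have eL1 : glcInt L1 = (1 - r) * glcInt L := by linarith
  have pw : ∀ q : ℝ, 0 ≤ q → (q * glcInt K) ^ s * (q * glcInt L) ^ t =
      q * (glcInt K ^ s * glcInt L ^ t) := by
    intro q hq
    rw [Real.mul_rpow hq hk.le, Real.mul_rpow hq hl0.le]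
    have : q ^ s * q ^ t = q := by
      rw [← Real.rpow_add_of_nonneg hq hs.le ht.le, hst, Real.rpow_one]
    calc _ = (q ^ s * q ^ t) * (glcInt K ^ s * glcInt L ^ t) := by ring
      _ = _ := by rw [this]
  rw [eK1, eL1, pw _ (by linarith)] at g1
  rw [eK2, hb, pw _ hr0.le] at g2
  simp only [ne_eq, OfNat.ofNat_ne_zero, not_false_eq_true, zero_pow, mul_zero, zero_div, neg_zero,
    Real.exp_zero, one_mul] at g1
  have hP : 0 < glcInt K ^ s * glcInt L ^ t := by positivity
  have hE : Real.exp (-(s * t * ((d - c) / ‖l‖) ^ 2 / 2)) < 1 := by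
    rw [Real.exp_lt_one_iff]
    have : 0 < s * t * ((d - c) / ‖l‖) ^ 2 / 2 := by positivity
    linarith
  have hE0 := Real.exp_pos (-(s * t * ((d - c) / ‖l‖) ^ 2 / 2))
  have hrP : 0 < r * (glcInt K ^ s * glcInt L ^ t) := mul_pos hr0 hP
  have hM2pos : 0 < glcInt (s • K2 + t • L2) := by
    by_contra! h
    nlinarith
  have : r * (glcInt K ^ s * glcInt L ^ t) < glcInt (s • K2 + t • L2) := by nlinarith
  nlinarith

/-- Log-concavity of the Gaussian measure on convex bodies, with its equality
condition: `γₙ((1-t)K + tL) ≥ γₙ(K)^{1-t} γₙ(L)^t`, with equality iff `K = L`. -/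
theorem gaussian_log_concavity
    (n : ℕ) (hn : 1 ≤ n) (K L : Set (Eu n)) (hK : IsConvexBody K) (hL : IsConvexBody L)
    (t : ℝ) (ht0 : 0 < t) (ht1 : t < 1) :
    gaussVol n K ^ (1 - t) * gaussVol n L ^ t ≤ gaussVol n ((1 - t) • K + t • L) ∧
    (gaussVol n ((1 - t) • K + t • L) = gaussVol n K ^ (1 - t) * gaussVol n L ^ t ↔
      K = L) := by
  obtain ⟨s, hs⟩ : ∃ s, s = 1 - t := ⟨_, rfl⟩
  have hs0 : 0 < s := by linarith
  have hst : s + t = 1 := by linarith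
  rw [← hs]
  have hc : 0 < (Real.sqrt (2 * Real.pi))⁻¹ ^ n := by positivity
  have hg : ∀ A : Set (Eu n), gaussVol n A = (Real.sqrt (2 * Real.pi))⁻¹ ^ n * glcInt A :=
    fun A => rfl
  have hpw : gaussVol n K ^ s * gaussVol n L ^ t =
      (Real.sqrt (2 * Real.pi))⁻¹ ^ n * (glcInt K ^ s * glcInt L ^ t) := by
    rw [hg, hg]
    generalize (Real.sqrt (2 * Real.pi))⁻¹ ^ n = q at *
    rw [Real.mul_rpow hc.le (glcInt_nonneg K), Real.mul_rpow hc.le (glcInt_nonneg L)]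
    have : q ^ s * q ^ t = q := by
      rw [← Real.rpow_add_of_nonneg hc.le hs0.le ht0.le, hst, Real.rpow_one]
    calc _ = (q ^ s * q ^ t) * (glcInt K ^ s * glcInt L ^ t) := by ring
      _ = _ := by rw [this]
  have hlt : K ≠ L → gaussVol n K ^ s * gaussVol n L ^ t < gaussVol n (s • K + t • L) := by
    intro hne
    rw [hpw, hg]
    refine mul_lt_mul_of_pos_left ?_ hc
    by_cases h : K ⊆ L
    · have h' : ¬ L ⊆ K := fun h' => hne (h.antisymm h')
      have := glc_strict t s ht0 hs0 (by linarith) n L K hL hK h'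
      rwa [mul_comm, add_comm] at this
    · exact glc_strict s t hs0 ht0 hst n K L hK hL h
  have heq : K = L → gaussVol n (s • K + t • L) = gaussVol n K ^ s * gaussVol n L ^ t := by
    rintro rfl
    rw [hpw, hg, ← hK.1.add_smul hs0.le ht0.le, hst, one_smul,
      ← Real.rpow_add_of_nonneg (glcInt_nonneg K) hs0.le ht0.le, hst, Real.rpow_one]
  refine ⟨?_, ?_, heq⟩
  · by_cases h : K = L
    · exact (heq h).ge
    · exact (hlt h).le
  · intro h
    by_contra hne
    exact (hlt hne).ne' h
end
end
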